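/- Operational-separation achievability for the DM MARC: Let a DM MARC with correlated sources (S1,S2), relay side information W3 and destination side information W be given, and let κ > 0. Suppose there exist finite auxiliary alphabets V1, V2 and a joint distribution of the form p(s1,s2,w3,w)·p(v1)·p(x1|v1)·p(v2)·p(x2|v2)·p(x3|v1,v2), with (Y,Y3) generated from (X1,X2,X3) by the channel transition law, such that H(S1|S2,W3) < κ·I(X1;Y3|X2,V1,X3), H(S2|S1,W3) < κ·I(X2;Y3|X1,V2,X3), H(S1,S2|W3) < κ·I(X1,X2;Y3|V1,V2,X3), H(S1|S2,W) < κ·I(X1,X3;Y|X2,V2), H(S2|S1,W) < κ·I(X2,X3;Y|X1,V1), and H(S1,S2|W) < κ·I(X1,X2,X3;Y). Then the source-channel rate κ is achievable for the DM MARC. -/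

import Mathlib

open scoped BigOperators
open Finset

noncomputable section
open scoped Classical

namespace Paper

def pr {Ω A : Type*} [Fintype Ω] (μ : Ω → ℝ) (X : Ω → A) (a : A) : ℝ :=
  ∑ ω, if X ω = a then μ ω else 0

def Hent {Ω A : Type*} [Fintype Ω] [Fintype A] (μ : Ω → ℝ) (X : Ω → A) : ℝ :=
  - ∑ a, pr μ X a * Real.logb 2 (pr μ X a)

def condEnt {Ω A B : Type*} [Fintype Ω] [Fintype A] [Fintype B]
    (μ : Ω → ℝ) (X : Ω → A) (Y : Ω → B) : ℝ :=
  Hent μ (fun ω => (X ω, Y ω)) - Hent μ Y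

def mutInfo {Ω A B : Type*} [Fintype Ω] [Fintype A] [Fintype B]
    (μ : Ω → ℝ) (X : Ω → A) (Y : Ω → B) : ℝ :=
  Hent μ X + Hent μ Y - Hent μ (fun ω => (X ω, Y ω))

def condMutInfo {Ω A B C : Type*} [Fintype Ω] [Fintype A] [Fintype B] [Fintype C]
    (μ : Ω → ℝ) (X : Ω → A) (Y : Ω → B) (Z : Ω → C) : ℝ :=
  condEnt μ X Z - condEnt μ X (fun ω => (Y ω, Z ω))

structure SourcePMF (S : Type) [Fintype S] where
  q : S → ℝ
  nonneg : ∀ s, 0 ≤ q s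
  sum_one : ∑ s, q s = 1

/-- A discrete memoryless multiple-access relay channel. -/
structure DMMARC (X1 X2 X3 Y Y3 : Type) [Fintype X1] [Fintype X2] [Fintype X3]
    [Fintype Y] [Fintype Y3] where
  P : X1 → X2 → X3 → Y → Y3 → ℝ
  nonneg : ∀ x1 x2 x3 y y3, 0 ≤ P x1 x2 x3 y y3
  sum_one : ∀ x1 x2 x3, ∑ y : Y, ∑ y3 : Y3, P x1 x2 x3 y y3 = 1

/-- An (m,n) source-channel code for the MARC: two encoders, a causal relay
encoding function and a destination decoder. -/
structure MARCCode (S1 S2 W W3 X1 X2 X3 Y Y3 : Type) (m n : ℕ) where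
  f1 : (Fin m → S1) → Fin n → X1
  f2 : (Fin m → S2) → Fin n → X2
  f3 : (k : Fin n) → (Fin k.val → Y3) → (Fin m → W3) → X3
  g : (Fin n → Y) → (Fin m → W) → (Fin m → S1) × (Fin m → S2)

variable {S1 S2 W W3 X1 X2 X3 Y Y3 : Type} {m n : ℕ}

/-- The relay channel input at time `k` (causal function of past relay outputs and `W3^m`). -/
def relayIn (c : MARCCode S1 S2 W W3 X1 X2 X3 Y Y3 m n)
    (y3 : Fin n → Y3) (w3 : Fin m → W3) (k : Fin n) : X3 :=
  c.f3 k (fun j => y3 ⟨j.val, j.isLt.trans k.isLt⟩) w3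

section
variable [Fintype S1] [Fintype S2] [Fintype W] [Fintype W3]
  [Fintype X1] [Fintype X2] [Fintype X3] [Fintype Y] [Fintype Y3]

/-- Joint law on (source sequences, destination outputs, relay outputs)
induced by the i.i.d. source, the encoders, the causal relay function and the
memoryless channel. -/
def marcLaw (src : SourcePMF (S1 × S2 × W × W3)) (ch : DMMARC X1 X2 X3 Y Y3)
    (c : MARCCode S1 S2 W W3 X1 X2 X3 Y Y3 m n) :
    ((Fin m → S1 × S2 × W × W3) × (Fin n → Y) × (Fin n → Y3)) → ℝ :=
  fun ω => (∏ i, src.q (ω.1 i)) *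
    ∏ k, ch.P (c.f1 (fun i => (ω.1 i).1) k) (c.f2 (fun i => (ω.1 i).2.1) k)
      (relayIn c ω.2.2 (fun i => (ω.1 i).2.2.2) k) (ω.2.1 k) (ω.2.2 k)

/-- Error probability of a MARC source-channel code. -/
def marcErr (src : SourcePMF (S1 × S2 × W × W3)) (ch : DMMARC X1 X2 X3 Y Y3)
    (c : MARCCode S1 S2 W W3 X1 X2 X3 Y Y3 m n) : ℝ :=
  ∑ ω : (Fin m → S1 × S2 × W × W3) × (Fin n → Y) × (Fin n → Y3),
    if c.g ω.2.1 (fun i => (ω.1 i).2.2.1) ≠ (fun i => (ω.1 i).1, fun i => (ω.1 i).2.1)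
    then marcLaw src ch c ω else 0

/-- Achievability of the source-channel rate `κ` for the DM MARC. -/
def marcAchievable (src : SourcePMF (S1 × S2 × W × W3)) (ch : DMMARC X1 X2 X3 Y Y3)
    (κ : ℝ) : Prop :=
  ∀ ε : ℝ, 0 < ε → ∃ m0 n0 : ℕ, ∀ m n : ℕ, m0 < m → n0 < n → (n : ℝ) / m = κ →
    ∃ c : MARCCode S1 S2 W W3 X1 X2 X3 Y Y3 m n, marcErr src ch c < ε

end



section OperationalSeparation

variable {S1 S2 W W3 V1 V2 X1 X2 X3 Y Y3 : Type}
  [Fintype S1] [Fintype S2] [Fintype W] [Fintype W3] [Fintype V1] [Fintype V2]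
  [Fintype X1] [Fintype X2] [Fintype X3] [Fintype Y] [Fintype Y3]

/-- The joint single-letter law
`p(s1,s2,w3,w)·p(v1)·p(x1|v1)·p(v2)·p(x2|v2)·p(x3|v1,v2)·p(y,y3|x1,x2,x3)`.
Coordinates: `z.1 = (s1,s2,w,w3)`, then `v1, v2, x1, x2, x3, y, y3`. -/
def opSepLaw (src : SourcePMF (S1 × S2 × W × W3)) (ch : DMMARC X1 X2 X3 Y Y3)
    (pV1 : V1 → ℝ) (pX1 : V1 → X1 → ℝ) (pV2 : V2 → ℝ) (pX2 : V2 → X2 → ℝ)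
    (pX3 : V1 → V2 → X3 → ℝ) :
    ((S1 × S2 × W × W3) × V1 × V2 × X1 × X2 × X3 × Y × Y3) → ℝ :=
  fun z => src.q z.1 * pV1 z.2.1 * pX1 z.2.1 z.2.2.2.1 * pV2 z.2.2.1
    * pX2 z.2.2.1 z.2.2.2.2.1 * pX3 z.2.1 z.2.2.1 z.2.2.2.2.2.1
    * ch.P z.2.2.2.1 z.2.2.2.2.1 z.2.2.2.2.2.1 z.2.2.2.2.2.2.1 z.2.2.2.2.2.2.2

/-- Expectation of `F` against a weight `p` on a finite type. -/
def ex {α : Type*} [Fintype α] (p F : α → ℝ) : ℝ := ∑ a, p a * F a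

/-- Product weight on functions. -/
def pm {ι α : Type*} [Fintype ι] (p : ι → α → ℝ) : (ι → α) → ℝ := fun f => ∏ i, p i (f i)

/-- Real-valued indicator of a proposition. -/
def ind (P : Prop) : ℝ := if P then 1 else 0

/-- `p` is a probability mass function. -/
structure IsPmf {α : Type*} [Fintype α] (p : α → ℝ) : Prop where
  nonneg : ∀ a, 0 ≤ p a
  sum_one : ∑ a, p a = 1

section Indicator

lemma ind_nonneg (P : Prop) : 0 ≤ ind P := by unfold ind; split_ifs <;> norm_num

lemma ind_le_one (P : Prop) : ind P ≤ 1 := by unfold ind; split_ifs <;> norm_num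

lemma ind_true {P : Prop} (h : P) : ind P = 1 := if_pos h

lemma ind_false {P : Prop} (h : ¬ P) : ind P = 0 := if_neg h

lemma ind_mono {P Q : Prop} (h : P → Q) : ind P ≤ ind Q := by
  by_cases hP : P
  · rw [ind_true hP, ind_true (h hP)]
  · rw [ind_false hP]; exact ind_nonneg Q

lemma ind_or_le (P Q : Prop) : ind (P ∨ Q) ≤ ind P + ind Q := by
  unfold ind
  by_cases hP : P <;> by_cases hQ : Q <;> simp [hP, hQ]

lemma ind_exists_le {α : Type*} [Fintype α] (P : α → Prop) : ind (∃ a, P a) ≤ ∑ a, ind (P a) := by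
  by_cases h : ∃ a, P a
  · obtain ⟨a, ha⟩ := h
    calc ind (∃ a, P a) ≤ 1 := ind_le_one _
      _ = ind (P a) := (ind_true ha).symm
      _ ≤ ∑ a, ind (P a) :=
        Finset.single_le_sum (f := fun a => ind (P a)) (fun _ _ => ind_nonneg _) (mem_univ a)
  · rw [ind_false h]; exact Finset.sum_nonneg fun _ _ => ind_nonneg _

end Indicator

section Expectation

variable {α γ ι κ : Type*} [Fintype α] [Fintype γ]

lemma IsPmf.nonempty {p : α → ℝ} (hp : IsPmf p) : Nonempty α := by
  by_contra h
  rw [not_nonempty_iff] at h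
  have := hp.sum_one
  simp at this

lemma ex_mono_of_pos {p F G : α → ℝ} (hp : ∀ a, 0 ≤ p a) (h : ∀ a, 0 < p a → F a ≤ G a) :
    ex p F ≤ ex p G := by
  refine Finset.sum_le_sum fun a _ => ?_
  rcases (hp a).eq_or_lt with h0 | h0
  · simp [← h0]
  · exact mul_le_mul_of_nonneg_left (h a h0) (hp a)

lemma ex_mono {p F G : α → ℝ} (hp : ∀ a, 0 ≤ p a) (h : ∀ a, F a ≤ G a) : ex p F ≤ ex p G :=
  ex_mono_of_pos hp fun a _ => h a

lemma ex_congr {p F G : α → ℝ} (h : ∀ a, F a = G a) : ex p F = ex p G :=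
  congrArg (ex p) (funext h)

lemma ex_nonneg {p F : α → ℝ} (hp : ∀ a, 0 ≤ p a) (h : ∀ a, 0 ≤ F a) : 0 ≤ ex p F :=
  Finset.sum_nonneg fun a _ => mul_nonneg (hp a) (h a)

lemma ex_const {p : α → ℝ} (hp : IsPmf p) (c : ℝ) : ex p (fun _ => c) = c := by
  unfold ex; rw [← Finset.sum_mul, hp.sum_one, one_mul]

lemma ex_add (p F G : α → ℝ) : ex p (fun a => F a + G a) = ex p F + ex p G := by
  simp only [ex, mul_add, Finset.sum_add_distrib]

lemma ex_sub (p F G : α → ℝ) : ex p (fun a => F a - G a) = ex p F - ex p G := by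
  simp only [ex, mul_sub, Finset.sum_sub_distrib]

lemma ex_mul_left (p F : α → ℝ) (c : ℝ) : ex p (fun a => c * F a) = c * ex p F := by
  simp only [ex, Finset.mul_sum]; exact Finset.sum_congr rfl fun _ _ => by ring

lemma ex_mul_right (p F : α → ℝ) (c : ℝ) : ex p (fun a => F a * c) = ex p F * c := by
  simp only [ex, Finset.sum_mul]; exact Finset.sum_congr rfl fun _ _ => by ring

lemma ex_sum (p : α → ℝ) (s : Finset ι) (F : ι → α → ℝ) :
    ex p (fun a => ∑ i ∈ s, F i a) = ∑ i ∈ s, ex p (F i) := by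
  simp only [ex, Finset.mul_sum]; exact Finset.sum_comm

lemma ex_comm (p : α → ℝ) (q : γ → ℝ) (F : α → γ → ℝ) :
    ex p (fun a => ex q fun b => F a b) = ex q fun b => ex p fun a => F a b := by
  simp only [ex, Finset.mul_sum]; rw [Finset.sum_comm]
  exact Finset.sum_congr rfl fun _ _ => Finset.sum_congr rfl fun _ _ => by ring

lemma exists_le_of_ex_le {p F : α → ℝ} (hp : IsPmf p) {δ : ℝ} (h : ex p F ≤ δ) :
    ∃ a, F a ≤ δ := by
  by_contra! hc
  have h1 : ex p (fun a => F a - δ) ≤ 0 := by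
    rw [ex_sub, ex_const hp]; linarith
  have h2 : ∀ a, 0 ≤ p a * (F a - δ) := fun a =>
    mul_nonneg (hp.nonneg a) (by linarith [hc a])
  have h3 : ∑ a, p a * (F a - δ) = 0 := le_antisymm h1 (Finset.sum_nonneg fun a _ => h2 a)
  have h4 := (Finset.sum_eq_zero_iff_of_nonneg fun a _ => h2 a).1 h3
  have h5 : ∀ a, p a = 0 := fun a => by
    rcases mul_eq_zero.1 (h4 a (mem_univ a)) with h | h
    · exact h
    · linarith [hc a]
  have := hp.sum_one
  simp [h5] at this

end Expectation

section Product

variable {ι κ α γ : Type*} [Fintype ι] [DecidableEq ι] [Fintype κ] [DecidableEq κ]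
  [Fintype α] [Fintype γ]

lemma pm_nonneg {ι α : Type*} [Fintype ι] {p : ι → α → ℝ} (hp : ∀ i a, 0 ≤ p i a) (f : ι → α) : 0 ≤ pm p f :=
  Finset.prod_nonneg fun i _ => hp i (f i)

lemma ex_pm_prod (p g : ι → α → ℝ) :
    ex (pm p) (fun f => ∏ i, g i (f i)) = ∏ i, ex (p i) (g i) := by
  simp only [ex, pm, ← Finset.prod_mul_distrib]
  rw [Finset.prod_univ_sum, Fintype.piFinset_univ]

lemma pm_isPmf {p : ι → α → ℝ} (hp : ∀ i, IsPmf (p i)) : IsPmf (pm p) := by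
  refine ⟨pm_nonneg fun i => (hp i).nonneg, ?_⟩
  have := ex_pm_prod p (fun _ _ => 1)
  simp only [ex_const (hp _), Finset.prod_const_one] at this
  simpa [ex] using this

lemma ex_pm_comp {p : ι → α → ℝ} (hp : ∀ i, IsPmf (p i)) {e : κ → ι}
    (he : Function.Injective e) (F : (κ → α) → ℝ) :
    ex (pm p) (fun f => F (fun j => f (e j))) = ex (pm fun j => p (e j)) F := by
  have key : ∀ g : κ → α, ex (pm p) (fun f => ∏ j, ind (f (e j) = g j)) =
      ∏ j, p (e j) (g j) := by
    intro g
    have h1 : ∀ f : ι → α, ∏ j, ind (f (e j) = g j) =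
        ∏ i, ∏ j, if e j = i then ind (f i = g j) else 1 := by
      intro f
      rw [Finset.prod_comm]
      exact Finset.prod_congr rfl fun j _ => by simp
    simp only [h1]
    rw [ex_pm_prod p (fun i a => ∏ j, if e j = i then ind (a = g j) else 1)]
    symm
    refine Fintype.prod_of_injective e he _ _ ?_ ?_
    · intro i hi
      have : ∀ j, e j ≠ i := fun j hj => hi ⟨j, hj⟩
      simp [this, ex_const (hp i)]
    · intro j
      have : ∀ j', (e j' = e j) ↔ (j' = j) := fun j' => he.eq_iff
      simp [this, ex, ind]
  have h2 : ∀ f : ι → α, F (fun j => f (e j)) = ∑ g, F g * ∏ j, ind (f (e j) = g j) := by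
    intro f
    rw [Finset.sum_eq_single (fun j => f (e j))]
    · simp [ind]
    · intro g _ hg
      obtain ⟨j, hj⟩ := Function.ne_iff.1 hg
      rw [Finset.prod_eq_zero (mem_univ j) (ind_false fun h => hj h.symm), mul_zero]
    · simp
  simp only [h2]
  rw [ex_sum]
  simp only [ex_mul_left, key]
  unfold ex pm
  exact Finset.sum_congr rfl fun _ _ => mul_comm _ _

lemma ex_pm_one {p : ι → α → ℝ} (hp : ∀ i, IsPmf (p i)) (i : ι) (F : α → ℝ) :
    ex (pm p) (fun f => F (f i)) = ex (p i) F := by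
  have := ex_pm_comp hp (e := fun _ : Fin 1 => i) (Function.injective_of_subsingleton _)
    (fun g => F (g 0))
  rw [this]
  unfold ex pm
  refine Fintype.sum_equiv (Equiv.funUnique (Fin 1) α) _ _ fun g => ?_
  simp

lemma ex_pm_two {p : ι → α → ℝ} (hp : ∀ i, IsPmf (p i)) {i j : ι} (hij : i ≠ j)
    (F : α → α → ℝ) :
    ex (pm p) (fun f => F (f i) (f j)) = ex (p i) fun a => ex (p j) fun b => F a b := by
  have hinj : Function.Injective (fun b : Fin 2 => if b = 0 then i else j) := by
    intro a b h
    fin_cases a <;> fin_cases b <;> simp_all [eq_comm]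
  have := ex_pm_comp hp hinj (fun g => F (g 0) (g 1))
  simp only [if_true, one_ne_zero, if_false] at this
  rw [this]
  unfold ex pm
  simp only [Finset.mul_sum]
  rw [← Finset.sum_product', Finset.univ_product_univ]
  refine Fintype.sum_equiv (finTwoArrowEquiv α) _ _ fun g => ?_
  simp [Fin.prod_univ_two, mul_assoc]

lemma ex_prod (p : α → ℝ) (r : α → γ → ℝ) (F : α × γ → ℝ) :
    ex (fun x : α × γ => p x.1 * r x.1 x.2) F = ex p fun a => ex (r a) fun b => F (a, b) := by
  unfold ex
  rw [Fintype.sum_prod_type]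
  simp only [Finset.mul_sum, mul_assoc]

lemma ex_pm_zip (p : ι → α → ℝ) (r : ι → α → γ → ℝ) (F : (ι → α) → (ι → γ) → ℝ) :
    ex (pm p) (fun f => ex (pm fun i => r i (f i)) fun g => F f g) =
      ex (pm fun i (x : α × γ) => p i x.1 * r i x.1 x.2)
        fun h => F (fun i => (h i).1) (fun i => (h i).2) := by
  unfold ex pm
  simp only [Finset.mul_sum]
  rw [← Finset.sum_product', Finset.univ_product_univ]
  refine (Fintype.sum_equiv (Equiv.arrowProdEquivProdArrow ι (fun _ => α) (fun _ => γ)) _ _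
    fun h => ?_).symm
  simp [Finset.prod_mul_distrib, Equiv.arrowProdEquivProdArrow, mul_assoc]

/-- Weak law of large numbers for finitely supported i.i.d. variables. -/
lemma weak_law {p : α → ℝ} (hp : IsPmf p) (f : α → ℝ) {δ : ℝ} (hδ : 0 < δ) {N : ℕ}
    (hN : 0 < N) :
    ex (pm fun _ : Fin N => p) (fun ω => ind (δ * N ≤ |∑ i, f (ω i) - N * ex p f|)) ≤
      ex p (fun a => (f a - ex p f) ^ 2) / δ ^ 2 / N := by
  have hNR : (0 : ℝ) < N := by exact_mod_cast hN
  set μ := ex p f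
  set g : α → ℝ := fun a => f a - μ with hg
  have hg0 : ex p g = 0 := by rw [hg, ex_sub, ex_const hp]; exact sub_self _
  have hpm : IsPmf (pm fun _ : Fin N => p) := pm_isPmf fun _ => hp
  have hsecond : ex (pm fun _ : Fin N => p) (fun ω => (∑ i, g (ω i)) ^ 2) =
      N * ex p (fun a => g a ^ 2) := by
    have h1 : ∀ ω : Fin N → α, (∑ i, g (ω i)) ^ 2 = ∑ i, ∑ j, g (ω i) * g (ω j) := fun ω => by
      rw [sq, Finset.sum_mul_sum]
    simp only [h1]
    rw [ex_sum]
    have h2 : ∀ i : Fin N, ex (pm fun _ : Fin N => p) (fun ω => ∑ j, g (ω i) * g (ω j)) =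
        ex p (fun a => g a ^ 2) := by
      intro i
      rw [ex_sum, Finset.sum_eq_single i]
      · rw [← ex_pm_one (fun _ : Fin N => hp) i (fun a => g a ^ 2)]
        simp only [sq]
      · intro j _ hj
        rw [ex_pm_two (fun _ : Fin N => hp) hj.symm (fun a b => g a * g b)]
        simp only [ex_mul_left, hg0, mul_zero, ex_const hp]
      · simp
    simp [h2]
  have hpt : ∀ ω : Fin N → α, ind (δ * N ≤ |∑ i, f (ω i) - N * μ|) ≤
      ((δ * N) ^ 2)⁻¹ * (∑ i, g (ω i)) ^ 2 := by
    intro ω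
    have hs : ∑ i, g (ω i) = ∑ i, f (ω i) - N * μ := by simp [hg, Finset.sum_sub_distrib]
    by_cases h : δ * N ≤ |∑ i, f (ω i) - N * μ|
    · rw [ind_true h, hs]
      have hpos : 0 < δ * N := by positivity
      have := pow_le_pow_left₀ hpos.le h 2
      rw [sq_abs] at this
      rwa [inv_mul_eq_div, le_div_iff₀ (by positivity), one_mul]
    · rw [ind_false h]; positivity
  calc _ ≤ ex (pm fun _ : Fin N => p) (fun ω => ((δ * N) ^ 2)⁻¹ * (∑ i, g (ω i)) ^ 2) :=
        ex_mono hpm.nonneg hpt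
    _ = _ := by
        rw [ex_mul_left, hsecond]
        field_simp
        rfl

end Product

section OneShot

/-- Some pair satisfying `pass`, or an arbitrary one if there is none. -/
def thresholdDecode {A B : Type*} [Nonempty (A × B)] (pass : A → B → Prop) : A × B :=
  if h : ∃ k : A × B, pass k.1 k.2 then Classical.choose h else Classical.arbitrary _

lemma ind_thresholdDecode_ne_le {A B : Type*} [Fintype A] [Fintype B] [Nonempty (A × B)]
    (p₁ p₂ p₃ : A → B → Prop) (a : A) (b : B) :
    ind (thresholdDecode (fun a b => p₁ a b ∧ p₂ a b ∧ p₃ a b) ≠ (a, b)) ≤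
      ind (¬ p₁ a b) + ind (¬ p₂ a b) + ind (¬ p₃ a b) + ∑ a', ind (a' ≠ a ∧ p₁ a' b)
        + ∑ b', ind (b' ≠ b ∧ p₂ a b') + ∑ a', ∑ b', ind (a' ≠ a ∧ b' ≠ b ∧ p₃ a' b') := by
  have key : thresholdDecode (fun a b => p₁ a b ∧ p₂ a b ∧ p₃ a b) ≠ (a, b) →
      ((((¬ p₁ a b ∨ ¬ p₂ a b) ∨ ¬ p₃ a b) ∨ ∃ a', a' ≠ a ∧ p₁ a' b) ∨ ∃ b', b' ≠ b ∧ p₂ a b') ∨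
        ∃ a', ∃ b', a' ≠ a ∧ b' ≠ b ∧ p₃ a' b' := by
    intro hne
    by_cases hp : p₁ a b ∧ p₂ a b ∧ p₃ a b
    · have hex : ∃ k : A × B, p₁ k.1 k.2 ∧ p₂ k.1 k.2 ∧ p₃ k.1 k.2 := ⟨(a, b), hp⟩
      rw [thresholdDecode, dif_pos hex] at hne
      have hs := Classical.choose_spec hex
      set k := Classical.choose hex
      by_cases h1 : k.1 = a
      · have h2 : k.2 ≠ b := fun h2 => hne (Prod.ext h1 h2)
        exact Or.inl (Or.inr ⟨k.2, h2, h1 ▸ hs.2.1⟩)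
      · by_cases h2 : k.2 = b
        · exact Or.inl (Or.inl (Or.inr ⟨k.1, h1, h2 ▸ hs.1⟩))
        · exact Or.inr ⟨k.1, k.2, h1, h2, hs.2.2⟩
    · tauto
  refine (ind_mono key).trans ((ind_or_le _ _).trans (add_le_add ((ind_or_le _ _).trans
    (add_le_add ((ind_or_le _ _).trans (add_le_add ((ind_or_le _ _).trans
      (add_le_add (ind_or_le _ _) le_rfl)) (ind_exists_le _))) (ind_exists_le _))) ?_))
  exact (ind_exists_le _).trans (Finset.sum_le_sum fun _ _ => ind_exists_le _)

/-- Change of measure bound for a likelihood-ratio threshold test. -/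
lemma sum_mul_ind_threshold_le {Y : Type*} [Fintype Y] {D N : Y → ℝ} (hN : IsPmf N)
    {Γ c c' : ℝ} (hΓ : 0 < Γ) (hc : 0 < c) (hc' : 0 ≤ c') :
    ∑ y, D y * ind (Γ * c * D y < c' * N y) ≤ c' / (Γ * c) := by
  have : ∀ y, D y * ind (Γ * c * D y < c' * N y) ≤ c' / (Γ * c) * N y := by
    intro y
    by_cases h : Γ * c * D y < c' * N y
    · rw [ind_true h, mul_one, div_mul_eq_mul_div, le_div_iff₀ (by positivity)]
      linarith
    · rw [ind_false h, mul_zero]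
      exact mul_nonneg (by positivity) (hN.nonneg y)
  refine (Finset.sum_le_sum fun y _ => this y).trans ?_
  rw [← Finset.mul_sum, hN.sum_one, mul_one]

/-- The threshold decoder of a two-user joint source-channel code. -/
def macDecode {A B Y : Type*} [Fintype A] [Fintype B] [Nonempty (A × B)] (Γ : ℝ)
    (q : A → B → ℝ) (N : A → B → Y → ℝ) (D₁ : B → Y → ℝ) (D₂ : A → Y → ℝ) (D₃ : Y → ℝ)
    (y : Y) : A × B :=
  thresholdDecode fun a b =>
    Γ * (∑ a', q a' b) * D₁ b y < q a b * N a b y ∧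
    Γ * (∑ b', q a b') * D₂ a y < q a b * N a b y ∧
    Γ * (∑ a', ∑ b', q a' b') * D₃ y < q a b * N a b y

lemma macDecode_error_le {Ω A B Y : Type*} [Fintype Ω] [Fintype A] [Fintype B] [Fintype Y]
    [Nonempty (A × B)] {P : Ω → ℝ} (hP : IsPmf P) {q : A → B → ℝ} (hq : ∀ a b, 0 ≤ q a b)
    {N : Ω → A → B → Y → ℝ} (hN : ∀ ω a b, IsPmf (N ω a b))
    {D₁ : Ω → B → Y → ℝ} {D₂ : Ω → A → Y → ℝ} {D₃ : Ω → Y → ℝ}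
    (hD₁ : ∀ ω b y, 0 ≤ D₁ ω b y) (hD₂ : ∀ ω a y, 0 ≤ D₂ ω a y) (hD₃ : ∀ ω y, 0 ≤ D₃ ω y)
    (h₁ : ∀ a a' b, a' ≠ a → ∀ φ : ℝ → ℝ → ℝ,
      ex P (fun ω => ∑ y, N ω a b y * φ (D₁ ω b y) (N ω a' b y)) =
        ex P (fun ω => ∑ y, D₁ ω b y * φ (D₁ ω b y) (N ω a' b y)))
    (h₂ : ∀ a b b', b' ≠ b → ∀ φ : ℝ → ℝ → ℝ,
      ex P (fun ω => ∑ y, N ω a b y * φ (D₂ ω a y) (N ω a b' y)) =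
        ex P (fun ω => ∑ y, D₂ ω a y * φ (D₂ ω a y) (N ω a b' y)))
    (h₃ : ∀ a a' b b', a' ≠ a → b' ≠ b → ∀ φ : ℝ → ℝ → ℝ,
      ex P (fun ω => ∑ y, N ω a b y * φ (D₃ ω y) (N ω a' b' y)) =
        ex P (fun ω => ∑ y, D₃ ω y * φ (D₃ ω y) (N ω a' b' y)))
    {Γ : ℝ} (hΓ : 0 < Γ) {Sr Θ : Fin 3 → ℝ} (hΘ : ∀ j, Γ * Sr j ≤ Θ j)
    {a : A} {b : B} (hab : 0 < q a b) :
    ex P (fun ω => ∑ y, N ω a b y *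
        ind (macDecode Γ q (N ω) (D₁ ω) (D₂ ω) (D₃ ω) y ≠ (a, b))) ≤
      ind (Sr 0 * q a b < ∑ a', q a' b) + ind (Sr 1 * q a b < ∑ b', q a b')
        + ind (Sr 2 * q a b < ∑ a', ∑ b', q a' b')
        + ex P (fun ω => ∑ y, N ω a b y * ind (N ω a b y ≤ Θ 0 * D₁ ω b y))
        + ex P (fun ω => ∑ y, N ω a b y * ind (N ω a b y ≤ Θ 1 * D₂ ω a y))
        + ex P (fun ω => ∑ y, N ω a b y * ind (N ω a b y ≤ Θ 2 * D₃ ω y)) + 3 / Γ := by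
  -- the correct pair passes a test unless the source or the channel is atypical
  have miss : ∀ (j : Fin 3) (c : ℝ) (D : Ω → Y → ℝ), (∀ ω y, 0 ≤ D ω y) →
      ex P (fun ω => ∑ y, N ω a b y * ind (¬ Γ * c * D ω y < q a b * N ω a b y)) ≤
        ind (Sr j * q a b < c) + ex P (fun ω => ∑ y, N ω a b y * ind (N ω a b y ≤ Θ j * D ω y)) := by
    intro j c D hD
    have hpt : ∀ ω y, ind (¬ Γ * c * D ω y < q a b * N ω a b y) ≤
        ind (Sr j * q a b < c) + ind (N ω a b y ≤ Θ j * D ω y) := by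
      intro ω y
      refine (ind_mono ?_).trans (ind_or_le _ _)
      intro hn
      by_contra! hc
      refine hn ?_
      have h1 : Γ * c * D ω y ≤ Γ * (Sr j * q a b) * D ω y :=
        mul_le_mul_of_nonneg_right (mul_le_mul_of_nonneg_left hc.1 hΓ.le) (hD ω y)
      have h2 : (Γ * Sr j) * (q a b * D ω y) ≤ Θ j * (q a b * D ω y) :=
        mul_le_mul_of_nonneg_right (hΘ j) (mul_nonneg hab.le (hD ω y))
      have h3 : q a b * (Θ j * D ω y) < q a b * N ω a b y := mul_lt_mul_of_pos_left hc.2 hab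
      nlinarith
    have hpt2 : ∀ ω, ∑ y, N ω a b y * ind (¬ Γ * c * D ω y < q a b * N ω a b y) ≤
        ind (Sr j * q a b < c) + ∑ y, N ω a b y * ind (N ω a b y ≤ Θ j * D ω y) := by
      intro ω
      refine (Finset.sum_le_sum fun y _ =>
        mul_le_mul_of_nonneg_left (hpt ω y) ((hN ω a b).nonneg y)).trans ?_
      simp only [mul_add, Finset.sum_add_distrib]
      rw [← Finset.sum_mul, (hN ω a b).sum_one, one_mul]
    refine (ex_mono hP.nonneg hpt2).trans ?_
    rw [ex_add, ex_const hP]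
  -- a wrong candidate passes a test with small probability
  have alarm : ∀ (c c' : ℝ) (N' D : Ω → Y → ℝ), (∀ ω, IsPmf (N' ω)) → 0 < c → 0 ≤ c' →
      (∀ φ : ℝ → ℝ → ℝ, ex P (fun ω => ∑ y, N ω a b y * φ (D ω y) (N' ω y)) =
        ex P (fun ω => ∑ y, D ω y * φ (D ω y) (N' ω y))) →
      ex P (fun ω => ∑ y, N ω a b y * ind (Γ * c * D ω y < c' * N' ω y)) ≤ c' / (Γ * c) := by
    intro c c' N' D hN' hc hc' h
    rw [h (fun d n => ind (Γ * c * d < c' * n))]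
    refine (ex_mono hP.nonneg fun ω => sum_mul_ind_threshold_le (hN' ω) hΓ hc hc').trans ?_
    rw [ex_const hP]
  have alarm' : ∀ (R : Prop) (c c' : ℝ) (N' D : Ω → Y → ℝ), (∀ ω, IsPmf (N' ω)) → 0 < c →
      0 ≤ c' → (R → ∀ φ : ℝ → ℝ → ℝ, ex P (fun ω => ∑ y, N ω a b y * φ (D ω y) (N' ω y)) =
        ex P (fun ω => ∑ y, D ω y * φ (D ω y) (N' ω y))) →
      ex P (fun ω => ∑ y, N ω a b y * ind (R ∧ Γ * c * D ω y < c' * N' ω y)) ≤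
        c' / (Γ * c) := by
    intro R c c' N' D hN' hc hc' h
    by_cases hR : R
    · simpa only [hR, true_and] using alarm c c' N' D hN' hc hc' (h hR)
    · simp only [hR, false_and, ind_false not_false, mul_zero, Finset.sum_const_zero,
        ex_const hP]
      positivity
  have c1 : 0 < ∑ a', q a' b :=
    hab.trans_le (Finset.single_le_sum (f := fun a' => q a' b) (fun _ _ => hq _ _) (mem_univ a))
  have c2 : 0 < ∑ b', q a b' :=
    hab.trans_le (Finset.single_le_sum (f := fun b' => q a b') (fun _ _ => hq _ _) (mem_univ b))
  have c3 : 0 < ∑ a', ∑ b', q a' b' :=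
    c2.trans_le (Finset.single_le_sum (f := fun a' => ∑ b', q a' b')
      (fun _ _ => Finset.sum_nonneg fun _ _ => hq _ _) (mem_univ a))
  have hdec : ∀ ω, ∑ y, N ω a b y *
        ind (macDecode Γ q (N ω) (D₁ ω) (D₂ ω) (D₃ ω) y ≠ (a, b)) ≤
      ∑ y, N ω a b y * ind (¬ Γ * (∑ a', q a' b) * D₁ ω b y < q a b * N ω a b y)
      + ∑ y, N ω a b y * ind (¬ Γ * (∑ b', q a b') * D₂ ω a y < q a b * N ω a b y)
      + ∑ y, N ω a b y * ind (¬ Γ * (∑ a', ∑ b', q a' b') * D₃ ω y < q a b * N ω a b y)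
      + ∑ a', ∑ y, N ω a b y *
          ind (a' ≠ a ∧ Γ * (∑ a', q a' b) * D₁ ω b y < q a' b * N ω a' b y)
      + ∑ b', ∑ y, N ω a b y *
          ind (b' ≠ b ∧ Γ * (∑ b', q a b') * D₂ ω a y < q a b' * N ω a b' y)
      + ∑ a', ∑ b', ∑ y, N ω a b y * ind ((a' ≠ a ∧ b' ≠ b) ∧
          Γ * (∑ a', ∑ b', q a' b') * D₃ ω y < q a' b' * N ω a' b' y) := by
    intro ω
    refine (Finset.sum_le_sum fun y _ => mul_le_mul_of_nonneg_left
      (ind_thresholdDecode_ne_le _ _ _ a b) ((hN ω a b).nonneg y)).trans (le_of_eq ?_)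
    simp only [mul_add, Finset.sum_add_distrib, Finset.mul_sum, and_assoc]
    congr 1
    · congr 1
      · congr 1
        exact Finset.sum_comm
      · exact Finset.sum_comm
    · rw [Finset.sum_comm]
      exact Finset.sum_congr rfl fun _ _ => Finset.sum_comm
  refine (ex_mono hP.nonneg hdec).trans ?_
  simp only [ex_add]
  have m1 := miss 0 (∑ a', q a' b) (fun ω => D₁ ω b) (fun ω => hD₁ ω b)
  have m2 := miss 1 (∑ b', q a b') (fun ω => D₂ ω a) (fun ω => hD₂ ω a)
  have m3 := miss 2 (∑ a', ∑ b', q a' b') D₃ hD₃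
  have f1 : ex P (fun ω => ∑ a', ∑ y, N ω a b y *
      ind (a' ≠ a ∧ Γ * (∑ a', q a' b) * D₁ ω b y < q a' b * N ω a' b y)) ≤ 1 / Γ := by
    rw [ex_sum]
    refine (Finset.sum_le_sum fun a' _ => alarm' (a' ≠ a) _ _ (fun ω => N ω a' b)
      (fun ω => D₁ ω b) (fun ω => hN _ _ _) c1 (hq _ _) (fun h => h₁ a a' b h)).trans ?_
    rw [← Finset.sum_div, mul_comm Γ, div_mul_cancel_left₀ c1.ne', one_div]
  have f2 : ex P (fun ω => ∑ b', ∑ y, N ω a b y *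
      ind (b' ≠ b ∧ Γ * (∑ b', q a b') * D₂ ω a y < q a b' * N ω a b' y)) ≤ 1 / Γ := by
    rw [ex_sum]
    refine (Finset.sum_le_sum fun b' _ => alarm' (b' ≠ b) _ _ (fun ω => N ω a b')
      (fun ω => D₂ ω a) (fun ω => hN _ _ _) c2 (hq _ _) (fun h => h₂ a b b' h)).trans ?_
    rw [← Finset.sum_div, mul_comm Γ, div_mul_cancel_left₀ c2.ne', one_div]
  have f3 : ex P (fun ω => ∑ a', ∑ b', ∑ y, N ω a b y * ind ((a' ≠ a ∧ b' ≠ b) ∧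
      Γ * (∑ a', ∑ b', q a' b') * D₃ ω y < q a' b' * N ω a' b' y)) ≤ 1 / Γ := by
    rw [ex_sum]
    refine (Finset.sum_le_sum fun a' _ => (ex_sum P univ _).le.trans
      (Finset.sum_le_sum fun b' _ => alarm' (a' ≠ a ∧ b' ≠ b) _ (q a' b') (fun ω => N ω a' b')
      D₃ (fun ω => hN _ _ _) c3 (hq _ _) (fun h => h₃ a a' b b' h.1 h.2))).trans ?_
    simp only [← Finset.sum_div]
    rw [mul_comm Γ, div_mul_cancel_left₀ c3.ne', one_div]
  have h3 : 3 / Γ = 1 / Γ + 1 / Γ + 1 / Γ := by ring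
  linarith

end OneShot

/-- An input law `p(v1) p(x1|v1) p(v2) p(x2|v2) p(x3|v1,v2)`. -/
structure InLaw (V1 V2 X1 X2 X3 : Type*) [Fintype V1] [Fintype V2] [Fintype X1] [Fintype X2]
    [Fintype X3] where
  pV1 : V1 → ℝ
  pV2 : V2 → ℝ
  pX1 : V1 → X1 → ℝ
  pX2 : V2 → X2 → ℝ
  pX3 : V1 → V2 → X3 → ℝ
  hV1 : IsPmf pV1
  hV2 : IsPmf pV2
  hX1 : ∀ v, IsPmf (pX1 v)
  hX2 : ∀ v, IsPmf (pX2 v)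
  hX3 : ∀ v w, IsPmf (pX3 v w)

namespace InLaw

variable {V1 V2 X1 X2 X3 Y A B : Type*} [Fintype V1] [Fintype V2] [Fintype X1] [Fintype X2]
  [Fintype X3] [Fintype Y] (L : InLaw V1 V2 X1 X2 X3)

/-- Expectation over the inputs and the output of the channel `Q`. -/
def chExp (Q : X1 → X2 → X3 → Y → ℝ) (F : V1 → V2 → X1 → X2 → X3 → Y → ℝ) : ℝ :=
  ex L.pV1 fun v1 => ex L.pV2 fun v2 => ex (L.pX1 v1) fun x1 => ex (L.pX2 v2) fun x2 =>
    ex (L.pX3 v1 v2) fun x3 => ex (Q x1 x2 x3) fun y => F v1 v2 x1 x2 x3 y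

/-- Output law given `v1, x2, x3`. -/
def out1 (Q : X1 → X2 → X3 → Y → ℝ) (v1 : V1) (x2 : X2) (x3 : X3) (y : Y) : ℝ :=
  ex (L.pX1 v1) fun x1 => Q x1 x2 x3 y

/-- Output law given `v2, x1, x3`. -/
def out2 (Q : X1 → X2 → X3 → Y → ℝ) (v2 : V2) (x1 : X1) (x3 : X3) (y : Y) : ℝ :=
  ex (L.pX2 v2) fun x2 => Q x1 x2 x3 y

/-- Output law given `v1, v2, x3`. -/
def out12 (Q : X1 → X2 → X3 → Y → ℝ) (v1 : V1) (v2 : V2) (x3 : X3) (y : Y) : ℝ :=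
  ex (L.pX1 v1) fun x1 => ex (L.pX2 v2) fun x2 => Q x1 x2 x3 y

/-- Output law given `v2, x2`. -/
def out13 (Q : X1 → X2 → X3 → Y → ℝ) (v2 : V2) (x2 : X2) (y : Y) : ℝ :=
  ex L.pV1 fun v1 => ex (L.pX1 v1) fun x1 => ex (L.pX3 v1 v2) fun x3 => Q x1 x2 x3 y

/-- Output law given `v1, x1`. -/
def out23 (Q : X1 → X2 → X3 → Y → ℝ) (v1 : V1) (x1 : X1) (y : Y) : ℝ :=
  ex L.pV2 fun v2 => ex (L.pX2 v2) fun x2 => ex (L.pX3 v1 v2) fun x3 => Q x1 x2 x3 y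

/-- Unconditional output law. -/
def out123 (Q : X1 → X2 → X3 → Y → ℝ) (y : Y) : ℝ :=
  ex L.pV1 fun v1 => ex L.pV2 fun v2 => ex (L.pX1 v1) fun x1 => ex (L.pX2 v2) fun x2 =>
    ex (L.pX3 v1 v2) fun x3 => Q x1 x2 x3 y

end InLaw

/-- Codebooks: `v1 a`, `v2 b`, `x1 (new, old)`, `x2 (new, old)`, `x3 (a, b)`. -/
abbrev Codebook (A B V1 V2 X1 X2 X3 : Type*) :=
  (A → V1) × (B → V2) × (A × A → X1) × (B × B → X2) × (A × B → X3)

namespace Codebook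

variable {V1 V2 X1 X2 X3 Y A B : Type*} [Fintype V1] [Fintype V2] [Fintype X1] [Fintype X2]
  [Fintype X3] [Fintype Y] [Fintype A] [Fintype B] [DecidableEq A] [DecidableEq B]
  (L : InLaw V1 V2 X1 X2 X3)

/-- The random codebook law. -/
def law (c : Codebook A B V1 V2 X1 X2 X3) : ℝ :=
  pm (fun _ => L.pV1) c.1 * (pm (fun _ => L.pV2) c.2.1 * (pm (fun i => L.pX1 (c.1 i.2)) c.2.2.1 *
    (pm (fun i => L.pX2 (c.2.1 i.2)) c.2.2.2.1 *
      pm (fun i => L.pX3 (c.1 i.1) (c.2.1 i.2)) c.2.2.2.2)))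

lemma ex_law (F : Codebook A B V1 V2 X1 X2 X3 → ℝ) :
    ex (law L) F = ex (pm fun _ => L.pV1) fun v1 => ex (pm fun _ => L.pV2) fun v2 =>
      ex (pm fun i : A × A => L.pX1 (v1 i.2)) fun x1 =>
      ex (pm fun i : B × B => L.pX2 (v2 i.2)) fun x2 =>
      ex (pm fun i : A × B => L.pX3 (v1 i.1) (v2 i.2)) fun x3 => F (v1, v2, x1, x2, x3) := by
  simp only [ex, law, Fintype.sum_prod_type, Finset.mul_sum, mul_assoc]

lemma law_isPmf : IsPmf (law L : Codebook A B V1 V2 X1 X2 X3 → ℝ) := by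
  refine ⟨fun c => ?_, ?_⟩
  · have h1 := pm_nonneg (fun _ : A => L.hV1.nonneg) c.1
    have h2 := pm_nonneg (fun _ : B => L.hV2.nonneg) c.2.1
    have h3 := pm_nonneg (fun i : A × A => (L.hX1 (c.1 i.2)).nonneg) c.2.2.1
    have h4 := pm_nonneg (fun i : B × B => (L.hX2 (c.2.1 i.2)).nonneg) c.2.2.2.1
    have h5 := pm_nonneg (fun i : A × B => (L.hX3 (c.1 i.1) (c.2.1 i.2)).nonneg) c.2.2.2.2
    unfold law
    positivity
  · have h := ex_law L (fun _ : Codebook A B V1 V2 X1 X2 X3 => 1)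
    simp only [ex_const (pm_isPmf fun _ => L.hV1), ex_const (pm_isPmf fun _ => L.hV2),
      ex_const (pm_isPmf fun _ => L.hX1 _), ex_const (pm_isPmf fun _ => L.hX2 _),
      ex_const (pm_isPmf fun _ => L.hX3 _ _)] at h
    simpa [ex] using h

/-- Joint law of the codewords used in one channel block. -/
lemma ex_law_single (a i : A) (b k : B) (F : V1 → V2 → X1 → X2 → X3 → ℝ) :
    ex (law L) (fun c : Codebook A B V1 V2 X1 X2 X3 =>
      F (c.1 i) (c.2.1 k) (c.2.2.1 (a, i)) (c.2.2.2.1 (b, k)) (c.2.2.2.2 (i, k))) =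
    ex L.pV1 fun v1 => ex L.pV2 fun v2 => ex (L.pX1 v1) fun x1 => ex (L.pX2 v2) fun x2 =>
      ex (L.pX3 v1 v2) fun x3 => F v1 v2 x1 x2 x3 := by
  rw [ex_law]
  let G3 := fun v1 v2 x1 x2 => ex (L.pX3 v1 v2) (F v1 v2 x1 x2)
  let G2 := fun v1 v2 x1 => ex (L.pX2 v2) (G3 v1 v2 x1)
  let G1 := fun v1 v2 => ex (L.pX1 v1) (G2 v1 v2)
  let G0 := fun v1 => ex L.pV2 (G1 v1)
  refine Eq.trans (ex_congr fun v1 => ex_congr fun v2 => ex_congr fun x1 => ex_congr fun x2 =>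
    ex_pm_one (fun _ => L.hX3 _ _) (i, k) (F (v1 i) (v2 k) (x1 (a, i)) (x2 (b, k)))) ?_
  refine Eq.trans (ex_congr fun v1 => ex_congr fun v2 => ex_congr fun x1 =>
    ex_pm_one (fun _ => L.hX2 _) (b, k) (G3 (v1 i) (v2 k) (x1 (a, i)))) ?_
  refine Eq.trans (ex_congr fun v1 => ex_congr fun v2 =>
    ex_pm_one (fun _ => L.hX1 _) (a, i) (G2 (v1 i) (v2 k))) ?_
  refine Eq.trans (ex_congr fun v1 => ex_pm_one (fun _ => L.hV2) k (G1 (v1 i))) ?_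
  exact ex_pm_one (fun _ => L.hV1) i G0

/-- As `ex_law_single`, with a second `x1` codeword sharing the cloud centre. -/
lemma ex_law_pair1 {a a' : A} (ha : a' ≠ a) (i : A) (b k : B)
    (F : V1 → V2 → X1 → X1 → X2 → X3 → ℝ) :
    ex (law L) (fun c : Codebook A B V1 V2 X1 X2 X3 =>
      F (c.1 i) (c.2.1 k) (c.2.2.1 (a', i)) (c.2.2.1 (a, i)) (c.2.2.2.1 (b, k))
        (c.2.2.2.2 (i, k))) =
    ex L.pV1 fun v1 => ex L.pV2 fun v2 => ex (L.pX1 v1) fun x1' => ex (L.pX2 v2) fun x2 =>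
      ex (L.pX3 v1 v2) fun x3 => ex (L.pX1 v1) fun x1 => F v1 v2 x1' x1 x2 x3 := by
  rw [ex_law]
  have hne : ((a', i) : A × A) ≠ (a, i) := fun h => ha (Prod.ext_iff.1 h).1
  let G3 := fun v1 v2 x1' x1 x2 => ex (L.pX3 v1 v2) (F v1 v2 x1' x1 x2)
  let G2 := fun v1 v2 x1' x1 => ex (L.pX2 v2) (G3 v1 v2 x1' x1)
  let G1 := fun v1 v2 => ex (L.pX1 v1) fun x1' => ex (L.pX1 v1) (G2 v1 v2 x1')
  let G0 := fun v1 => ex L.pV2 (G1 v1)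
  refine Eq.trans (ex_congr fun v1 => ex_congr fun v2 => ex_congr fun x1 => ex_congr fun x2 =>
    ex_pm_one (fun _ => L.hX3 _ _) (i, k)
      (F (v1 i) (v2 k) (x1 (a', i)) (x1 (a, i)) (x2 (b, k)))) ?_
  refine Eq.trans (ex_congr fun v1 => ex_congr fun v2 => ex_congr fun x1 =>
    ex_pm_one (fun _ => L.hX2 _) (b, k) (G3 (v1 i) (v2 k) (x1 (a', i)) (x1 (a, i)))) ?_
  refine Eq.trans (ex_congr fun v1 => ex_congr fun v2 =>
    ex_pm_two (fun _ => L.hX1 _) hne (G2 (v1 i) (v2 k))) ?_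
  refine Eq.trans (ex_congr fun v1 => ex_pm_one (fun _ => L.hV2) k (G1 (v1 i))) ?_
  refine Eq.trans (ex_pm_one (fun _ => L.hV1) i G0) ?_
  refine ex_congr fun v1 => ex_congr fun v2 => ex_congr fun x1' => ?_
  exact Eq.trans (ex_comm _ _ _) (ex_congr fun x2 => ex_comm _ _ _)

/-- As `ex_law_single`, with a second `x2` codeword sharing the cloud centre. -/
lemma ex_law_pair2 {b b' : B} (hb : b' ≠ b) (a i : A) (k : B)
    (F : V1 → V2 → X1 → X2 → X2 → X3 → ℝ) :
    ex (law L) (fun c : Codebook A B V1 V2 X1 X2 X3 =>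
      F (c.1 i) (c.2.1 k) (c.2.2.1 (a, i)) (c.2.2.2.1 (b', k)) (c.2.2.2.1 (b, k))
        (c.2.2.2.2 (i, k))) =
    ex L.pV1 fun v1 => ex L.pV2 fun v2 => ex (L.pX1 v1) fun x1 => ex (L.pX2 v2) fun x2' =>
      ex (L.pX3 v1 v2) fun x3 => ex (L.pX2 v2) fun x2 => F v1 v2 x1 x2' x2 x3 := by
  rw [ex_law]
  have hne : ((b', k) : B × B) ≠ (b, k) := fun h => hb (Prod.ext_iff.1 h).1
  let G3 := fun v1 v2 x1 x2' x2 => ex (L.pX3 v1 v2) (F v1 v2 x1 x2' x2)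
  let G2 := fun v1 v2 x1 => ex (L.pX2 v2) fun x2' => ex (L.pX2 v2) (G3 v1 v2 x1 x2')
  let G1 := fun v1 v2 => ex (L.pX1 v1) (G2 v1 v2)
  let G0 := fun v1 => ex L.pV2 (G1 v1)
  refine Eq.trans (ex_congr fun v1 => ex_congr fun v2 => ex_congr fun x1 => ex_congr fun x2 =>
    ex_pm_one (fun _ => L.hX3 _ _) (i, k)
      (F (v1 i) (v2 k) (x1 (a, i)) (x2 (b', k)) (x2 (b, k)))) ?_
  refine Eq.trans (ex_congr fun v1 => ex_congr fun v2 => ex_congr fun x1 =>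
    ex_pm_two (fun _ => L.hX2 _) hne (G3 (v1 i) (v2 k) (x1 (a, i)))) ?_
  refine Eq.trans (ex_congr fun v1 => ex_congr fun v2 =>
    ex_pm_one (fun _ => L.hX1 _) (a, i) (G2 (v1 i) (v2 k))) ?_
  refine Eq.trans (ex_congr fun v1 => ex_pm_one (fun _ => L.hV2) k (G1 (v1 i))) ?_
  refine Eq.trans (ex_pm_one (fun _ => L.hV1) i G0) ?_
  exact ex_congr fun v1 => ex_congr fun v2 => ex_congr fun x1 => ex_congr fun x2' =>
    ex_comm _ _ _

/-- As `ex_law_single`, with second `x1` and `x2` codewords sharing the cloud centres. -/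
lemma ex_law_pair12 {a a' : A} (ha : a' ≠ a) {b b' : B} (hb : b' ≠ b) (i : A) (k : B)
    (F : V1 → V2 → X1 → X1 → X2 → X2 → X3 → ℝ) :
    ex (law L) (fun c : Codebook A B V1 V2 X1 X2 X3 =>
      F (c.1 i) (c.2.1 k) (c.2.2.1 (a', i)) (c.2.2.1 (a, i)) (c.2.2.2.1 (b', k))
        (c.2.2.2.1 (b, k)) (c.2.2.2.2 (i, k))) =
    ex L.pV1 fun v1 => ex L.pV2 fun v2 => ex (L.pX1 v1) fun x1' => ex (L.pX2 v2) fun x2' =>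
      ex (L.pX3 v1 v2) fun x3 => ex (L.pX1 v1) fun x1 => ex (L.pX2 v2) fun x2 =>
        F v1 v2 x1' x1 x2' x2 x3 := by
  rw [ex_law]
  have hna : ((a', i) : A × A) ≠ (a, i) := fun h => ha (Prod.ext_iff.1 h).1
  have hnb : ((b', k) : B × B) ≠ (b, k) := fun h => hb (Prod.ext_iff.1 h).1
  let G3 := fun v1 v2 x1' x1 x2' x2 => ex (L.pX3 v1 v2) (F v1 v2 x1' x1 x2' x2)
  let G2 := fun v1 v2 x1' x1 => ex (L.pX2 v2) fun x2' => ex (L.pX2 v2) (G3 v1 v2 x1' x1 x2')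
  let G1 := fun v1 v2 => ex (L.pX1 v1) fun x1' => ex (L.pX1 v1) (G2 v1 v2 x1')
  let G0 := fun v1 => ex L.pV2 (G1 v1)
  refine Eq.trans (ex_congr fun v1 => ex_congr fun v2 => ex_congr fun x1 => ex_congr fun x2 =>
    ex_pm_one (fun _ => L.hX3 _ _) (i, k)
      (F (v1 i) (v2 k) (x1 (a', i)) (x1 (a, i)) (x2 (b', k)) (x2 (b, k)))) ?_
  refine Eq.trans (ex_congr fun v1 => ex_congr fun v2 => ex_congr fun x1 =>
    ex_pm_two (fun _ => L.hX2 _) hnb (G3 (v1 i) (v2 k) (x1 (a', i)) (x1 (a, i)))) ?_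
  refine Eq.trans (ex_congr fun v1 => ex_congr fun v2 =>
    ex_pm_two (fun _ => L.hX1 _) hna (G2 (v1 i) (v2 k))) ?_
  refine Eq.trans (ex_congr fun v1 => ex_pm_one (fun _ => L.hV2) k (G1 (v1 i))) ?_
  refine Eq.trans (ex_pm_one (fun _ => L.hV1) i G0) ?_
  refine ex_congr fun v1 => ex_congr fun v2 => ex_congr fun x1' => ?_
  refine Eq.trans (ex_comm _ _ _) (ex_congr fun x2' => ?_)
  exact Eq.trans (ex_congr fun x1 => ex_comm _ _ _) (ex_comm _ _ _)

/-- As `ex_law_single`, with a second cloud of the first user. -/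
lemma ex_law_pair13 {a a' : A} (ha : a' ≠ a) (i : A) (b k : B)
    (F : V1 → V1 → V2 → X1 → X1 → X2 → X3 → X3 → ℝ) :
    ex (law L) (fun c : Codebook A B V1 V2 X1 X2 X3 =>
      F (c.1 a') (c.1 a) (c.2.1 k) (c.2.2.1 (i, a')) (c.2.2.1 (i, a)) (c.2.2.2.1 (b, k))
        (c.2.2.2.2 (a', k)) (c.2.2.2.2 (a, k))) =
    ex L.pV1 fun v1' => ex L.pV2 fun v2 => ex (L.pX1 v1') fun x1' => ex (L.pX2 v2) fun x2 =>
      ex (L.pX3 v1' v2) fun x3' => ex L.pV1 fun v1 => ex (L.pX1 v1) fun x1 =>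
        ex (L.pX3 v1 v2) fun x3 => F v1' v1 v2 x1' x1 x2 x3' x3 := by
  rw [ex_law]
  have hn1 : ((i, a') : A × A) ≠ (i, a) := fun h => ha (Prod.ext_iff.1 h).2
  have hn3 : ((a', k) : A × B) ≠ (a, k) := fun h => ha (Prod.ext_iff.1 h).1
  let G3 := fun v1' v1 v2 x1' x1 x2 => ex (L.pX3 v1' v2) fun x3' =>
    ex (L.pX3 v1 v2) (F v1' v1 v2 x1' x1 x2 x3')
  let G2 := fun v1' v1 v2 x1' x1 => ex (L.pX2 v2) (G3 v1' v1 v2 x1' x1)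
  let G1 := fun v1' v1 v2 => ex (L.pX1 v1') fun x1' => ex (L.pX1 v1) (G2 v1' v1 v2 x1')
  let G0 := fun v1' v1 => ex L.pV2 (G1 v1' v1)
  refine Eq.trans (ex_congr fun v1 => ex_congr fun v2 => ex_congr fun x1 => ex_congr fun x2 =>
    ex_pm_two (fun _ => L.hX3 _ _) hn3
      (F (v1 a') (v1 a) (v2 k) (x1 (i, a')) (x1 (i, a)) (x2 (b, k)))) ?_
  refine Eq.trans (ex_congr fun v1 => ex_congr fun v2 => ex_congr fun x1 =>
    ex_pm_one (fun _ => L.hX2 _) (b, k)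
      (G3 (v1 a') (v1 a) (v2 k) (x1 (i, a')) (x1 (i, a)))) ?_
  refine Eq.trans (ex_congr fun v1 => ex_congr fun v2 =>
    ex_pm_two (fun _ => L.hX1 _) hn1 (G2 (v1 a') (v1 a) (v2 k))) ?_
  refine Eq.trans (ex_congr fun v1 => ex_pm_one (fun _ => L.hV2) k (G1 (v1 a') (v1 a))) ?_
  refine Eq.trans (ex_pm_two (fun _ => L.hV1) ha G0) ?_
  refine ex_congr fun v1' => Eq.trans (ex_comm _ _ _) (ex_congr fun v2 => ?_)
  refine Eq.trans (ex_comm _ _ _) (ex_congr fun x1' => ?_)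
  refine Eq.trans (ex_congr fun v1 => ex_comm _ _ _) (Eq.trans (ex_comm _ _ _) (ex_congr fun x2 => ?_))
  exact Eq.trans (ex_congr fun v1 => ex_comm _ _ _) (ex_comm _ _ _)

/-- As `ex_law_single`, with a second cloud of the second user. -/
lemma ex_law_pair23 {b b' : B} (hb : b' ≠ b) (a i : A) (k : B)
    (F : V1 → V2 → V2 → X1 → X2 → X2 → X3 → X3 → ℝ) :
    ex (law L) (fun c : Codebook A B V1 V2 X1 X2 X3 =>
      F (c.1 i) (c.2.1 b') (c.2.1 b) (c.2.2.1 (a, i)) (c.2.2.2.1 (k, b')) (c.2.2.2.1 (k, b))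
        (c.2.2.2.2 (i, b')) (c.2.2.2.2 (i, b))) =
    ex L.pV1 fun v1 => ex L.pV2 fun v2' => ex (L.pX1 v1) fun x1 => ex (L.pX2 v2') fun x2' =>
      ex (L.pX3 v1 v2') fun x3' => ex L.pV2 fun v2 => ex (L.pX2 v2) fun x2 =>
        ex (L.pX3 v1 v2) fun x3 => F v1 v2' v2 x1 x2' x2 x3' x3 := by
  rw [ex_law]
  have hn2 : ((k, b') : B × B) ≠ (k, b) := fun h => hb (Prod.ext_iff.1 h).2
  have hn3 : ((i, b') : A × B) ≠ (i, b) := fun h => hb (Prod.ext_iff.1 h).2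
  let G3 := fun v1 v2' v2 x1 x2' x2 => ex (L.pX3 v1 v2') fun x3' =>
    ex (L.pX3 v1 v2) (F v1 v2' v2 x1 x2' x2 x3')
  let G2 := fun v1 v2' v2 x1 => ex (L.pX2 v2') fun x2' => ex (L.pX2 v2) (G3 v1 v2' v2 x1 x2')
  let G1 := fun v1 v2' v2 => ex (L.pX1 v1) (G2 v1 v2' v2)
  let G0 := fun v1 => ex L.pV2 fun v2' => ex L.pV2 (G1 v1 v2')
  refine Eq.trans (ex_congr fun v1 => ex_congr fun v2 => ex_congr fun x1 => ex_congr fun x2 =>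
    ex_pm_two (fun _ => L.hX3 _ _) hn3
      (F (v1 i) (v2 b') (v2 b) (x1 (a, i)) (x2 (k, b')) (x2 (k, b)))) ?_
  refine Eq.trans (ex_congr fun v1 => ex_congr fun v2 => ex_congr fun x1 =>
    ex_pm_two (fun _ => L.hX2 _) hn2 (G3 (v1 i) (v2 b') (v2 b) (x1 (a, i)))) ?_
  refine Eq.trans (ex_congr fun v1 => ex_congr fun v2 =>
    ex_pm_one (fun _ => L.hX1 _) (a, i) (G2 (v1 i) (v2 b') (v2 b))) ?_
  refine Eq.trans (ex_congr fun v1 => ex_pm_two (fun _ => L.hV2) hb (G1 (v1 i))) ?_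
  refine Eq.trans (ex_pm_one (fun _ => L.hV1) i G0) ?_
  refine ex_congr fun v1 => ex_congr fun v2' => Eq.trans (ex_comm _ _ _) (ex_congr fun x1 => ?_)
  refine Eq.trans (ex_comm _ _ _) (ex_congr fun x2' => ?_)
  exact Eq.trans (ex_congr fun v2 => ex_comm _ _ _) (ex_comm _ _ _)

/-- As `ex_law_single`, with second clouds of both users. -/
lemma ex_law_pair123 {a a' : A} (ha : a' ≠ a) {b b' : B} (hb : b' ≠ b) (i : A) (k : B)
    (F : V1 → V1 → V2 → V2 → X1 → X1 → X2 → X2 → X3 → X3 → ℝ) :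
    ex (law L) (fun c : Codebook A B V1 V2 X1 X2 X3 =>
      F (c.1 a') (c.1 a) (c.2.1 b') (c.2.1 b) (c.2.2.1 (i, a')) (c.2.2.1 (i, a))
        (c.2.2.2.1 (k, b')) (c.2.2.2.1 (k, b)) (c.2.2.2.2 (a', b')) (c.2.2.2.2 (a, b))) =
    ex L.pV1 fun v1' => ex L.pV2 fun v2' => ex (L.pX1 v1') fun x1' => ex (L.pX2 v2') fun x2' =>
      ex (L.pX3 v1' v2') fun x3' => ex L.pV1 fun v1 => ex L.pV2 fun v2 => ex (L.pX1 v1) fun x1 =>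
        ex (L.pX2 v2) fun x2 => ex (L.pX3 v1 v2) fun x3 =>
          F v1' v1 v2' v2 x1' x1 x2' x2 x3' x3 := by
  rw [ex_law]
  have hn1 : ((i, a') : A × A) ≠ (i, a) := fun h => ha (Prod.ext_iff.1 h).2
  have hn2 : ((k, b') : B × B) ≠ (k, b) := fun h => hb (Prod.ext_iff.1 h).2
  have hn3 : ((a', b') : A × B) ≠ (a, b) := fun h => hb (Prod.ext_iff.1 h).2
  let G3 := fun v1' v1 v2' v2 x1' x1 x2' x2 => ex (L.pX3 v1' v2') fun x3' =>
    ex (L.pX3 v1 v2) (F v1' v1 v2' v2 x1' x1 x2' x2 x3')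
  let G2 := fun v1' v1 v2' v2 x1' x1 => ex (L.pX2 v2') fun x2' =>
    ex (L.pX2 v2) (G3 v1' v1 v2' v2 x1' x1 x2')
  let G1 := fun v1' v1 v2' v2 => ex (L.pX1 v1') fun x1' =>
    ex (L.pX1 v1) (G2 v1' v1 v2' v2 x1')
  let G0 := fun v1' v1 => ex L.pV2 fun v2' => ex L.pV2 (G1 v1' v1 v2')
  refine Eq.trans (ex_congr fun v1 => ex_congr fun v2 => ex_congr fun x1 => ex_congr fun x2 =>
    ex_pm_two (fun _ => L.hX3 _ _) hn3 (F (v1 a') (v1 a) (v2 b') (v2 b) (x1 (i, a'))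
      (x1 (i, a)) (x2 (k, b')) (x2 (k, b)))) ?_
  refine Eq.trans (ex_congr fun v1 => ex_congr fun v2 => ex_congr fun x1 =>
    ex_pm_two (fun _ => L.hX2 _) hn2
      (G3 (v1 a') (v1 a) (v2 b') (v2 b) (x1 (i, a')) (x1 (i, a)))) ?_
  refine Eq.trans (ex_congr fun v1 => ex_congr fun v2 =>
    ex_pm_two (fun _ => L.hX1 _) hn1 (G2 (v1 a') (v1 a) (v2 b') (v2 b))) ?_
  refine Eq.trans (ex_congr fun v1 => ex_pm_two (fun _ => L.hV2) hb (G1 (v1 a') (v1 a))) ?_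
  refine Eq.trans (ex_pm_two (fun _ => L.hV1) ha G0) ?_
  refine ex_congr fun v1' => Eq.trans (ex_comm _ _ _) (ex_congr fun v2' => ?_)
  refine Eq.trans (ex_congr fun v1 => ex_comm _ _ _) (Eq.trans (ex_comm _ _ _) (ex_congr fun x1' => ?_))
  refine Eq.trans (ex_congr fun v1 => Eq.trans (ex_congr fun v2 => ex_comm _ _ _) (ex_comm _ _ _))
    (Eq.trans (ex_comm _ _ _) (ex_congr fun x2' => ?_))
  exact Eq.trans (ex_congr fun v1 => Eq.trans (ex_congr fun v2 => Eq.trans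
    (ex_congr fun x1 => ex_comm _ _ _) (ex_comm _ _ _)) (ex_comm _ _ _)) (ex_comm _ _ _)

end Codebook

lemma ex_sum_mul_right {α γ : Type*} [Fintype α] [Fintype γ] (p : α → ℝ) (N : α → γ → ℝ)
    (c : γ → ℝ) :
    ex p (fun a => ∑ y, N a y * c y) = ∑ y, ex p (fun a => N a y) * c y := by
  rw [ex_sum]
  exact Finset.sum_congr rfl fun y _ => ex_mul_right p (fun a => N a y) (c y)

namespace InLaw

variable {V1 V2 X1 X2 X3 Y : Type*} [Fintype V1] [Fintype V2] [Fintype X1] [Fintype X2]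
  [Fintype X3] [Fintype Y] (L : InLaw V1 V2 X1 X2 X3) {Q : X1 → X2 → X3 → Y → ℝ}

/-- Probability that one of the relay information densities is atypically small. -/
def relayTail (Q : X1 → X2 → X3 → Y → ℝ) (Θ : Fin 3 → ℝ) : ℝ :=
  L.chExp Q (fun v1 _ x1 x2 x3 y => ind (Q x1 x2 x3 y ≤ Θ 0 * L.out1 Q v1 x2 x3 y))
  + L.chExp Q (fun _ v2 x1 x2 x3 y => ind (Q x1 x2 x3 y ≤ Θ 1 * L.out2 Q v2 x1 x3 y))
  + L.chExp Q (fun v1 v2 x1 x2 x3 y => ind (Q x1 x2 x3 y ≤ Θ 2 * L.out12 Q v1 v2 x3 y))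

/-- Probability that one of the destination information densities is atypically small. -/
def destTail (Q : X1 → X2 → X3 → Y → ℝ) (Θ : Fin 3 → ℝ) : ℝ :=
  L.chExp Q (fun _ v2 x1 x2 x3 y => ind (Q x1 x2 x3 y ≤ Θ 0 * L.out13 Q v2 x2 y))
  + L.chExp Q (fun v1 _ x1 x2 x3 y => ind (Q x1 x2 x3 y ≤ Θ 1 * L.out23 Q v1 x1 y))
  + L.chExp Q (fun _ _ x1 x2 x3 y => ind (Q x1 x2 x3 y ≤ Θ 2 * L.out123 Q y))

lemma out1_nonneg (hQ : ∀ x1 x2 x3 y, 0 ≤ Q x1 x2 x3 y) (v1 x2 x3 y) :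
    0 ≤ L.out1 Q v1 x2 x3 y :=
  ex_nonneg (L.hX1 _).nonneg fun _ => hQ _ _ _ _

lemma out2_nonneg (hQ : ∀ x1 x2 x3 y, 0 ≤ Q x1 x2 x3 y) (v2 x1 x3 y) :
    0 ≤ L.out2 Q v2 x1 x3 y :=
  ex_nonneg (L.hX2 _).nonneg fun _ => hQ _ _ _ _

lemma out12_nonneg (hQ : ∀ x1 x2 x3 y, 0 ≤ Q x1 x2 x3 y) (v1 v2 x3 y) :
    0 ≤ L.out12 Q v1 v2 x3 y :=
  ex_nonneg (L.hX1 _).nonneg fun _ => ex_nonneg (L.hX2 _).nonneg fun _ => hQ _ _ _ _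

lemma out13_nonneg (hQ : ∀ x1 x2 x3 y, 0 ≤ Q x1 x2 x3 y) (v2 x2 y) : 0 ≤ L.out13 Q v2 x2 y :=
  ex_nonneg L.hV1.nonneg fun _ => ex_nonneg (L.hX1 _).nonneg fun _ =>
    ex_nonneg (L.hX3 _ _).nonneg fun _ => hQ _ _ _ _

lemma out23_nonneg (hQ : ∀ x1 x2 x3 y, 0 ≤ Q x1 x2 x3 y) (v1 x1 y) : 0 ≤ L.out23 Q v1 x1 y :=
  ex_nonneg L.hV2.nonneg fun _ => ex_nonneg (L.hX2 _).nonneg fun _ =>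
    ex_nonneg (L.hX3 _ _).nonneg fun _ => hQ _ _ _ _

lemma out123_nonneg (hQ : ∀ x1 x2 x3 y, 0 ≤ Q x1 x2 x3 y) (y) : 0 ≤ L.out123 Q y :=
  ex_nonneg L.hV1.nonneg fun _ => ex_nonneg L.hV2.nonneg fun _ =>
    ex_nonneg (L.hX1 _).nonneg fun _ => ex_nonneg (L.hX2 _).nonneg fun _ =>
      ex_nonneg (L.hX3 _ _).nonneg fun _ => hQ _ _ _ _

end InLaw

namespace Codebook

variable {V1 V2 X1 X2 X3 Y A B : Type*} [Fintype V1] [Fintype V2] [Fintype X1] [Fintype X2]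
  [Fintype X3] [Fintype Y] [Fintype A] [Fintype B]
  (L : InLaw V1 V2 X1 X2 X3)

/-- The relay decoder: decode the new pair given the previous pair `u`. -/
def relayDec [Nonempty (A × B)] (Γ : ℝ) (Q : X1 → X2 → X3 → Y → ℝ) (q : A → B → ℝ)
    (c : Codebook A B V1 V2 X1 X2 X3) (u : A × B) (y : Y) : A × B :=
  macDecode Γ q (fun a b => Q (c.2.2.1 (a, u.1)) (c.2.2.2.1 (b, u.2)) (c.2.2.2.2 u))
    (fun b => L.out1 Q (c.1 u.1) (c.2.2.2.1 (b, u.2)) (c.2.2.2.2 u))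
    (fun a => L.out2 Q (c.2.1 u.2) (c.2.2.1 (a, u.1)) (c.2.2.2.2 u))
    (L.out12 Q (c.1 u.1) (c.2.1 u.2) (c.2.2.2.2 u)) y

/-- The destination decoder: decode the current pair given the next pair `u`. -/
def destDec [Nonempty (A × B)] (Γ : ℝ) (Q : X1 → X2 → X3 → Y → ℝ) (q : A → B → ℝ)
    (c : Codebook A B V1 V2 X1 X2 X3) (u : A × B) (y : Y) : A × B :=
  macDecode Γ q (fun a b => Q (c.2.2.1 (u.1, a)) (c.2.2.2.1 (u.2, b)) (c.2.2.2.2 (a, b)))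
    (fun b => L.out13 Q (c.2.1 b) (c.2.2.2.1 (u.2, b)))
    (fun a => L.out23 Q (c.1 a) (c.2.2.1 (u.1, a)))
    (L.out123 Q) y

/-- Probability that one of the source densities is atypically small. -/
def srcBad (q : A → B → ℝ) (Sr : Fin 3 → ℝ) (a : A) (b : B) : ℝ :=
  ind (Sr 0 * q a b < ∑ a', q a' b) + ind (Sr 1 * q a b < ∑ b', q a b')
    + ind (Sr 2 * q a b < ∑ a', ∑ b', q a' b')

lemma relayDec_error_le
    {Q : X1 → X2 → X3 → Y → ℝ} (hQ : ∀ x1 x2 x3, IsPmf (Q x1 x2 x3))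
    {q : A → B → ℝ} (hq : ∀ a b, 0 ≤ q a b) {Γ : ℝ} (hΓ : 0 < Γ) {Sr Θ : Fin 3 → ℝ}
    (hΘ : ∀ j, Γ * Sr j ≤ Θ j) [Nonempty (A × B)] (u : A × B) {a : A} {b : B}
    (hab : 0 < q a b) :
    ex (law L) (fun c : Codebook A B V1 V2 X1 X2 X3 =>
      ex (Q (c.2.2.1 (a, u.1)) (c.2.2.2.1 (b, u.2)) (c.2.2.2.2 u)) fun y =>
        ind (relayDec L Γ Q q c u y ≠ (a, b))) ≤
      srcBad q Sr a b + L.relayTail Q Θ + 3 / Γ := by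
  obtain ⟨a0, b0⟩ := u
  have hQ0 : ∀ x1 x2 x3 y, 0 ≤ Q x1 x2 x3 y := fun x1 x2 x3 => (hQ x1 x2 x3).nonneg
  have key := macDecode_error_le (law_isPmf (A := A) (B := B) L) hq
    (N := fun c a b => Q (c.2.2.1 (a, a0)) (c.2.2.2.1 (b, b0)) (c.2.2.2.2 (a0, b0)))
    (D₁ := fun c b => L.out1 Q (c.1 a0) (c.2.2.2.1 (b, b0)) (c.2.2.2.2 (a0, b0)))
    (D₂ := fun c a => L.out2 Q (c.2.1 b0) (c.2.2.1 (a, a0)) (c.2.2.2.2 (a0, b0)))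
    (D₃ := fun c => L.out12 Q (c.1 a0) (c.2.1 b0) (c.2.2.2.2 (a0, b0)))
    (fun _ _ _ => hQ _ _ _) (fun _ _ _ => L.out1_nonneg hQ0 _ _ _ _)
    (fun _ _ _ => L.out2_nonneg hQ0 _ _ _ _) (fun _ _ => L.out12_nonneg hQ0 _ _ _ _)
    (fun a a' b ha φ => by
      refine Eq.trans (ex_law_pair1 L ha a0 b b0 (fun v1 v2 x1' x1 x2 x3 =>
        ∑ y, Q x1 x2 x3 y * φ (L.out1 Q v1 x2 x3 y) (Q x1' x2 x3 y))) (Eq.trans ?_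
        (ex_law_pair1 L ha a0 b b0 (fun v1 v2 x1' x1 x2 x3 =>
        ∑ y, L.out1 Q v1 x2 x3 y * φ (L.out1 Q v1 x2 x3 y) (Q x1' x2 x3 y))).symm)
      simp only [ex_sum_mul_right, ex_const (L.hX1 _)]
      rfl)
    (fun a b b' hb φ => by
      refine Eq.trans (ex_law_pair2 L hb a a0 b0 (fun v1 v2 x1 x2' x2 x3 =>
        ∑ y, Q x1 x2 x3 y * φ (L.out2 Q v2 x1 x3 y) (Q x1 x2' x3 y))) (Eq.trans ?_
        (ex_law_pair2 L hb a a0 b0 (fun v1 v2 x1 x2' x2 x3 =>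
        ∑ y, L.out2 Q v2 x1 x3 y * φ (L.out2 Q v2 x1 x3 y) (Q x1 x2' x3 y))).symm)
      simp only [ex_sum_mul_right, ex_const (L.hX2 _)]
      rfl)
    (fun a a' b b' ha hb φ => by
      refine Eq.trans (ex_law_pair12 L ha hb a0 b0 (fun v1 v2 x1' x1 x2' x2 x3 =>
        ∑ y, Q x1 x2 x3 y * φ (L.out12 Q v1 v2 x3 y) (Q x1' x2' x3 y))) (Eq.trans ?_
        (ex_law_pair12 L ha hb a0 b0 (fun v1 v2 x1' x1 x2' x2 x3 =>
        ∑ y, L.out12 Q v1 v2 x3 y * φ (L.out12 Q v1 v2 x3 y) (Q x1' x2' x3 y))).symm)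
      simp only [ex_sum_mul_right, ex_const (L.hX2 _), ex_const (L.hX1 _)]
      rfl)
    hΓ hΘ hab
  have e1 := ex_law_single L a a0 b b0 (fun v1 _ x1 x2 x3 =>
    ∑ y, Q x1 x2 x3 y * ind (Q x1 x2 x3 y ≤ Θ 0 * L.out1 Q v1 x2 x3 y))
  have e2 := ex_law_single L a a0 b b0 (fun _ v2 x1 x2 x3 =>
    ∑ y, Q x1 x2 x3 y * ind (Q x1 x2 x3 y ≤ Θ 1 * L.out2 Q v2 x1 x3 y))
  have e3 := ex_law_single L a a0 b b0 (fun v1 v2 x1 x2 x3 =>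
    ∑ y, Q x1 x2 x3 y * ind (Q x1 x2 x3 y ≤ Θ 2 * L.out12 Q v1 v2 x3 y))
  rw [e1, e2, e3] at key
  refine key.trans (le_of_eq ?_)
  simp only [srcBad, InLaw.relayTail, InLaw.chExp, ex]
  ring

lemma destDec_error_le
    {Q : X1 → X2 → X3 → Y → ℝ} (hQ : ∀ x1 x2 x3, IsPmf (Q x1 x2 x3))
    {q : A → B → ℝ} (hq : ∀ a b, 0 ≤ q a b) {Γ : ℝ} (hΓ : 0 < Γ) {Sr Θ : Fin 3 → ℝ}
    (hΘ : ∀ j, Γ * Sr j ≤ Θ j) [Nonempty (A × B)] (u : A × B) {a : A} {b : B}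
    (hab : 0 < q a b) :
    ex (law L) (fun c : Codebook A B V1 V2 X1 X2 X3 =>
      ex (Q (c.2.2.1 (u.1, a)) (c.2.2.2.1 (u.2, b)) (c.2.2.2.2 (a, b))) fun y =>
        ind (destDec L Γ Q q c u y ≠ (a, b))) ≤
      srcBad q Sr a b + L.destTail Q Θ + 3 / Γ := by
  obtain ⟨a2, b2⟩ := u
  have hQ0 : ∀ x1 x2 x3 y, 0 ≤ Q x1 x2 x3 y := fun x1 x2 x3 => (hQ x1 x2 x3).nonneg
  have key := macDecode_error_le (law_isPmf (A := A) (B := B) L) hq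
    (N := fun c a b => Q (c.2.2.1 (a2, a)) (c.2.2.2.1 (b2, b)) (c.2.2.2.2 (a, b)))
    (D₁ := fun c b => L.out13 Q (c.2.1 b) (c.2.2.2.1 (b2, b)))
    (D₂ := fun c a => L.out23 Q (c.1 a) (c.2.2.1 (a2, a)))
    (D₃ := fun c => L.out123 Q)
    (fun _ _ _ => hQ _ _ _) (fun _ _ _ => L.out13_nonneg hQ0 _ _ _)
    (fun _ _ _ => L.out23_nonneg hQ0 _ _ _) (fun _ _ => L.out123_nonneg hQ0 _)
    (fun a a' b ha φ => by
      refine Eq.trans (ex_law_pair13 L ha a2 b2 b (fun v1' v1 v2 x1' x1 x2 x3' x3 =>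
        ∑ y, Q x1 x2 x3 y * φ (L.out13 Q v2 x2 y) (Q x1' x2 x3' y))) (Eq.trans ?_
        (ex_law_pair13 L ha a2 b2 b (fun v1' v1 v2 x1' x1 x2 x3' x3 =>
        ∑ y, L.out13 Q v2 x2 y * φ (L.out13 Q v2 x2 y) (Q x1' x2 x3' y))).symm)
      simp only [ex_sum_mul_right, ex_const (L.hX1 _), ex_const (L.hX3 _ _), ex_const L.hV1]
      rfl)
    (fun a b b' hb φ => by
      refine Eq.trans (ex_law_pair23 L hb a2 a b2 (fun v1 v2' v2 x1 x2' x2 x3' x3 =>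
        ∑ y, Q x1 x2 x3 y * φ (L.out23 Q v1 x1 y) (Q x1 x2' x3' y))) (Eq.trans ?_
        (ex_law_pair23 L hb a2 a b2 (fun v1 v2' v2 x1 x2' x2 x3' x3 =>
        ∑ y, L.out23 Q v1 x1 y * φ (L.out23 Q v1 x1 y) (Q x1 x2' x3' y))).symm)
      simp only [ex_sum_mul_right, ex_const (L.hX2 _), ex_const (L.hX3 _ _), ex_const L.hV2]
      rfl)
    (fun a a' b b' ha hb φ => by
      refine Eq.trans (ex_law_pair123 L ha hb a2 b2 (fun v1' v1 v2' v2 x1' x1 x2' x2 x3' x3 =>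
        ∑ y, Q x1 x2 x3 y * φ (L.out123 Q y) (Q x1' x2' x3' y))) (Eq.trans ?_
        (ex_law_pair123 L ha hb a2 b2 (fun v1' v1 v2' v2 x1' x1 x2' x2 x3' x3 =>
        ∑ y, L.out123 Q y * φ (L.out123 Q y) (Q x1' x2' x3' y))).symm)
      simp only [ex_sum_mul_right, ex_const (L.hX1 _), ex_const (L.hX2 _), ex_const (L.hX3 _ _),
        ex_const L.hV1, ex_const L.hV2]
      rfl)
    hΓ hΘ hab
  have e1 := ex_law_single L a2 a b2 b (fun _ v2 x1 x2 x3 =>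
    ∑ y, Q x1 x2 x3 y * ind (Q x1 x2 x3 y ≤ Θ 0 * L.out13 Q v2 x2 y))
  have e2 := ex_law_single L a2 a b2 b (fun v1 _ x1 x2 x3 =>
    ∑ y, Q x1 x2 x3 y * ind (Q x1 x2 x3 y ≤ Θ 1 * L.out23 Q v1 x1 y))
  have e3 := ex_law_single L a2 a b2 b (fun _ _ x1 x2 x3 =>
    ∑ y, Q x1 x2 x3 y * ind (Q x1 x2 x3 y ≤ Θ 2 * L.out123 Q y))
  rw [e1, e2, e3] at key
  refine key.trans (le_of_eq ?_)
  simp only [srcBad, InLaw.destTail, InLaw.chExp, ex]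
  ring

end Codebook

section Tail

variable {T : Type*} [Fintype T]

lemma pos_of_pm_pos {ι : Type*} [Fintype ι] {J : T → ℝ} (hJ : ∀ t, 0 ≤ J t) {t : ι → T}
    (h : 0 < pm (fun _ => J) t) (i : ι) : 0 < J (t i) := by
  refine (hJ _).lt_of_ne fun h0 => h.ne' ?_
  exact Finset.prod_eq_zero (mem_univ i) h0.symm

/-- The weak law of large numbers for a log-likelihood ratio. -/
lemma prod_tail_le {J : T → ℝ} (hJ : IsPmf J) {R D : T → ℝ} (hR : ∀ t, 0 < J t → 0 < R t)
    (hD : ∀ t, 0 < J t → 0 < D t) {δ : ℝ} (hδ : 0 < δ) {N : ℕ} (hN : 0 < N) :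
    ex (pm fun _ : Fin N => J) (fun t => ind (∏ i, R (t i) ≤
      (2 : ℝ) ^ ((N : ℝ) * (ex J (fun t => Real.logb 2 (R t / D t)) - δ)) * ∏ i, D (t i))) ≤
    ex J (fun t => (Real.logb 2 (R t / D t) - ex J (fun t => Real.logb 2 (R t / D t))) ^ 2)
      / δ ^ 2 / N := by
  refine le_trans (ex_mono_of_pos (pm_nonneg fun _ => hJ.nonneg) fun t ht => ind_mono fun h => ?_)
    (weak_law hJ (fun t => Real.logb 2 (R t / D t)) hδ hN)
  have hpos := pos_of_pm_pos hJ.nonneg ht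
  have hRp : 0 < ∏ i, R (t i) := Finset.prod_pos fun i _ => hR _ (hpos i)
  have hDp : 0 < ∏ i, D (t i) := Finset.prod_pos fun i _ => hD _ (hpos i)
  have h2 := Real.logb_le_logb_of_le (by norm_num : (1 : ℝ) < 2) hRp h
  rw [Real.logb_mul (by positivity) hDp.ne', Real.logb_rpow (by norm_num) (by norm_num),
    Real.logb_prod _ _ fun i _ => (hR _ (hpos i)).ne',
    Real.logb_prod _ _ fun i _ => (hD _ (hpos i)).ne'] at h2
  have h3 : ∑ i, Real.logb 2 (R (t i) / D (t i)) =
      ∑ i, Real.logb 2 (R (t i)) - ∑ i, Real.logb 2 (D (t i)) := by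
    rw [← Finset.sum_sub_distrib]
    exact Finset.sum_congr rfl fun i _ =>
      Real.logb_div (hR _ (hpos i)).ne' (hD _ (hpos i)).ne'
  rw [h3, le_abs]
  right
  linarith

lemma exists_prod_tail_le {J : T → ℝ} (hJ : IsPmf J) {R D : T → ℝ} (hR : ∀ t, 0 < J t → 0 < R t)
    (hD : ∀ t, 0 < J t → 0 < D t) {δ : ℝ} (hδ : 0 < δ) :
    ∃ C : ℝ, ∀ N : ℕ, 0 < N → ex (pm fun _ : Fin N => J) (fun t => ind (∏ i, R (t i) ≤
      (2 : ℝ) ^ ((N : ℝ) * (ex J (fun t => Real.logb 2 (R t / D t)) - δ)) * ∏ i, D (t i))) ≤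
      C / N :=
  ⟨_, fun _ hN => prod_tail_le hJ hR hD hδ hN⟩

end Tail

namespace InLaw

variable {V1 V2 X1 X2 X3 Y : Type*} [Fintype V1] [Fintype V2] [Fintype X1] [Fintype X2]
  [Fintype X3] (L : InLaw V1 V2 X1 X2 X3)

/-- The memoryless extension of an input law. -/
def block (N : ℕ) : InLaw (Fin N → V1) (Fin N → V2) (Fin N → X1) (Fin N → X2) (Fin N → X3) where
  pV1 := pm fun _ => L.pV1
  pV2 := pm fun _ => L.pV2
  pX1 v := pm fun i => L.pX1 (v i)
  pX2 v := pm fun i => L.pX2 (v i)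
  pX3 v w := pm fun i => L.pX3 (v i) (w i)
  hV1 := pm_isPmf fun _ => L.hV1
  hV2 := pm_isPmf fun _ => L.hV2
  hX1 _ := pm_isPmf fun _ => L.hX1 _
  hX2 _ := pm_isPmf fun _ => L.hX2 _
  hX3 _ _ := pm_isPmf fun _ => L.hX3 _ _

/-- The memoryless extension of a channel. -/
def chBlock (Q : X1 → X2 → X3 → Y → ℝ) (N : ℕ) (x1 : Fin N → X1) (x2 : Fin N → X2)
    (x3 : Fin N → X3) : (Fin N → Y) → ℝ :=
  pm fun i => Q (x1 i) (x2 i) (x3 i)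

section Outputs

variable (Q : X1 → X2 → X3 → Y → ℝ) (N : ℕ)

lemma block_out1 (v1 x2 x3 y) : (L.block N).out1 (chBlock Q N) v1 x2 x3 y =
    ∏ i, L.out1 Q (v1 i) (x2 i) (x3 i) (y i) :=
  ex_pm_prod (fun i => L.pX1 (v1 i)) (fun i x => Q x (x2 i) (x3 i) (y i))

lemma block_out2 (v2 x1 x3 y) : (L.block N).out2 (chBlock Q N) v2 x1 x3 y =
    ∏ i, L.out2 Q (v2 i) (x1 i) (x3 i) (y i) :=
  ex_pm_prod (fun i => L.pX2 (v2 i)) (fun i x => Q (x1 i) x (x3 i) (y i))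

lemma block_out12 (v1 v2 x3 y) : (L.block N).out12 (chBlock Q N) v1 v2 x3 y =
    ∏ i, L.out12 Q (v1 i) (v2 i) (x3 i) (y i) :=
  Eq.trans (ex_congr fun x1 => ex_pm_prod (fun i => L.pX2 (v2 i))
      (fun i x => Q (x1 i) x (x3 i) (y i)))
    (ex_pm_prod (fun i => L.pX1 (v1 i)) (fun i x => L.out2 Q (v2 i) x (x3 i) (y i)))

lemma block_out13 (v2 x2 y) : (L.block N).out13 (chBlock Q N) v2 x2 y =
    ∏ i, L.out13 Q (v2 i) (x2 i) (y i) :=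
  Eq.trans (ex_congr fun v1 => Eq.trans (ex_congr fun x1 =>
      ex_pm_prod (fun i => L.pX3 (v1 i) (v2 i)) (fun i x => Q (x1 i) (x2 i) x (y i)))
    (ex_pm_prod (fun i => L.pX1 (v1 i))
      (fun i x => ex (L.pX3 (v1 i) (v2 i)) fun x3 => Q x (x2 i) x3 (y i))))
    (ex_pm_prod (fun _ => L.pV1) (fun i v => ex (L.pX1 v) fun x =>
      ex (L.pX3 v (v2 i)) fun x3 => Q x (x2 i) x3 (y i)))

lemma block_out23 (v1 x1 y) : (L.block N).out23 (chBlock Q N) v1 x1 y =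
    ∏ i, L.out23 Q (v1 i) (x1 i) (y i) :=
  Eq.trans (ex_congr fun v2 => Eq.trans (ex_congr fun x2 =>
      ex_pm_prod (fun i => L.pX3 (v1 i) (v2 i)) (fun i x => Q (x1 i) (x2 i) x (y i)))
    (ex_pm_prod (fun i => L.pX2 (v2 i))
      (fun i x => ex (L.pX3 (v1 i) (v2 i)) fun x3 => Q (x1 i) x x3 (y i))))
    (ex_pm_prod (fun _ => L.pV2) (fun i v => ex (L.pX2 v) fun x =>
      ex (L.pX3 (v1 i) v) fun x3 => Q (x1 i) x x3 (y i)))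

lemma block_out123 (y) : (L.block N).out123 (chBlock Q N) y = ∏ i, L.out123 Q (y i) :=
  Eq.trans (ex_congr fun v1 => Eq.trans (ex_congr fun v2 => Eq.trans (ex_congr fun x1 =>
    Eq.trans (ex_congr fun x2 =>
      ex_pm_prod (fun i => L.pX3 (v1 i) (v2 i)) (fun i x => Q (x1 i) (x2 i) x (y i)))
    (ex_pm_prod (fun i => L.pX2 (v2 i))
      (fun i x => ex (L.pX3 (v1 i) (v2 i)) fun x3 => Q (x1 i) x x3 (y i))))
    (ex_pm_prod (fun i => L.pX1 (v1 i)) (fun i x1 => ex (L.pX2 (v2 i)) fun x2 =>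
      ex (L.pX3 (v1 i) (v2 i)) fun x3 => Q x1 x2 x3 (y i))))
    (ex_pm_prod (fun _ => L.pV2) (fun i v2 => ex (L.pX1 (v1 i)) fun x1 => ex (L.pX2 v2) fun x2 =>
      ex (L.pX3 (v1 i) v2) fun x3 => Q x1 x2 x3 (y i))))
    (ex_pm_prod (fun _ => L.pV1) (fun i v1 => ex L.pV2 fun v2 => ex (L.pX1 v1) fun x1 =>
      ex (L.pX2 v2) fun x2 => ex (L.pX3 v1 v2) fun x3 => Q x1 x2 x3 (y i)))

end Outputs

section Joint

variable [Fintype Y] (Q : X1 → X2 → X3 → Y → ℝ)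

/-- The joint law of inputs and output. -/
def joint (t : ((((V1 × V2) × X1) × X2) × X3) × Y) : ℝ :=
  L.pV1 t.1.1.1.1.1 * L.pV2 t.1.1.1.1.2 * L.pX1 t.1.1.1.1.1 t.1.1.1.2 * L.pX2 t.1.1.1.1.2 t.1.1.2
    * L.pX3 t.1.1.1.1.1 t.1.1.1.1.2 t.1.2 * Q t.1.1.1.2 t.1.1.2 t.1.2 t.2

lemma ex_joint (F : ((((V1 × V2) × X1) × X2) × X3) × Y → ℝ) :
    ex (L.joint Q) F = L.chExp Q fun v1 v2 x1 x2 x3 y => F (((((v1, v2), x1), x2), x3), y) := by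
  simp only [ex, joint, chExp, Fintype.sum_prod_type, Finset.mul_sum, mul_assoc]

variable {Q}

lemma joint_isPmf (hQ : ∀ x1 x2 x3, IsPmf (Q x1 x2 x3)) : IsPmf (L.joint Q) := by
  refine ⟨fun t => ?_, ?_⟩
  · have h1 := L.hV1.nonneg t.1.1.1.1.1
    have h2 := L.hV2.nonneg t.1.1.1.1.2
    have h3 := (L.hX1 t.1.1.1.1.1).nonneg t.1.1.1.2
    have h4 := (L.hX2 t.1.1.1.1.2).nonneg t.1.1.2
    have h5 := (L.hX3 t.1.1.1.1.1 t.1.1.1.1.2).nonneg t.1.2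
    have h6 := (hQ t.1.1.1.2 t.1.1.2 t.1.2).nonneg t.2
    unfold joint
    positivity
  · have h := L.ex_joint Q (fun _ => 1)
    simp only [chExp, ex_const L.hV1, ex_const L.hV2, ex_const (L.hX1 _), ex_const (L.hX2 _),
      ex_const (L.hX3 _ _), ex_const (hQ _ _ _)] at h
    simpa [ex] using h

variable (Q)

lemma block_chExp (N : ℕ) (F) : (L.block N).chExp (chBlock Q N) F =
    ex (pm fun _ : Fin N => L.joint Q) fun t => F (fun i => (t i).1.1.1.1.1)
      (fun i => (t i).1.1.1.1.2) (fun i => (t i).1.1.1.2) (fun i => (t i).1.1.2)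
      (fun i => (t i).1.2) (fun i => (t i).2) := by
  unfold chExp
  refine Eq.trans (ex_pm_zip (fun _ => L.pV1) (fun _ _ => L.pV2) _) ?_
  refine Eq.trans (ex_pm_zip (fun _ (t : V1 × V2) => L.pV1 t.1 * L.pV2 t.2) (fun _ t => L.pX1 t.1)
    (fun (h : Fin N → V1 × V2) x1 =>
    ex (pm fun i => L.pX2 (h i).2) fun x2 => ex (pm fun i => L.pX3 (h i).1 (h i).2) fun x3 =>
      ex (pm fun i => Q (x1 i) (x2 i) (x3 i)) fun y =>
        F (fun i => (h i).1) (fun i => (h i).2) x1 x2 x3 y)) ?_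
  refine Eq.trans (ex_pm_zip
    (fun _ (t : (V1 × V2) × X1) => L.pV1 t.1.1 * L.pV2 t.1.2 * L.pX1 t.1.1 t.2)
    (fun _ t => L.pX2 t.1.2) (fun h x2 =>
    ex (pm fun i => L.pX3 (h i).1.1 (h i).1.2) fun x3 =>
      ex (pm fun i => Q (h i).2 (x2 i) (x3 i)) fun y =>
        F (fun i => (h i).1.1) (fun i => (h i).1.2) (fun i => (h i).2) x2 x3 y)) ?_
  refine Eq.trans (ex_pm_zip
    (fun _ (t : ((V1 × V2) × X1) × X2) =>
      L.pV1 t.1.1.1 * L.pV2 t.1.1.2 * L.pX1 t.1.1.1 t.1.2 * L.pX2 t.1.1.2 t.2)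
    (fun _ t => L.pX3 t.1.1.1 t.1.1.2) (fun h x3 =>
    ex (pm fun i => Q (h i).1.2 (h i).2 (x3 i)) fun y =>
      F (fun i => (h i).1.1.1) (fun i => (h i).1.1.2) (fun i => (h i).1.2) (fun i => (h i).2)
        x3 y)) ?_
  exact ex_pm_zip (fun _ (t : (((V1 × V2) × X1) × X2) × X3) =>
      L.pV1 t.1.1.1.1 * L.pV2 t.1.1.1.2 * L.pX1 t.1.1.1.1 t.1.1.2 * L.pX2 t.1.1.1.2 t.1.2
        * L.pX3 t.1.1.1.1 t.1.1.1.2 t.2)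
    (fun _ t => Q t.1.1.2 t.1.2 t.2) (fun h y =>
    F (fun i => (h i).1.1.1.1) (fun i => (h i).1.1.1.2) (fun i => (h i).1.1.2)
      (fun i => (h i).1.2) (fun i => (h i).2) y)

end Joint

section Positivity

variable [Fintype Y] {Q : X1 → X2 → X3 → Y → ℝ}

lemma ex_pos_of {α : Type*} [Fintype α] {p F : α → ℝ} (hp : ∀ a, 0 ≤ p a) (hF : ∀ a, 0 ≤ F a)
    {a : α} (ha : 0 < p a) (h : 0 < F a) : 0 < ex p F :=
  (mul_pos ha h).trans_le (Finset.single_le_sum (f := fun a => p a * F a)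
    (fun b _ => mul_nonneg (hp b) (hF b)) (mem_univ a))

lemma joint_pos_iff (hQ : ∀ x1 x2 x3, IsPmf (Q x1 x2 x3)) {t} (ht : 0 < L.joint Q t) :
    0 < L.pV1 t.1.1.1.1.1 ∧ 0 < L.pV2 t.1.1.1.1.2 ∧ 0 < L.pX1 t.1.1.1.1.1 t.1.1.1.2 ∧
      0 < L.pX2 t.1.1.1.1.2 t.1.1.2 ∧ 0 < L.pX3 t.1.1.1.1.1 t.1.1.1.1.2 t.1.2 ∧
      0 < Q t.1.1.1.2 t.1.1.2 t.1.2 t.2 := by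
  unfold joint at ht
  have h0 := ht.ne'
  simp only [ne_eq, mul_eq_zero, not_or] at h0
  obtain ⟨⟨⟨⟨⟨h1, h2⟩, h3⟩, h4⟩, h5⟩, h6⟩ := h0
  exact ⟨(L.hV1.nonneg _).lt_of_ne' h1, (L.hV2.nonneg _).lt_of_ne' h2,
    ((L.hX1 _).nonneg _).lt_of_ne' h3, ((L.hX2 _).nonneg _).lt_of_ne' h4,
    ((L.hX3 _ _).nonneg _).lt_of_ne' h5, ((hQ _ _ _).nonneg _).lt_of_ne' h6⟩

end Positivity

section Tails

variable [Fintype Y] {Q : X1 → X2 → X3 → Y → ℝ}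

/-- The relay information rates. -/
def relayInfo (Q : X1 → X2 → X3 → Y → ℝ) : Fin 3 → ℝ :=
  ![L.chExp Q fun v1 _ x1 x2 x3 y => Real.logb 2 (Q x1 x2 x3 y / L.out1 Q v1 x2 x3 y),
    L.chExp Q fun _ v2 x1 x2 x3 y => Real.logb 2 (Q x1 x2 x3 y / L.out2 Q v2 x1 x3 y),
    L.chExp Q fun v1 v2 x1 x2 x3 y => Real.logb 2 (Q x1 x2 x3 y / L.out12 Q v1 v2 x3 y)]

/-- The destination information rates. -/
def destInfo (Q : X1 → X2 → X3 → Y → ℝ) : Fin 3 → ℝ :=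
  ![L.chExp Q fun _ v2 x1 x2 x3 y => Real.logb 2 (Q x1 x2 x3 y / L.out13 Q v2 x2 y),
    L.chExp Q fun v1 _ x1 x2 x3 y => Real.logb 2 (Q x1 x2 x3 y / L.out23 Q v1 x1 y),
    L.chExp Q fun _ _ x1 x2 x3 y => Real.logb 2 (Q x1 x2 x3 y / L.out123 Q y)]

lemma exists_relayTail_le (hQ : ∀ x1 x2 x3, IsPmf (Q x1 x2 x3)) {δ : ℝ} (hδ : 0 < δ) :
    ∃ C : ℝ, ∀ N : ℕ, 0 < N → (L.block N).relayTail (chBlock Q N)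
      (fun j => (2 : ℝ) ^ ((N : ℝ) * (L.relayInfo Q j - δ))) ≤ C / N := by
  have hJ := L.joint_isPmf hQ
  have hQ0 : ∀ x1 x2 x3 y, 0 ≤ Q x1 x2 x3 y := fun x1 x2 x3 => (hQ x1 x2 x3).nonneg
  have hR : ∀ t, 0 < L.joint Q t → 0 < Q t.1.1.1.2 t.1.1.2 t.1.2 t.2 := fun t ht =>
    (L.joint_pos_iff hQ ht).2.2.2.2.2
  obtain ⟨C1, h1⟩ := exists_prod_tail_le hJ hR
    (D := fun t => L.out1 Q t.1.1.1.1.1 t.1.1.2 t.1.2 t.2) (fun t ht => by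
      obtain ⟨p1, p2, p3, p4, p5, p6⟩ := L.joint_pos_iff hQ ht
      exact ex_pos_of (L.hX1 _).nonneg (fun _ => hQ0 _ _ _ _) p3 p6) hδ
  obtain ⟨C2, h2⟩ := exists_prod_tail_le hJ hR
    (D := fun t => L.out2 Q t.1.1.1.1.2 t.1.1.1.2 t.1.2 t.2) (fun t ht => by
      obtain ⟨p1, p2, p3, p4, p5, p6⟩ := L.joint_pos_iff hQ ht
      exact ex_pos_of (L.hX2 _).nonneg (fun _ => hQ0 _ _ _ _) p4 p6) hδ
  obtain ⟨C3, h3⟩ := exists_prod_tail_le hJ hR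
    (D := fun t => L.out12 Q t.1.1.1.1.1 t.1.1.1.1.2 t.1.2 t.2) (fun t ht => by
      obtain ⟨p1, p2, p3, p4, p5, p6⟩ := L.joint_pos_iff hQ ht
      exact ex_pos_of (L.hX1 _).nonneg (fun _ => L.out2_nonneg hQ0 _ _ _ _) p3
        (ex_pos_of (L.hX2 _).nonneg (fun _ => hQ0 _ _ _ _) p4 p6)) hδ
  refine ⟨C1 + C2 + C3, fun N hN => ?_⟩
  have e1 := h1 N hN
  have e2 := h2 N hN
  have e3 := h3 N hN
  simp only [relayTail, block_chExp, block_out1, block_out2, block_out12]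
  rw [ex_joint] at e1 e2 e3
  rw [add_div, add_div]
  exact add_le_add (add_le_add e1 e2) e3

lemma exists_destTail_le (hQ : ∀ x1 x2 x3, IsPmf (Q x1 x2 x3)) {δ : ℝ} (hδ : 0 < δ) :
    ∃ C : ℝ, ∀ N : ℕ, 0 < N → (L.block N).destTail (chBlock Q N)
      (fun j => (2 : ℝ) ^ ((N : ℝ) * (L.destInfo Q j - δ))) ≤ C / N := by
  have hJ := L.joint_isPmf hQ
  have hQ0 : ∀ x1 x2 x3 y, 0 ≤ Q x1 x2 x3 y := fun x1 x2 x3 => (hQ x1 x2 x3).nonneg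
  have hR : ∀ t, 0 < L.joint Q t → 0 < Q t.1.1.1.2 t.1.1.2 t.1.2 t.2 := fun t ht =>
    (L.joint_pos_iff hQ ht).2.2.2.2.2
  have n3 : ∀ v1 v2 x1 x2 y, 0 ≤ ex (L.pX3 v1 v2) fun x3 => Q x1 x2 x3 y :=
    fun _ _ _ _ _ => ex_nonneg (L.hX3 _ _).nonneg fun _ => hQ0 _ _ _ _
  obtain ⟨C1, h1⟩ := exists_prod_tail_le hJ hR
    (D := fun t => L.out13 Q t.1.1.1.1.2 t.1.1.2 t.2) (fun t ht => by
      obtain ⟨p1, p2, p3, p4, p5, p6⟩ := L.joint_pos_iff hQ ht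
      exact ex_pos_of L.hV1.nonneg (fun _ => ex_nonneg (L.hX1 _).nonneg fun _ => n3 _ _ _ _ _) p1
        (ex_pos_of (L.hX1 _).nonneg (fun _ => n3 _ _ _ _ _) p3
          (ex_pos_of (L.hX3 _ _).nonneg (fun _ => hQ0 _ _ _ _) p5 p6))) hδ
  obtain ⟨C2, h2⟩ := exists_prod_tail_le hJ hR
    (D := fun t => L.out23 Q t.1.1.1.1.1 t.1.1.1.2 t.2) (fun t ht => by
      obtain ⟨p1, p2, p3, p4, p5, p6⟩ := L.joint_pos_iff hQ ht
      exact ex_pos_of L.hV2.nonneg (fun _ => ex_nonneg (L.hX2 _).nonneg fun _ => n3 _ _ _ _ _) p2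
        (ex_pos_of (L.hX2 _).nonneg (fun _ => n3 _ _ _ _ _) p4
          (ex_pos_of (L.hX3 _ _).nonneg (fun _ => hQ0 _ _ _ _) p5 p6))) hδ
  obtain ⟨C3, h3⟩ := exists_prod_tail_le hJ hR
    (D := fun t => L.out123 Q t.2) (fun t ht => by
      obtain ⟨p1, p2, p3, p4, p5, p6⟩ := L.joint_pos_iff hQ ht
      have n2 : ∀ v1 v2 x1 y, 0 ≤ ex (L.pX2 v2) fun x2 => ex (L.pX3 v1 v2) fun x3 => Q x1 x2 x3 y :=
        fun _ _ _ _ => ex_nonneg (L.hX2 _).nonneg fun _ => n3 _ _ _ _ _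
      exact ex_pos_of L.hV1.nonneg (fun _ => ex_nonneg L.hV2.nonneg fun _ =>
          ex_nonneg (L.hX1 _).nonneg fun _ => n2 _ _ _ _) p1
        (ex_pos_of L.hV2.nonneg (fun _ => ex_nonneg (L.hX1 _).nonneg fun _ => n2 _ _ _ _) p2
        (ex_pos_of (L.hX1 _).nonneg (fun _ => n2 _ _ _ _) p3
        (ex_pos_of (L.hX2 _).nonneg (fun _ => n3 _ _ _ _ _) p4
          (ex_pos_of (L.hX3 _ _).nonneg (fun _ => hQ0 _ _ _ _) p5 p6))))) hδ
  refine ⟨C1 + C2 + C3, fun N hN => ?_⟩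
  have e1 := h1 N hN
  have e2 := h2 N hN
  have e3 := h3 N hN
  simp only [destTail, block_chExp, block_out13, block_out23, block_out123]
  rw [ex_joint] at e1 e2 e3
  rw [add_div, add_div]
  exact add_le_add (add_le_add e1 e2) e3

end Tails

end InLaw

section SourceTail

variable {T S1 S2 Z : Type*} [Fintype T] [Fintype S1] [Fintype S2]

/-- Conditional entropy rates of a pair of sources with side information. -/
def srcEnt (J : T → ℝ) (f1 : T → S1) (f2 : T → S2) (fz : T → Z) (r : S1 → S2 → Z → ℝ) :
    Fin 3 → ℝ :=
  ![- ex J fun t => Real.logb 2 (r (f1 t) (f2 t) (fz t) / ∑ a, r a (f2 t) (fz t)),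
    - ex J fun t => Real.logb 2 (r (f1 t) (f2 t) (fz t) / ∑ b, r (f1 t) b (fz t)),
    - ex J fun t => Real.logb 2 (r (f1 t) (f2 t) (fz t) / ∑ a, ∑ b, r a b (fz t))]

lemma sum_prod_eq {ι α : Type*} [Fintype ι] [DecidableEq ι] [Fintype α] (g : ι → α → ℝ) :
    ∑ f : ι → α, ∏ i, g i (f i) = ∏ i, ∑ a, g i a := by
  rw [Finset.prod_univ_sum, Fintype.piFinset_univ]

lemma exists_srcBad_le {J : T → ℝ} (hJ : IsPmf J) (f1 : T → S1) (f2 : T → S2) (fz : T → Z)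
    {r : S1 → S2 → Z → ℝ} (hr : ∀ a b z, 0 ≤ r a b z)
    (hpos : ∀ t, 0 < J t → 0 < r (f1 t) (f2 t) (fz t)) {δ : ℝ} (hδ : 0 < δ) :
    ∃ C : ℝ, ∀ M : ℕ, 0 < M → ex (pm fun _ : Fin M => J) (fun t =>
      Codebook.srcBad (fun (a : Fin M → S1) (b : Fin M → S2) => ∏ i, r (a i) (b i) (fz (t i)))
        (fun j => (2 : ℝ) ^ ((M : ℝ) * (srcEnt J f1 f2 fz r j + δ)))
        (fun i => f1 (t i)) (fun i => f2 (t i))) ≤ C / M := by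
  obtain ⟨C1, h1⟩ := exists_prod_tail_le hJ hpos
    (D := fun t => ∑ a, r a (f2 t) (fz t)) (fun t ht => (hpos t ht).trans_le
      (Finset.single_le_sum (f := fun a => r a (f2 t) (fz t)) (fun _ _ => hr _ _ _)
        (mem_univ _))) hδ
  obtain ⟨C2, h2⟩ := exists_prod_tail_le hJ hpos
    (D := fun t => ∑ b, r (f1 t) b (fz t)) (fun t ht => (hpos t ht).trans_le
      (Finset.single_le_sum (f := fun b => r (f1 t) b (fz t)) (fun _ _ => hr _ _ _)
        (mem_univ _))) hδ
  obtain ⟨C3, h3⟩ := exists_prod_tail_le hJ hpos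
    (D := fun t => ∑ a, ∑ b, r a b (fz t)) (fun t ht => ((hpos t ht).trans_le
      (Finset.single_le_sum (f := fun b => r (f1 t) b (fz t)) (fun _ _ => hr _ _ _)
        (mem_univ _))).trans_le (Finset.single_le_sum (f := fun a => ∑ b, r a b (fz t))
          (fun _ _ => Finset.sum_nonneg fun _ _ => hr _ _ _) (mem_univ _))) hδ
  refine ⟨C1 + C2 + C3, fun M hM => ?_⟩
  have flip : ∀ (H x y : ℝ), (2 : ℝ) ^ ((M : ℝ) * (-H + δ)) * x < y →
      x ≤ (2 : ℝ) ^ ((M : ℝ) * (H - δ)) * y := by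
    intro H x y h
    have hp : (0 : ℝ) < 2 ^ ((M : ℝ) * (H - δ)) := by positivity
    have h2 : (2 : ℝ) ^ ((M : ℝ) * (H - δ)) * 2 ^ ((M : ℝ) * (-H + δ)) = 1 := by
      rw [← Real.rpow_add (by norm_num)]
      ring_nf
      exact Real.rpow_zero 2
    have h3 := mul_lt_mul_of_pos_left h hp
    rw [← mul_assoc, h2, one_mul] at h3
    exact h3.le
  have hp := fun t => pm_nonneg (fun _ : Fin M => hJ.nonneg) t
  have s3 : ∀ t : Fin M → T, ∑ a : Fin M → S1, ∑ b : Fin M → S2, ∏ i, r (a i) (b i) (fz (t i)) =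
      ∏ i, ∑ a, ∑ b, r a b (fz (t i)) := by
    intro t
    rw [← sum_prod_eq fun i a => ∑ b, r a b (fz (t i))]
    exact Finset.sum_congr rfl fun a _ => sum_prod_eq fun i b => r (a i) b (fz (t i))
  simp only [Codebook.srcBad, ex_add]
  rw [add_div, add_div]
  refine add_le_add (add_le_add ?_ ?_) ?_
  · refine (ex_mono hp fun t => ind_mono fun h => ?_).trans (h1 M hM)
    rw [sum_prod_eq fun i a => r a (f2 (t i)) (fz (t i))] at h
    exact flip _ _ _ h
  · refine (ex_mono hp fun t => ind_mono fun h => ?_).trans (h2 M hM)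
    rw [sum_prod_eq fun i b => r (f1 (t i)) b (fz (t i))] at h
    exact flip _ _ _ h
  · refine (ex_mono hp fun t => ind_mono fun h => ?_).trans (h3 M hM)
    rw [s3 t] at h
    exact flip _ _ _ h

end SourceTail

section CausalNormalization

/-- A causal product of kernels has total mass one. -/
lemma sum_causal_prod {Z : Type*} [Fintype Z] (n : ℕ)
    (K : (k : Fin n) → (Fin k.val → Z) → Z → ℝ) (hK : ∀ k h, ∑ z, K k h z = 1) :
    ∑ z : Fin n → Z, ∏ k, K k (fun j => z ⟨j.val, j.isLt.trans k.isLt⟩) (z k) = 1 := by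
  induction n with
  | zero => simp
  | succ n ih =>
    rw [← (Fin.snocEquiv fun _ : Fin (n + 1) => Z).sum_comp, Fintype.sum_prod_type_right]
    have h1 := ih (fun k => K k.castSucc) (fun k h => hK k.castSucc h)
    rw [← h1]
    refine Finset.sum_congr rfl fun z _ => ?_
    have h2 : ∀ x : Z, ∏ k : Fin (n + 1), K k (fun j => (Fin.snocEquiv (fun _ => Z) (x, z) :
        Fin (n + 1) → Z) ⟨j.val, j.isLt.trans k.isLt⟩) ((Fin.snocEquiv (fun _ => Z) (x, z) :
        Fin (n + 1) → Z) k) =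
        (∏ k : Fin n, K k.castSucc (fun j => z ⟨j.val, j.isLt.trans k.isLt⟩) (z k)) *
          K (Fin.last n) z x := by
      intro x
      rw [Fin.prod_univ_castSucc]
      have h3 : ∀ (j : ℕ) (hj : j < n), (Fin.snoc z x : Fin (n + 1) → Z) ⟨j, hj.trans n.lt_succ_self⟩
          = z ⟨j, hj⟩ := fun j hj => Fin.snoc_castSucc (α := fun _ => Z) x z ⟨j, hj⟩
      congr 1
      · refine Finset.prod_congr rfl fun k _ => ?_
        congr 1
        · funext j
          exact h3 j (j.isLt.trans k.isLt)
        · exact Fin.snoc_castSucc (α := fun _ => Z) x z k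
      · congr 1
        · funext j
          exact h3 j j.isLt
        · exact Fin.snoc_last (α := fun _ => Z) x z
    simp only [h2]
    rw [← Finset.mul_sum, hK, mul_one]
    rfl

end CausalNormalization

section Marginal

variable {ι α γ : Type*} [Fintype ι] [DecidableEq ι] [Fintype α] [Fintype γ]

lemma ex_pm_snd (p : ι → α × γ → ℝ) (F : (ι → γ) → ℝ) :
    ex (pm p) (fun z => F fun i => (z i).2) = ex (pm fun i b => ∑ a, p i (a, b)) F := by
  unfold ex pm
  rw [← (Equiv.arrowProdEquivProdArrow ι (fun _ => α) (fun _ => γ)).symm.sum_comp,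
    Fintype.sum_prod_type_right]
  refine Finset.sum_congr rfl fun g _ => ?_
  rw [← sum_prod_eq fun i a => p i (a, g i), Finset.sum_mul]
  rfl

lemma ex_pm_fst (p : ι → α × γ → ℝ) (F : (ι → α) → ℝ) :
    ex (pm p) (fun z => F fun i => (z i).1) = ex (pm fun i a => ∑ b, p i (a, b)) F := by
  unfold ex pm
  rw [← (Equiv.arrowProdEquivProdArrow ι (fun _ => α) (fun _ => γ)).symm.sum_comp,
    Fintype.sum_prod_type]
  refine Finset.sum_congr rfl fun g _ => ?_
  rw [← sum_prod_eq fun i b => p i (g i, b), Finset.sum_mul]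
  rfl

end Marginal

/-- A block Markov scheme: `B` source blocks of length `M`, channel blocks of length `N`. -/
structure BlockScheme (S1 S2 W W3 X1 X2 X3 Y Y3 : Type) (M N B m : ℕ) where
  /-- positions of the source blocks -/
  pos : Fin B → Fin M → Fin m
  /-- the pair used before the first and after the last block -/
  u0 : (Fin M → S1) × (Fin M → S2)
  /-- first encoder, `x1 new old` -/
  x1 : (Fin M → S1) → (Fin M → S1) → Fin N → X1
  /-- second encoder, `x2 new old` -/
  x2 : (Fin M → S2) → (Fin M → S2) → Fin N → X2
  /-- relay encoder -/
  x3 : (Fin M → S1) × (Fin M → S2) → Fin N → X3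
  /-- relay decoder given the previous pair -/
  decR : (Fin M → S1) × (Fin M → S2) → (Fin N → Y3) → (Fin M → W3) →
    (Fin M → S1) × (Fin M → S2)
  /-- destination decoder given the next pair -/
  decD : (Fin M → S1) × (Fin M → S2) → (Fin N → Y) → (Fin M → W) →
    (Fin M → S1) × (Fin M → S2)

namespace BlockScheme

variable {S1 S2 W W3 X1 X2 X3 Y Y3 : Type} {M N B m n : ℕ}
  (σ : BlockScheme S1 S2 W W3 X1 X2 X3 Y Y3 M N B m)

/-- The block messages of the first source. -/
def msg1 (s : Fin m → S1) : ℕ → (Fin M → S1)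
  | 0 => σ.u0.1
  | t + 1 => if h : t < B then fun j => s (σ.pos ⟨t, h⟩ j) else σ.u0.1

/-- The block messages of the second source. -/
def msg2 (s : Fin m → S2) : ℕ → (Fin M → S2)
  | 0 => σ.u0.2
  | t + 1 => if h : t < B then fun j => s (σ.pos ⟨t, h⟩ j) else σ.u0.2

/-- The pair of block messages. -/
def msg (s : Fin m → S1 × S2 × W × W3) (t : ℕ) : (Fin M → S1) × (Fin M → S2) :=
  (σ.msg1 (fun i => (s i).1) t, σ.msg2 (fun i => (s i).2.1) t)

/-- Extension of a finite output sequence by an arbitrary symbol. -/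
def extendSeq {Z : Type*} [Nonempty Z] {k : ℕ} (y : Fin k → Z) (i : ℕ) : Z :=
  if h : i < k then y ⟨i, h⟩ else Classical.arbitrary Z

/-- The `t`-th channel block of an output sequence. -/
def chunk {Z : Type*} (N : ℕ) (y : ℕ → Z) (t : ℕ) (j : Fin N) : Z := y (t * N + j)

/-- The forward estimates of the relay. -/
def relayEst (y : ℕ → Y3) (w : Fin m → W3) : ℕ → (Fin M → S1) × (Fin M → S2)
  | 0 => σ.u0
  | t + 1 => if h : t < B then
      σ.decR (relayEst y w t) (chunk N y t) (fun j => w (σ.pos ⟨t, h⟩ j)) else σ.u0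

/-- The backward estimates of the destination: `destEst y w r` estimates block `B + 1 - r`. -/
def destEst (y : ℕ → Y) (w : Fin m → W) : ℕ → (Fin M → S1) × (Fin M → S2)
  | 0 => σ.u0
  | r + 1 => if h : r < B then
      σ.decD (destEst y w r) (chunk N y (B - r))
        (fun j => w (σ.pos ⟨B - r - 1, by omega⟩ j)) else σ.u0

/-- The source-channel code of a block scheme. -/
def code [Nonempty Y] [Nonempty Y3] (hN : 0 < N) (loc : Fin m → Fin B × Fin M) (n : ℕ) :
    MARCCode S1 S2 W W3 X1 X2 X3 Y Y3 m n where
  f1 s k := σ.x1 (σ.msg1 s (k / N + 1)) (σ.msg1 s (k / N)) ⟨k % N, Nat.mod_lt _ hN⟩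
  f2 s k := σ.x2 (σ.msg2 s (k / N + 1)) (σ.msg2 s (k / N)) ⟨k % N, Nat.mod_lt _ hN⟩
  f3 k y w := σ.x3 (σ.relayEst (extendSeq y) w (k / N)) ⟨k % N, Nat.mod_lt _ hN⟩
  g y w := (fun i => (σ.destEst (extendSeq y) w (B - (loc i).1)).1 (loc i).2,
    fun i => (σ.destEst (extendSeq y) w (B - (loc i).1)).2 (loc i).2)

lemma relayEst_congr {y y' : ℕ → Y3} (w : Fin m → W3) (t : ℕ)
    (h : ∀ i < t * N, y i = y' i) : σ.relayEst y w t = σ.relayEst y' w t := by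
  induction t with
  | zero => rfl
  | succ t ih =>
    have e : chunk N y t = chunk N y' t := by
      funext j
      refine h _ ?_
      rw [Nat.succ_mul]
      exact Nat.add_lt_add_left j.isLt _
    simp only [relayEst, e, ih fun i hi => h i (hi.trans_le (Nat.mul_le_mul_right N t.le_succ))]

/-- All genie-aided relay decodings are correct. -/
def RelayOk (s : Fin m → S1 × S2 × W × W3) (y : ℕ → Y3) : Prop :=
  ∀ t : Fin B, σ.decR (σ.msg s t) (chunk N y t) (fun j => (s (σ.pos t j)).2.2.2) =
    σ.msg s (t + 1)

/-- All genie-aided destination decodings are correct. -/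
def DestOk (s : Fin m → S1 × S2 × W × W3) (y : ℕ → Y) : Prop :=
  ∀ t : Fin B, σ.decD (σ.msg s (t + 2)) (chunk N y (t + 1)) (fun j => (s (σ.pos t j)).2.2.1) =
    σ.msg s (t + 1)

lemma relayEst_eq {s : Fin m → S1 × S2 × W × W3} {y : ℕ → Y3} (h : σ.RelayOk s y) (t : ℕ) :
    σ.relayEst y (fun i => (s i).2.2.2) t = σ.msg s t := by
  induction t with
  | zero => rfl
  | succ t ih =>
    by_cases ht : t < B
    · simp only [relayEst, dif_pos ht, ih]
      exact h ⟨t, ht⟩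
    · simp only [relayEst, dif_neg ht, msg, msg1, msg2]

lemma destEst_eq {s : Fin m → S1 × S2 × W × W3} {y : ℕ → Y} (h : σ.DestOk s y) (r : ℕ)
    (hr : r ≤ B) : σ.destEst y (fun i => (s i).2.2.1) r = σ.msg s (B + 1 - r) := by
  induction r with
  | zero => simp [destEst, msg, msg1, msg2]
  | succ r ih =>
    have hr' : r < B := hr
    simp only [destEst, dif_pos hr', ih hr'.le]
    have := h ⟨B - r - 1, by omega⟩
    simp only at this
    rw [show B - r - 1 + 2 = B + 1 - r by omega, show B - r - 1 + 1 = B - r by omega] at this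
    rw [this, show B + 1 - (r + 1) = B - r by omega]

lemma msg_succ (s : Fin m → S1 × S2 × W × W3) (t : Fin B) : σ.msg s (t + 1) =
    (fun j => (s (σ.pos t j)).1, fun j => (s (σ.pos t j)).2.1) := by
  simp [msg, msg1, msg2]

section Channels

variable [Fintype X1] [Fintype X2] [Fintype X3] [Fintype Y] [Fintype Y3]
  (ch : DMMARC X1 X2 X3 Y Y3)

/-- The channel to the relay. -/
def relayCh (x1 : X1) (x2 : X2) (x3 : X3) (y3 : Y3) : ℝ := ∑ y, ch.P x1 x2 x3 y y3

/-- The channel to the destination. -/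
def destCh (x1 : X1) (x2 : X2) (x3 : X3) (y : Y) : ℝ := ∑ y3, ch.P x1 x2 x3 y y3

lemma relayCh_isPmf (x1 : X1) (x2 : X2) (x3 : X3) : IsPmf (relayCh ch x1 x2 x3) :=
  ⟨fun _ => Finset.sum_nonneg fun _ _ => ch.nonneg _ _ _ _ _, by
    unfold relayCh; rw [Finset.sum_comm]; exact ch.sum_one _ _ _⟩

lemma destCh_isPmf (x1 : X1) (x2 : X2) (x3 : X3) : IsPmf (destCh ch x1 x2 x3) :=
  ⟨fun _ => Finset.sum_nonneg fun _ _ => ch.nonneg _ _ _ _ _, ch.sum_one _ _ _⟩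

end Channels

section Error

variable [Fintype S1] [Fintype S2] [Fintype W] [Fintype W3]
  [Fintype X1] [Fintype X2] [Fintype X3] [Fintype Y] [Fintype Y3] [Nonempty Y] [Nonempty Y3]
  (hN : 0 < N) (src : SourcePMF (S1 × S2 × W × W3)) (ch : DMMARC X1 X2 X3 Y Y3)

/-- The channel kernel at time `k` when the relay knows the previous messages. -/
def genieKernel (s : Fin m → S1 × S2 × W × W3) (k : ℕ) (z : Y × Y3) : ℝ :=
  ch.P (σ.x1 (σ.msg s (k / N + 1)).1 (σ.msg s (k / N)).1 ⟨k % N, Nat.mod_lt _ hN⟩)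
    (σ.x2 (σ.msg s (k / N + 1)).2 (σ.msg s (k / N)).2 ⟨k % N, Nat.mod_lt _ hN⟩)
    (σ.x3 (σ.msg s (k / N)) ⟨k % N, Nat.mod_lt _ hN⟩) z.1 z.2

lemma genieKernel_isPmf (s : Fin m → S1 × S2 × W × W3) (k : ℕ) :
    IsPmf (σ.genieKernel hN ch s k) :=
  ⟨fun _ => ch.nonneg _ _ _ _ _, by rw [Fintype.sum_prod_type]; exact ch.sum_one _ _ _⟩

/-- The conditional law of the outputs given the sources. -/
def condLaw (c : MARCCode S1 S2 W W3 X1 X2 X3 Y Y3 m n) (s : Fin m → S1 × S2 × W × W3)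
    (z : Fin n → Y × Y3) : ℝ :=
  ∏ k, ch.P (c.f1 (fun i => (s i).1) k) (c.f2 (fun i => (s i).2.1) k)
      (relayIn c (fun k => (z k).2) (fun i => (s i).2.2.2) k) (z k).1 (z k).2

lemma condLaw_isPmf (c : MARCCode S1 S2 W W3 X1 X2 X3 Y Y3 m n)
    (s : Fin m → S1 × S2 × W × W3) : IsPmf (condLaw ch c s) := by
  refine ⟨fun z => Finset.prod_nonneg fun _ _ => ch.nonneg _ _ _ _ _, ?_⟩
  exact sum_causal_prod (Z := Y × Y3) n (fun k h z => ch.P (c.f1 (fun i => (s i).1) k)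
    (c.f2 (fun i => (s i).2.1) k) (c.f3 k (fun j => (h j).2) fun i => (s i).2.2.2) z.1 z.2)
    fun k h => by rw [Fintype.sum_prod_type]; exact ch.sum_one _ _ _

lemma marcErr_eq (c : MARCCode S1 S2 W W3 X1 X2 X3 Y Y3 m n) :
    marcErr src ch c = ex (pm fun _ => src.q) fun s => ex (condLaw ch c s) fun z =>
      ind (c.g (fun k => (z k).1) (fun i => (s i).2.2.1) ≠
        (fun i => (s i).1, fun i => (s i).2.1)) := by
  unfold marcErr ex
  rw [Fintype.sum_prod_type]
  refine Finset.sum_congr rfl fun s _ => ?_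
  rw [← (Equiv.arrowProdEquivProdArrow (Fin n) (fun _ => Y) (fun _ => Y3)).sum_comp,
    Finset.mul_sum]
  refine Finset.sum_congr rfl fun z _ => ?_
  simp only [marcLaw, condLaw, pm, ind, mul_ite, mul_one, mul_zero]
  rfl

lemma condLaw_eq (loc : Fin m → Fin B × Fin M) {s : Fin m → S1 × S2 × W × W3}
    {z : Fin n → Y × Y3} (h : σ.RelayOk s (extendSeq fun k => (z k).2)) :
    condLaw ch (σ.code hN loc n) s z =
      pm (fun k : Fin n => σ.genieKernel hN ch s k) z := by
  refine Finset.prod_congr rfl fun k _ => ?_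
  have e : σ.relayEst (extendSeq fun j : Fin k.val => (z ⟨j, j.isLt.trans k.isLt⟩).2)
      (fun i => (s i).2.2.2) (k / N) = σ.msg s (k / N) := by
    rw [← σ.relayEst_eq h]
    refine σ.relayEst_congr _ _ fun i hi => ?_
    have hik : i < k := hi.trans_le (Nat.div_mul_le_self _ _)
    simp only [extendSeq, dif_pos hik, dif_pos (hik.trans k.isLt)]
  simp only [genieKernel, relayIn, code, e]
  rfl

lemma marcErr_code_le_genie (loc : Fin m → Fin B × Fin M)
    (hloc : ∀ i, σ.pos (loc i).1 (loc i).2 = i) :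
    marcErr src ch (σ.code hN loc n) ≤ ex (pm fun _ => src.q) fun s =>
      ex (pm fun k : Fin n => σ.genieKernel hN ch s k) fun z =>
        ind (¬ σ.RelayOk s (extendSeq fun k => (z k).2)) +
          ind (¬ σ.DestOk s (extendSeq fun k => (z k).1)) := by
  rw [marcErr_eq]
  refine ex_mono (pm_nonneg fun _ => src.nonneg) fun s => ?_
  have hc := condLaw_isPmf ch (σ.code hN loc n) s
  have hg : IsPmf (pm fun k : Fin n => σ.genieKernel hN ch s k) :=
    pm_isPmf fun _ => σ.genieKernel_isPmf hN ch s _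
  set G : (Fin n → Y × Y3) → Prop := fun z => σ.RelayOk s (extendSeq fun k => (z k).2)
  set D : (Fin n → Y × Y3) → Prop := fun z => σ.DestOk s (extendSeq fun k => (z k).1)
  have hdec : ∀ z, D z → (σ.code hN loc n).g (fun k => (z k).1) (fun i => (s i).2.2.1) =
      (fun i => (s i).1, fun i => (s i).2.1) := by
    intro z hz
    have e : ∀ b : Fin B, σ.destEst (extendSeq fun k => (z k).1) (fun i => (s i).2.2.1) (B - b) =
        (fun j => (s (σ.pos b j)).1, fun j => (s (σ.pos b j)).2.1) := by
      intro b
      rw [σ.destEst_eq hz _ (Nat.sub_le _ _), show B + 1 - (B - b) = b + 1 by omega, σ.msg_succ]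
    simp only [code, e, hloc]
  have hflip : ∀ p : (Fin n → Y × Y3) → ℝ, IsPmf p →
      ex p (fun z => ind (¬ G z)) = 1 - ex p (fun z => ind (G z)) := by
    intro p hp
    rw [← ex_const hp 1, ← ex_sub]
    refine ex_congr fun z => ?_
    by_cases h : G z <;> simp [ind, h]
  have hsame : ∀ F : (Fin n → Y × Y3) → ℝ, ex (condLaw ch (σ.code hN loc n) s)
      (fun z => ind (G z) * F z) =
      ex (pm fun k : Fin n => σ.genieKernel hN ch s k) (fun z => ind (G z) * F z) := by
    intro F
    refine Finset.sum_congr rfl fun z _ => ?_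
    by_cases h : G z
    · rw [σ.condLaw_eq hN ch loc h]
    · simp [ind_false h]
  have hsame1 := hsame fun _ => 1
  simp only [mul_one] at hsame1
  rw [ex_add, hflip _ hg, ← hsame1, ← hflip _ hc]
  refine le_trans (ex_mono (G := fun z => ind (¬ G z) + ind (G z) * ind (¬ D z)) hc.nonneg
    fun z => ?_) ?_
  · by_cases h : G z
    · rw [ind_false (not_not.2 h), ind_true h, zero_add, one_mul]
      exact ind_mono fun hne hd => hne (hdec z hd)
    · rw [ind_true h, ind_false h, zero_mul, add_zero]
      exact ind_le_one _
  · rw [ex_add, hsame]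
    refine add_le_add le_rfl (ex_mono hg.nonneg fun z => ?_)
    exact mul_le_of_le_one_left (ind_nonneg _) (ind_le_one _)

lemma ex_genie_chunk (s : Fin m → S1 × S2 × W × W3) {t : ℕ} (ht : (t + 1) * N ≤ n)
    (F : (Fin N → Y × Y3) → ℝ) :
    ex (pm fun k : Fin n => σ.genieKernel hN ch s k)
      (fun z => F fun j => z ⟨t * N + j, by
        have := j.isLt; rw [Nat.succ_mul] at ht; omega⟩) =
    ex (pm fun j z => ch.P (σ.x1 (σ.msg s (t + 1)).1 (σ.msg s t).1 j)
      (σ.x2 (σ.msg s (t + 1)).2 (σ.msg s t).2 j) (σ.x3 (σ.msg s t) j) z.1 z.2) F := by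
  rw [ex_pm_comp (p := fun k : Fin n => σ.genieKernel hN ch s k)
    (fun k => σ.genieKernel_isPmf hN ch s _) (e := fun j : Fin N => (⟨t * N + j, by
        have := j.isLt; rw [Nat.succ_mul] at ht; omega⟩ : Fin n))]
  · congr 2
    funext j z
    have e1 : (t * N + j) / N = t := by
      rw [Nat.mul_comm, Nat.mul_add_div hN, Nat.div_eq_of_lt j.isLt, add_zero]
    have e2 : (t * N + j) % N = j := by
      rw [Nat.mul_comm, Nat.mul_add_mod, Nat.mod_eq_of_lt j.isLt]
    simp only [genieKernel, e1, e2]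
  · intro i j h
    simp only [Fin.mk.injEq] at h
    exact Fin.ext (by omega)

lemma chunk_extendSeq {Z : Type*} [Nonempty Z] (z : Fin n → Z) {t : ℕ} (ht : (t + 1) * N ≤ n) :
    chunk N (extendSeq z) t = fun j : Fin N => z ⟨t * N + j, by
        have := j.isLt; rw [Nat.succ_mul] at ht; omega⟩ := by
  funext j
  have : t * N + j < n := by
    have := j.isLt; rw [Nat.succ_mul] at ht; omega
  simp only [chunk, extendSeq, dif_pos this]

/-- Error probability of a block scheme: sum of the per-block decoding errors. -/
lemma marcErr_code_le (loc : Fin m → Fin B × Fin M)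
    (hloc : ∀ i, σ.pos (loc i).1 (loc i).2 = i) (hn : (B + 1) * N ≤ n) :
    marcErr src ch (σ.code hN loc n) ≤ ∑ t : Fin B, (ex (pm fun _ => src.q) fun s =>
      ex (InLaw.chBlock (relayCh ch) N (σ.x1 (σ.msg s (t + 1)).1 (σ.msg s t).1)
        (σ.x2 (σ.msg s (t + 1)).2 (σ.msg s t).2) (σ.x3 (σ.msg s t))) (fun y =>
          ind (σ.decR (σ.msg s t) y (fun j => (s (σ.pos t j)).2.2.2) ≠ σ.msg s (t + 1))) +
      ex (InLaw.chBlock (destCh ch) N (σ.x1 (σ.msg s (t + 2)).1 (σ.msg s (t + 1)).1)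
        (σ.x2 (σ.msg s (t + 2)).2 (σ.msg s (t + 1)).2) (σ.x3 (σ.msg s (t + 1)))) (fun y =>
          ind (σ.decD (σ.msg s (t + 2)) y (fun j => (s (σ.pos t j)).2.2.1) ≠
            σ.msg s (t + 1)))) := by
  refine (σ.marcErr_code_le_genie hN src ch loc hloc).trans ?_
  rw [← ex_sum]
  refine ex_mono (pm_nonneg fun _ => src.nonneg) fun s => ?_
  have hg : IsPmf (pm fun k : Fin n => σ.genieKernel hN ch s k) :=
    pm_isPmf fun _ => σ.genieKernel_isPmf hN ch s _
  have h1 : ∀ t : Fin B, (t.val + 1) * N ≤ n := fun t =>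
    (Nat.mul_le_mul_right N (by omega)).trans hn
  have h2 : ∀ t : Fin B, (t.val + 1 + 1) * N ≤ n := fun t =>
    (Nat.mul_le_mul_right N (by omega)).trans hn
  rw [ex_add, Finset.sum_add_distrib]
  refine add_le_add ?_ ?_
  · refine (ex_mono hg.nonneg fun z => (ind_mono not_forall.1).trans (ind_exists_le _)).trans ?_
    rw [ex_sum]
    refine Finset.sum_le_sum fun t _ => le_of_eq ?_
    simp only [chunk_extendSeq _ (h1 t)]
    refine Eq.trans (σ.ex_genie_chunk hN ch s (h1 t) (fun z => ind (σ.decR (σ.msg s t)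
      (fun j => (z j).2) (fun j => (s (σ.pos t j)).2.2.2) ≠ σ.msg s (t + 1)))) ?_
    exact ex_pm_snd _ (fun y => ind (σ.decR (σ.msg s t) y _ ≠ σ.msg s (t + 1)))
  · refine (ex_mono hg.nonneg fun z => (ind_mono not_forall.1).trans (ind_exists_le _)).trans ?_
    rw [ex_sum]
    refine Finset.sum_le_sum fun t _ => le_of_eq ?_
    simp only [chunk_extendSeq _ (h2 t)]
    refine Eq.trans (σ.ex_genie_chunk hN ch s (h2 t) (fun z => ind (σ.decD (σ.msg s (t + 2))
      (fun j => (z j).1) (fun j => (s (σ.pos t j)).2.2.1) ≠ σ.msg s (t + 1)))) ?_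
    exact ex_pm_fst _ (fun y => ind (σ.decD (σ.msg s (t + 2)) y _ ≠ σ.msg s (t + 1)))

end Error

end BlockScheme

section Entropy

variable {Ω Ω' A B C : Type*} [Fintype Ω] [Fintype Ω']

lemma pr_eq_ex (μ : Ω → ℝ) (X : Ω → A) (a : A) : pr μ X a = ex μ fun ω => ind (X ω = a) := by
  simp only [pr, ex, ind, mul_ite, mul_one, mul_zero]

lemma pr_nonneg {μ : Ω → ℝ} (hμ : ∀ ω, 0 ≤ μ ω) (X : Ω → A) (a : A) : 0 ≤ pr μ X a := by
  rw [pr_eq_ex]; exact ex_nonneg hμ fun _ => ind_nonneg _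

lemma pr_pos {μ : Ω → ℝ} (hμ : ∀ ω, 0 ≤ μ ω) (X : Ω → A) {ω : Ω} (h : 0 < μ ω) :
    0 < pr μ X (X ω) := by
  rw [pr_eq_ex]
  exact InLaw.ex_pos_of hμ (fun _ => ind_nonneg _) h (by rw [ind_true rfl]; norm_num)

lemma sum_pr_mul [Fintype A] (μ : Ω → ℝ) (X : Ω → A) (g : A → ℝ) :
    ∑ a, pr μ X a * g a = ex μ fun ω => g (X ω) := by
  simp only [pr, ex, Finset.sum_mul]
  rw [Finset.sum_comm]
  refine Finset.sum_congr rfl fun ω _ => ?_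
  simp [ite_mul]

lemma Hent_eq [Fintype A] (μ : Ω → ℝ) (X : Ω → A) :
    Hent μ X = - ex μ fun ω => Real.logb 2 (pr μ X (X ω)) := by
  unfold Hent
  rw [sum_pr_mul μ X fun a => Real.logb 2 (pr μ X a)]

lemma sum_pr_pair [Fintype A] (μ : Ω → ℝ) (X : Ω → A) (Z : Ω → B) (b : B) :
    ∑ a, pr μ (fun ω => (X ω, Z ω)) (a, b) = pr μ Z b := by
  simp only [pr]
  rw [Finset.sum_comm]
  refine Finset.sum_congr rfl fun ω _ => ?_
  by_cases h : Z ω = b <;> simp [h, Prod.ext_iff]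

lemma pr_congr (μ : Ω → ℝ) {X : Ω → A} {X' : Ω → B} {a : A} {b : B}
    (h : ∀ ω, X ω = a ↔ X' ω = b) : pr μ X a = pr μ X' b := by
  simp only [pr, h]

lemma pr_comp {μ : Ω → ℝ} {ν : Ω' → ℝ} {π : Ω → Ω'}
    (h : ∀ F : Ω' → ℝ, ex μ (fun ω => F (π ω)) = ex ν F) (X : Ω' → A) (a : A) :
    pr μ (fun ω => X (π ω)) a = pr ν X a := by
  rw [pr_eq_ex, pr_eq_ex]
  exact h fun ω => ind (X ω = a)

lemma Hent_comp [Fintype A] {μ : Ω → ℝ} {ν : Ω' → ℝ} {π : Ω → Ω'}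
    (h : ∀ F : Ω' → ℝ, ex μ (fun ω => F (π ω)) = ex ν F) (X : Ω' → A) :
    Hent μ (fun ω => X (π ω)) = Hent ν X := by
  simp only [Hent, pr_comp h]

lemma condEnt_comp [Fintype A] [Fintype B] {μ : Ω → ℝ} {ν : Ω' → ℝ} {π : Ω → Ω'}
    (h : ∀ F : Ω' → ℝ, ex μ (fun ω => F (π ω)) = ex ν F) (X : Ω' → A) (Z : Ω' → B) :
    condEnt μ (fun ω => X (π ω)) (fun ω => Z (π ω)) = condEnt ν X Z := by
  unfold condEnt
  rw [Hent_comp h Z, Hent_comp h fun ω => (X ω, Z ω)]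

lemma mutInfo_comp [Fintype A] [Fintype B] {μ : Ω → ℝ} {ν : Ω' → ℝ} {π : Ω → Ω'}
    (h : ∀ F : Ω' → ℝ, ex μ (fun ω => F (π ω)) = ex ν F) (X : Ω' → A) (Z : Ω' → B) :
    mutInfo μ (fun ω => X (π ω)) (fun ω => Z (π ω)) = mutInfo ν X Z := by
  unfold mutInfo
  rw [Hent_comp h X, Hent_comp h Z, Hent_comp h fun ω => (X ω, Z ω)]

lemma condMutInfo_comp [Fintype A] [Fintype B] [Fintype C] {μ : Ω → ℝ} {ν : Ω' → ℝ} {π : Ω → Ω'}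
    (h : ∀ F : Ω' → ℝ, ex μ (fun ω => F (π ω)) = ex ν F) (X : Ω' → A) (Y : Ω' → B) (Z : Ω' → C) :
    condMutInfo μ (fun ω => X (π ω)) (fun ω => Y (π ω)) (fun ω => Z (π ω)) =
      condMutInfo ν X Y Z := by
  unfold condMutInfo
  rw [condEnt_comp h X Z, condEnt_comp h X fun ω => (Y ω, Z ω)]

lemma ex_congr_of_pos {p F G : Ω → ℝ} (hp : ∀ a, 0 ≤ p a) (h : ∀ a, 0 < p a → F a = G a) :
    ex p F = ex p G :=
  le_antisymm (ex_mono_of_pos hp fun a ha => (h a ha).le)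
    (ex_mono_of_pos hp fun a ha => (h a ha).ge)

lemma condEnt_eq [Fintype A] [Fintype B] {μ : Ω → ℝ} (hμ : ∀ ω, 0 ≤ μ ω) (X : Ω → A) (Z : Ω → B) :
    condEnt μ X Z = - ex μ fun ω =>
      Real.logb 2 (pr μ (fun ω => (X ω, Z ω)) (X ω, Z ω) / pr μ Z (Z ω)) := by
  unfold condEnt
  rw [Hent_eq, Hent_eq, neg_sub_neg, ← neg_sub, ← ex_sub]
  congr 1
  refine ex_congr_of_pos hμ fun ω h => ?_
  rw [Real.logb_div (pr_pos hμ (fun ω => (X ω, Z ω)) h).ne' (pr_pos hμ Z h).ne']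

end Entropy

section SourceEntropy

variable {T S1 S2 Z : Type*} [Fintype T] [Fintype S1] [Fintype S2] [Fintype Z]

/-- Marginal law of the sources and one side information. -/
def srcMarg (J : T → ℝ) (f1 : T → S1) (f2 : T → S2) (fz : T → Z) (a : S1) (b : S2) (z : Z) : ℝ :=
  pr J (fun t => (f1 t, f2 t, fz t)) (a, b, z)

variable {J : T → ℝ} (f1 : T → S1) (f2 : T → S2) (fz : T → Z)

lemma sum_srcMarg_left (b : S2) (z : Z) :
    ∑ a, srcMarg J f1 f2 fz a b z = pr J (fun t => (f2 t, fz t)) (b, z) :=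
  sum_pr_pair J f1 (fun t => (f2 t, fz t)) (b, z)

lemma srcMarg_swap (a : S1) (b : S2) (z : Z) :
    srcMarg J f1 f2 fz a b z = srcMarg J f2 f1 fz b a z :=
  pr_congr J fun t => by simp only [Prod.mk.injEq]; tauto

lemma sum_srcMarg_right (a : S1) (z : Z) :
    ∑ b, srcMarg J f1 f2 fz a b z = pr J (fun t => (f1 t, fz t)) (a, z) := by
  simp only [srcMarg_swap f1]
  exact sum_srcMarg_left f2 f1 fz a z

lemma srcEnt_eq (hJ : ∀ t, 0 ≤ J t) : srcEnt J f1 f2 fz (srcMarg J f1 f2 fz) =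
    ![condEnt J f1 (fun t => (f2 t, fz t)), condEnt J f2 (fun t => (f1 t, fz t)),
      condEnt J (fun t => (f1 t, f2 t)) fz] := by
  unfold srcEnt
  rw [condEnt_eq hJ, condEnt_eq hJ, condEnt_eq hJ]
  simp only [sum_srcMarg_left, sum_srcMarg_right, sum_pr_pair]
  have e1 : ∀ t, pr J (fun ω => (f2 ω, f1 ω, fz ω)) (f2 t, f1 t, fz t) =
      srcMarg J f1 f2 fz (f1 t) (f2 t) (fz t) := fun t =>
    pr_congr J fun t => by simp only [Prod.mk.injEq]; tauto
  have e2 : ∀ t, pr J (fun ω => ((f1 ω, f2 ω), fz ω)) ((f1 t, f2 t), fz t) =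
      srcMarg J f1 f2 fz (f1 t) (f2 t) (fz t) := fun t =>
    pr_congr J fun t => by simp only [Prod.mk.injEq]; tauto
  simp only [e1, e2]
  rfl

end SourceEntropy

section KernelInfo

variable {U Y A C : Type*} [Fintype U] [Fintype Y] [Fintype A] [Fintype C] {P : U → ℝ}
  {K : U → Y → ℝ}

lemma pr_input (hK : ∀ u, IsPmf (K u)) (g : U → A) (a : A) :
    pr (fun t : U × Y => P t.1 * K t.1 t.2) (fun t => g t.1) a = ex P fun u => ind (g u = a) := by
  rw [pr_eq_ex, ex_prod]
  exact ex_congr fun u => ex_const (hK u) (ind (g u = a))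

lemma pr_input_output (g : U → A) (f : A → Y → C) (hf : ∀ a y a' y', f a y = f a' y' → a = a' ∧ y = y')
    (a : A) (y : Y) :
    pr (fun t : U × Y => P t.1 * K t.1 t.2) (fun t => f (g t.1) t.2) (f a y) =
      ex P fun u => ind (g u = a) * K u y := by
  rw [pr_eq_ex, ex_prod]
  refine ex_congr fun u => ?_
  have : ∀ y', ind (f (g u) y' = f a y) = ind (g u = a) * ind (y' = y) := by
    intro y'
    unfold ind
    by_cases h1 : g u = a <;> by_cases h2 : y' = y
    · simp [h1, h2]
    · rw [if_neg fun h => h2 (hf _ _ _ _ h).2]; simp [h2]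
    · rw [if_neg fun h => h1 (hf _ _ _ _ h).1]; simp [h1]
    · rw [if_neg fun h => h2 (hf _ _ _ _ h).2]; simp [h2]
  simp only [this]
  rw [ex_mul_left]
  congr 1
  simp [ex, ind]

lemma condMutInfo_kernel (hP : ∀ u, 0 ≤ P u) (hK : ∀ u, IsPmf (K u)) (X : U → A) (Z : U → C)
    (D : C → Y → ℝ) (hX : ∀ u u', X u = X u' → Z u = Z u' → K u = K u')
    (hD : ∀ z y, ex P (fun u => ind (Z u = z) * K u y) = ex P fun u => ind (Z u = z) * D z y) :
    condMutInfo (fun t : U × Y => P t.1 * K t.1 t.2) (fun t => X t.1) (fun t => t.2)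
      (fun t => Z t.1) = ex (fun t : U × Y => P t.1 * K t.1 t.2) fun t =>
        Real.logb 2 (K t.1 t.2 / D (Z t.1) t.2) := by
  have hJ : ∀ t : U × Y, 0 ≤ P t.1 * K t.1 t.2 := fun t => mul_nonneg (hP _) ((hK _).nonneg _)
  unfold condMutInfo
  rw [condEnt_eq hJ, condEnt_eq hJ, neg_sub_neg, ← ex_sub]
  refine ex_congr_of_pos hJ fun t ht => ?_
  have p1 := pr_pos hJ (fun t => (X t.1, Z t.1)) ht
  have p2 := pr_pos hJ (fun t => Z t.1) ht
  have p3 := pr_pos hJ (fun t => (X t.1, (t.2, Z t.1))) ht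
  have p4 := pr_pos hJ (fun t => (t.2, Z t.1)) ht
  have e1 : pr (fun t : U × Y => P t.1 * K t.1 t.2) (fun t => (X t.1, (t.2, Z t.1)))
      (X t.1, (t.2, Z t.1)) = K t.1 t.2 * pr (fun t : U × Y => P t.1 * K t.1 t.2)
        (fun t => (X t.1, Z t.1)) (X t.1, Z t.1) := by
    rw [pr_input hK fun u => (X u, Z u), ← ex_mul_left]
    refine Eq.trans (pr_input_output (fun u => (X u, Z u)) (fun a y => (a.1, y, a.2))
      (fun a y a' y' h => by
        simp only [Prod.mk.injEq] at h
        exact ⟨Prod.ext h.1 h.2.2, h.2.1⟩) (X t.1, Z t.1) t.2) ?_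
    refine ex_congr fun u => ?_
    by_cases h : (X u, Z u) = (X t.1, Z t.1)
    · rw [hX u t.1 (congrArg Prod.fst h) (congrArg Prod.snd h), mul_comm]
    · rw [ind_false h]; ring
  have e2 : pr (fun t : U × Y => P t.1 * K t.1 t.2) (fun t => (t.2, Z t.1)) (t.2, Z t.1) =
      D (Z t.1) t.2 * pr (fun t : U × Y => P t.1 * K t.1 t.2) (fun t => Z t.1) (Z t.1) := by
    rw [pr_input hK, ← ex_mul_left]
    refine Eq.trans (pr_input_output Z (fun a y => (y, a))
      (fun a y a' y' h => by
        simp only [Prod.mk.injEq] at h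
        exact ⟨h.2, h.1⟩) (Z t.1) t.2) ?_
    rw [hD]
    exact ex_congr fun u => mul_comm _ _
  have hK0 : 0 < K t.1 t.2 := by
    have : 0 < K t.1 t.2 * _ := e1 ▸ p3
    exact pos_of_mul_pos_left this p1.le
  have hD0 : 0 < D (Z t.1) t.2 := by
    have : 0 < D (Z t.1) t.2 * _ := e2 ▸ p4
    exact pos_of_mul_pos_left this p2.le
  rw [e1, e2, ← Real.logb_div (div_pos (mul_pos hK0 p1) (mul_pos hD0 p2)).ne' (div_pos p1 p2).ne']
  congr 1
  field_simp

lemma mutInfo_kernel (hP : ∀ u, 0 ≤ P u) (hK : ∀ u, IsPmf (K u)) (X : U → A)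
    (hX : ∀ u u', X u = X u' → K u = K u') :
    mutInfo (fun t : U × Y => P t.1 * K t.1 t.2) (fun t => X t.1) (fun t => t.2) =
      ex (fun t : U × Y => P t.1 * K t.1 t.2) fun t =>
        Real.logb 2 (K t.1 t.2 / ex P fun u => K u t.2) := by
  have hJ : ∀ t : U × Y, 0 ≤ P t.1 * K t.1 t.2 := fun t => mul_nonneg (hP _) ((hK _).nonneg _)
  unfold mutInfo
  rw [Hent_eq, Hent_eq, Hent_eq, ← neg_add, sub_neg_eq_add, ← ex_add, neg_add_eq_sub, ← ex_sub]
  refine ex_congr_of_pos hJ fun t ht => ?_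
  have p1 := pr_pos hJ (fun t => X t.1) ht
  have p2 := pr_pos hJ (fun t => t.2) ht
  have p3 := pr_pos hJ (fun t => (X t.1, t.2)) ht
  have e1 : pr (fun t : U × Y => P t.1 * K t.1 t.2) (fun t => (X t.1, t.2))
      (X t.1, t.2) = K t.1 t.2 * pr (fun t : U × Y => P t.1 * K t.1 t.2)
        (fun t => X t.1) (X t.1) := by
    rw [pr_input hK, ← ex_mul_left]
    refine Eq.trans (pr_input_output X (fun a y => (a, y))
      (fun a y a' y' h => by simpa only [Prod.mk.injEq] using h) (X t.1) t.2) ?_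
    refine ex_congr fun u => ?_
    by_cases h : X u = X t.1
    · rw [hX u t.1 h, mul_comm]
    · rw [ind_false h]; ring
  have e2 : pr (fun t : U × Y => P t.1 * K t.1 t.2) (fun t => t.2) t.2 =
      ex P fun u => K u t.2 := by
    refine Eq.trans (pr_input_output (fun _ => ()) (fun _ y => y)
      (fun a y a' y' h => ⟨rfl, h⟩) () t.2) ?_
    exact ex_congr fun u => by rw [ind_true rfl, one_mul]
  have hK0 : 0 < K t.1 t.2 := by
    have : 0 < K t.1 t.2 * _ := e1 ▸ p3
    exact pos_of_mul_pos_left this p1.le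
  rw [← e2, e1, Real.logb_mul hK0.ne' p1.ne', Real.logb_div hK0.ne' p2.ne']
  ring

end KernelInfo

namespace InLaw

variable {V1 V2 X1 X2 X3 Y : Type*} [Fintype V1] [Fintype V2] [Fintype X1] [Fintype X2]
  [Fintype X3] [Fintype Y] (L : InLaw V1 V2 X1 X2 X3)

/-- The law of the inputs. -/
def input (u : (((V1 × V2) × X1) × X2) × X3) : ℝ :=
  L.pV1 u.1.1.1.1 * L.pV2 u.1.1.1.2 * L.pX1 u.1.1.1.1 u.1.1.2 * L.pX2 u.1.1.1.2 u.1.2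
    * L.pX3 u.1.1.1.1 u.1.1.1.2 u.2

lemma input_nonneg (u) : 0 ≤ L.input u :=
  mul_nonneg (mul_nonneg (mul_nonneg (mul_nonneg (L.hV1.nonneg _) (L.hV2.nonneg _))
    ((L.hX1 _).nonneg _)) ((L.hX2 _).nonneg _)) ((L.hX3 _ _).nonneg _)

lemma ex_input (F : (((V1 × V2) × X1) × X2) × X3 → ℝ) :
    ex L.input F = ex L.pV1 fun v1 => ex L.pV2 fun v2 => ex (L.pX1 v1) fun x1 =>
      ex (L.pX2 v2) fun x2 => ex (L.pX3 v1 v2) fun x3 => F ((((v1, v2), x1), x2), x3) := by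
  simp only [ex, input, Fintype.sum_prod_type, Finset.mul_sum, mul_assoc]

variable {Q : X1 → X2 → X3 → Y → ℝ}

lemma relayInfo_eq (hQ : ∀ x1 x2 x3, IsPmf (Q x1 x2 x3)) : L.relayInfo Q =
    ![condMutInfo (L.joint Q) (fun t => t.1.1.1.2) (fun t => t.2)
        (fun t => (t.1.1.2, t.1.1.1.1.1, t.1.2)),
      condMutInfo (L.joint Q) (fun t => t.1.1.2) (fun t => t.2)
        (fun t => (t.1.1.1.2, t.1.1.1.1.2, t.1.2)),
      condMutInfo (L.joint Q) (fun t => (t.1.1.1.2, t.1.1.2)) (fun t => t.2)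
        (fun t => (t.1.1.1.1.1, t.1.1.1.1.2, t.1.2))] := by
  have e1 := condMutInfo_kernel L.input_nonneg (K := fun u => Q u.1.1.2 u.1.2 u.2)
    (fun u => hQ _ _ _) (fun u => u.1.1.2) (fun u => (u.1.2, u.1.1.1.1, u.2))
    (fun z y => L.out1 Q z.2.1 z.1 z.2.2 y)
    (fun u u' h h' => by simp only [Prod.mk.injEq] at h'; simp only [h, h'.1, h'.2.2])
    (fun z y => by
      rw [ex_input, ex_input]
      refine ex_congr fun v1 => ex_congr fun v2 => ?_
      rw [ex_comm, ex_comm (L.pX1 v1)]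
      refine ex_congr fun x2 => ?_
      rw [ex_comm, ex_comm (L.pX1 v1)]
      refine ex_congr fun x3 => ?_
      simp only [ex_mul_left]
      rw [ex_const (L.hX1 v1)]
      by_cases h : (x2, v1, x3) = z
      · subst h; rfl
      · rw [ind_false h]; ring)
  have e2 := condMutInfo_kernel L.input_nonneg (K := fun u => Q u.1.1.2 u.1.2 u.2)
    (fun u => hQ _ _ _) (fun u => u.1.2) (fun u => (u.1.1.2, u.1.1.1.2, u.2))
    (fun z y => L.out2 Q z.2.1 z.1 z.2.2 y)
    (fun u u' h h' => by simp only [Prod.mk.injEq] at h'; simp only [h, h'.1, h'.2.2])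
    (fun z y => by
      rw [ex_input, ex_input]
      refine ex_congr fun v1 => ex_congr fun v2 => ex_congr fun x1 => ?_
      rw [ex_comm, ex_comm (L.pX2 v2)]
      refine ex_congr fun x3 => ?_
      simp only [ex_mul_left]
      rw [ex_const (L.hX2 v2)]
      by_cases h : (x1, v2, x3) = z
      · subst h; rfl
      · rw [ind_false h]; ring)
  have e3 := condMutInfo_kernel L.input_nonneg (K := fun u => Q u.1.1.2 u.1.2 u.2)
    (fun u => hQ _ _ _) (fun u => (u.1.1.2, u.1.2)) (fun u => (u.1.1.1.1, u.1.1.1.2, u.2))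
    (fun z y => L.out12 Q z.1 z.2.1 z.2.2 y)
    (fun u u' h h' => by
      simp only [Prod.mk.injEq] at h h'; simp only [h.1, h.2, h'.2.2])
    (fun z y => by
      rw [ex_input, ex_input]
      refine ex_congr fun v1 => ex_congr fun v2 => ?_
      simp only [ex_comm (L.pX2 v2) (L.pX3 v1 v2)]
      rw [ex_comm, ex_comm (L.pX1 v1)]
      refine ex_congr fun x3 => ?_
      simp only [ex_mul_left]
      rw [ex_const (L.hX1 v1), ex_const (L.hX2 v2)]
      by_cases h : (v1, v2, x3) = z
      · subst h; rfl
      · rw [ind_false h]; ring)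
  have f1 := L.ex_joint Q fun t =>
    Real.logb 2 (Q t.1.1.1.2 t.1.1.2 t.1.2 t.2 / L.out1 Q t.1.1.1.1.1 t.1.1.2 t.1.2 t.2)
  have f2 := L.ex_joint Q fun t =>
    Real.logb 2 (Q t.1.1.1.2 t.1.1.2 t.1.2 t.2 / L.out2 Q t.1.1.1.1.2 t.1.1.1.2 t.1.2 t.2)
  have f3 := L.ex_joint Q fun t =>
    Real.logb 2 (Q t.1.1.1.2 t.1.1.2 t.1.2 t.2 / L.out12 Q t.1.1.1.1.1 t.1.1.1.1.2 t.1.2 t.2)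
  unfold relayInfo
  rw [← f1, ← f2, ← f3]
  have aux : ∀ {a b c a' b' c' : ℝ}, a' = a → b' = b → c' = c → ![a, b, c] = ![a', b', c'] := by
    rintro _ _ _ _ _ _ rfl rfl rfl; rfl
  exact aux e1 e2 e3

lemma destInfo_eq (hQ : ∀ x1 x2 x3, IsPmf (Q x1 x2 x3)) : L.destInfo Q =
    ![condMutInfo (L.joint Q) (fun t => (t.1.1.1.2, t.1.2)) (fun t => t.2)
        (fun t => (t.1.1.2, t.1.1.1.1.2)),
      condMutInfo (L.joint Q) (fun t => (t.1.1.2, t.1.2)) (fun t => t.2)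
        (fun t => (t.1.1.1.2, t.1.1.1.1.1)),
      mutInfo (L.joint Q) (fun t => (t.1.1.1.2, t.1.1.2, t.1.2)) (fun t => t.2)] := by
  have e1 := condMutInfo_kernel L.input_nonneg (K := fun u => Q u.1.1.2 u.1.2 u.2)
    (fun u => hQ _ _ _) (fun u => (u.1.1.2, u.2)) (fun u => (u.1.2, u.1.1.1.2))
    (fun z y => L.out13 Q z.2 z.1 y)
    (fun u u' h h' => by simp only [Prod.mk.injEq] at h h'; simp only [h.1, h.2, h'.1])
    (fun z y => by
      rw [ex_input, ex_input, ex_comm, ex_comm L.pV1]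
      refine ex_congr fun v2 => ?_
      simp only [ex_comm (L.pX1 _) (L.pX2 v2)]
      rw [ex_comm, ex_comm L.pV1]
      refine ex_congr fun x2 => ?_
      simp only [ex_mul_left]
      simp only [ex_const (L.hX3 _ _), ex_const (L.hX1 _), ex_const L.hV1]
      by_cases h : (x2, v2) = z
      · subst h; rfl
      · rw [ind_false h]; ring)
  have e2 := condMutInfo_kernel L.input_nonneg (K := fun u => Q u.1.1.2 u.1.2 u.2)
    (fun u => hQ _ _ _) (fun u => (u.1.2, u.2)) (fun u => (u.1.1.2, u.1.1.1.1))
    (fun z y => L.out23 Q z.2 z.1 y)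
    (fun u u' h h' => by simp only [Prod.mk.injEq] at h h'; simp only [h.1, h.2, h'.1])
    (fun z y => by
      rw [ex_input, ex_input]
      refine ex_congr fun v1 => ?_
      rw [ex_comm, ex_comm L.pV2]
      refine ex_congr fun x1 => ?_
      simp only [ex_mul_left]
      simp only [ex_const (L.hX3 _ _), ex_const (L.hX2 _), ex_const L.hV2]
      by_cases h : (x1, v1) = z
      · subst h; rfl
      · rw [ind_false h]; ring)
  have e3 := mutInfo_kernel L.input_nonneg (K := fun u => Q u.1.1.2 u.1.2 u.2)
    (fun u => hQ _ _ _) (fun u => (u.1.1.2, u.1.2, u.2))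
    (fun u u' h => by simp only [Prod.mk.injEq] at h; simp only [h.1, h.2.1, h.2.2])
  simp only [ex_input] at e3
  have f1 := L.ex_joint Q fun t =>
    Real.logb 2 (Q t.1.1.1.2 t.1.1.2 t.1.2 t.2 / L.out13 Q t.1.1.1.1.2 t.1.1.2 t.2)
  have f2 := L.ex_joint Q fun t =>
    Real.logb 2 (Q t.1.1.1.2 t.1.1.2 t.1.2 t.2 / L.out23 Q t.1.1.1.1.1 t.1.1.1.2 t.2)
  have f3 := L.ex_joint Q fun t =>
    Real.logb 2 (Q t.1.1.1.2 t.1.1.2 t.1.2 t.2 / L.out123 Q t.2)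
  unfold destInfo
  rw [← f1, ← f2, ← f3]
  have aux : ∀ {a b c a' b' c' : ℝ}, a' = a → b' = b → c' = c → ![a, b, c] = ![a', b', c'] := by
    rintro _ _ _ _ _ _ rfl rfl rfl; rfl
  exact aux e1 e2 e3

end InLaw

section SingleLetter

variable {S1 S2 W W3 V1 V2 X1 X2 X3 Y Y3 : Type}
  [Fintype S1] [Fintype S2] [Fintype W] [Fintype W3] [Fintype V1] [Fintype V2]
  [Fintype X1] [Fintype X2] [Fintype X3] [Fintype Y] [Fintype Y3]
  (src : SourcePMF (S1 × S2 × W × W3)) (ch : DMMARC X1 X2 X3 Y Y3) (L : InLaw V1 V2 X1 X2 X3)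

lemma ex_opSepLaw (F : (S1 × S2 × W × W3) × V1 × V2 × X1 × X2 × X3 × Y × Y3 → ℝ) :
    ex (opSepLaw src ch L.pV1 L.pX1 L.pV2 L.pX2 L.pX3) F = ex src.q fun s =>
      ex L.pV1 fun v1 => ex L.pV2 fun v2 => ex (L.pX1 v1) fun x1 => ex (L.pX2 v2) fun x2 =>
      ex (L.pX3 v1 v2) fun x3 => ∑ y, ∑ y3, ch.P x1 x2 x3 y y3 *
        F (s, v1, v2, x1, x2, x3, y, y3) := by
  unfold ex
  rw [Fintype.sum_prod_type]
  refine Finset.sum_congr rfl fun s _ => ?_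
  simp only [opSepLaw, Fintype.sum_prod_type (α₁ := V1), Fintype.sum_prod_type (α₁ := V2),
    Fintype.sum_prod_type (α₁ := X1), Fintype.sum_prod_type (α₁ := X2),
    Fintype.sum_prod_type (α₁ := X3), Fintype.sum_prod_type (α₁ := Y), Finset.mul_sum]
  refine Finset.sum_congr rfl fun v1 _ => Finset.sum_congr rfl fun v2 _ =>
    Finset.sum_congr rfl fun x1 _ => Finset.sum_congr rfl fun x2 _ =>
    Finset.sum_congr rfl fun x3 _ => Finset.sum_congr rfl fun y _ =>
    Finset.sum_congr rfl fun y3 _ => by ring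

lemma ex_opSepLaw_source (F : S1 × S2 × W × W3 → ℝ) :
    ex (opSepLaw src ch L.pV1 L.pX1 L.pV2 L.pX2 L.pX3) (fun z => F z.1) = ex src.q F := by
  rw [ex_opSepLaw]
  simp only [← Finset.sum_mul, ch.sum_one, one_mul, ex_const L.hV1, ex_const L.hV2,
    ex_const (L.hX1 _), ex_const (L.hX2 _), ex_const (L.hX3 _ _)]

lemma ex_opSepLaw_relay (F : ((((V1 × V2) × X1) × X2) × X3) × Y3 → ℝ) :
    ex (opSepLaw src ch L.pV1 L.pX1 L.pV2 L.pX2 L.pX3) (fun z => F (((((z.2.1, z.2.2.1),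
      z.2.2.2.1), z.2.2.2.2.1), z.2.2.2.2.2.1), z.2.2.2.2.2.2.2)) =
      ex (L.joint (BlockScheme.relayCh ch)) F := by
  rw [ex_opSepLaw, InLaw.ex_joint]
  dsimp only
  rw [ex_const ⟨src.nonneg, src.sum_one⟩]
  refine ex_congr fun v1 => ex_congr fun v2 => ex_congr fun x1 => ex_congr fun x2 =>
    ex_congr fun x3 => ?_
  rw [Finset.sum_comm]
  simp only [ex, BlockScheme.relayCh, Finset.sum_mul]

lemma ex_opSepLaw_dest (F : ((((V1 × V2) × X1) × X2) × X3) × Y → ℝ) :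
    ex (opSepLaw src ch L.pV1 L.pX1 L.pV2 L.pX2 L.pX3) (fun z => F (((((z.2.1, z.2.2.1),
      z.2.2.2.1), z.2.2.2.2.1), z.2.2.2.2.2.1), z.2.2.2.2.2.2.1)) =
      ex (L.joint (BlockScheme.destCh ch)) F := by
  rw [ex_opSepLaw, InLaw.ex_joint]
  dsimp only
  rw [ex_const ⟨src.nonneg, src.sum_one⟩]
  refine ex_congr fun v1 => ex_congr fun v2 => ex_congr fun x1 => ex_congr fun x2 =>
    ex_congr fun x3 => ?_
  simp only [ex, BlockScheme.destCh, Finset.sum_mul]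

end SingleLetter

/-- Random coding: some codebook does as well as the average for all blocks together. -/
lemma Codebook.exists_le {V1 V2 X1 X2 X3 Y Y3 A B Ω τ : Type*} [Fintype V1] [Fintype V2]
    [Fintype X1] [Fintype X2] [Fintype X3] [Fintype Y] [Fintype Y3] [Fintype A] [Fintype B]
    [Nonempty (A × B)] [Fintype Ω] [Fintype τ] (L : InLaw V1 V2 X1 X2 X3)
    {QR : X1 → X2 → X3 → Y3 → ℝ} (hQR : ∀ x1 x2 x3, IsPmf (QR x1 x2 x3))
    {QD : X1 → X2 → X3 → Y → ℝ} (hQD : ∀ x1 x2 x3, IsPmf (QD x1 x2 x3))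
    {p : Ω → ℝ} (hp : ∀ s, 0 ≤ p s) (u v w : τ → Ω → A × B) {qR qD : τ → Ω → A → B → ℝ}
    (hqR : ∀ t s a b, 0 ≤ qR t s a b) (hqD : ∀ t s a b, 0 ≤ qD t s a b)
    (hvR : ∀ t s, 0 < p s → 0 < qR t s (v t s).1 (v t s).2)
    (hvD : ∀ t s, 0 < p s → 0 < qD t s (v t s).1 (v t s).2)
    {Γ : ℝ} (hΓ : 0 < Γ) {SR ΘR SD ΘD : Fin 3 → ℝ} (hR : ∀ j, Γ * SR j ≤ ΘR j)
    (hD : ∀ j, Γ * SD j ≤ ΘD j) :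
    ∃ c : Codebook A B V1 V2 X1 X2 X3, ∑ t, (ex p fun s =>
      ex (QR (c.2.2.1 ((v t s).1, (u t s).1)) (c.2.2.2.1 ((v t s).2, (u t s).2))
        (c.2.2.2.2 (u t s))) (fun y => ind (relayDec L Γ QR (qR t s) c (u t s) y ≠ v t s)) +
      ex (QD (c.2.2.1 ((w t s).1, (v t s).1)) (c.2.2.2.1 ((w t s).2, (v t s).2))
        (c.2.2.2.2 (v t s))) (fun y => ind (destDec L Γ QD (qD t s) c (w t s) y ≠ v t s))) ≤
      ∑ t, (ex p fun s =>
        (srcBad (qR t s) SR (v t s).1 (v t s).2 + L.relayTail QR ΘR + 3 / Γ) +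
        (srcBad (qD t s) SD (v t s).1 (v t s).2 + L.destTail QD ΘD + 3 / Γ)) := by
  refine exists_le_of_ex_le (law_isPmf L) ?_
  rw [ex_sum]
  refine Finset.sum_le_sum fun t _ => ?_
  rw [ex_comm]
  refine ex_mono_of_pos hp fun s hs => ?_
  rw [ex_add]
  exact add_le_add (relayDec_error_le L hQR (hqR t s) hΓ hR (u t s) (hvR t s hs))
    (destDec_error_le L hQD (hqD t s) hΓ hD (w t s) (hvD t s hs))

section

variable {S1 S2 W W3 V1 V2 X1 X2 X3 Y Y3 : Type}
  [Fintype S1] [Fintype S2] [Fintype W] [Fintype W3] [Fintype V1] [Fintype V2]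
  [Fintype X1] [Fintype X2] [Fintype X3] [Fintype Y] [Fintype Y3]
  (src : SourcePMF (S1 × S2 × W × W3)) (ch : DMMARC X1 X2 X3 Y Y3) (L : InLaw V1 V2 X1 X2 X3)

/-- Law of the sources and the relay side information. -/
def relayMarg : S1 → S2 → W3 → ℝ :=
  srcMarg src.q (fun s => s.1) (fun s => s.2.1) (fun s => s.2.2.2)

/-- Law of the sources and the destination side information. -/
def destMarg : S1 → S2 → W → ℝ :=
  srcMarg src.q (fun s => s.1) (fun s => s.2.1) (fun s => s.2.2.1)

/-- Block Markov coding with source blocks of length `M` and channel blocks of length `N`. -/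
lemma exists_code_le {M N B m n : ℕ} (hN : 0 < N) (hn : (B + 1) * N ≤ n)
    {pos : Fin B → Fin M → Fin m} (hpos : ∀ t, Function.Injective (pos t))
    {loc : Fin m → Fin B × Fin M} (hloc : ∀ i, pos (loc i).1 (loc i).2 = i)
    {Γ : ℝ} (hΓ : 0 < Γ) {SR ΘR SD ΘD : Fin 3 → ℝ} (hR : ∀ j, Γ * SR j ≤ ΘR j)
    (hD : ∀ j, Γ * SD j ≤ ΘD j) :
    ∃ c : MARCCode S1 S2 W W3 X1 X2 X3 Y Y3 m n, marcErr src ch c ≤ B *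
      ((ex (pm fun _ : Fin M => src.q) (fun t => Codebook.srcBad
          (fun (a : Fin M → S1) (b : Fin M → S2) => ∏ i, relayMarg src (a i) (b i) (t i).2.2.2)
          SR (fun i => (t i).1) (fun i => (t i).2.1)) +
        (L.block N).relayTail (InLaw.chBlock (BlockScheme.relayCh ch) N) ΘR + 3 / Γ) +
      (ex (pm fun _ : Fin M => src.q) (fun t => Codebook.srcBad
          (fun (a : Fin M → S1) (b : Fin M → S2) => ∏ i, destMarg src (a i) (b i) (t i).2.2.1)
          SD (fun i => (t i).1) (fun i => (t i).2.1)) +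
        (L.block N).destTail (InLaw.chBlock (BlockScheme.destCh ch) N) ΘD + 3 / Γ)) := by
  have hsrc : IsPmf src.q := ⟨src.nonneg, src.sum_one⟩
  obtain ⟨s0⟩ := hsrc.nonempty
  have : Nonempty S1 := ⟨s0.1⟩
  have : Nonempty S2 := ⟨s0.2.1⟩
  obtain ⟨v1⟩ := L.hV1.nonempty
  obtain ⟨v2⟩ := L.hV2.nonempty
  obtain ⟨x1⟩ := (L.hX1 v1).nonempty
  obtain ⟨x2⟩ := (L.hX2 v2).nonempty
  obtain ⟨x3⟩ := (L.hX3 v1 v2).nonempty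
  have : Nonempty Y := (BlockScheme.destCh_isPmf ch x1 x2 x3).nonempty
  have : Nonempty Y3 := (BlockScheme.relayCh_isPmf ch x1 x2 x3).nonempty
  have hQR : ∀ x1 x2 x3, IsPmf (InLaw.chBlock (BlockScheme.relayCh ch) N x1 x2 x3) :=
    fun _ _ _ => pm_isPmf fun _ => BlockScheme.relayCh_isPmf ch _ _ _
  have hQD : ∀ x1 x2 x3, IsPmf (InLaw.chBlock (BlockScheme.destCh ch) N x1 x2 x3) :=
    fun _ _ _ => pm_isPmf fun _ => BlockScheme.destCh_isPmf ch _ _ _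
  let u0 : (Fin M → S1) × (Fin M → S2) := Classical.arbitrary _
  let σ : Codebook (Fin M → S1) (Fin M → S2) (Fin N → V1) (Fin N → V2) (Fin N → X1) (Fin N → X2)
      (Fin N → X3) → BlockScheme S1 S2 W W3 X1 X2 X3 Y Y3 M N B m := fun c =>
    { pos := pos
      u0 := u0
      x1 := fun a a' => c.2.2.1 (a, a')
      x2 := fun b b' => c.2.2.2.1 (b, b')
      x3 := c.2.2.2.2
      decR := fun u y w => Codebook.relayDec (L.block N) Γ
        (InLaw.chBlock (BlockScheme.relayCh ch) N)
        (fun a b => ∏ i, relayMarg src (a i) (b i) (w i)) c u y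
      decD := fun u y w => Codebook.destDec (L.block N) Γ
        (InLaw.chBlock (BlockScheme.destCh ch) N)
        (fun a b => ∏ i, destMarg src (a i) (b i) (w i)) c u y }
  let σ0 : BlockScheme S1 S2 W W3 (Fin N → X1) X2 X3 Y Y3 M N B m :=
    { pos := pos
      u0 := u0
      x1 := fun _ _ _ _ => x1
      x2 := fun _ _ _ => x2
      x3 := fun _ _ => x3
      decR := fun _ _ _ => u0
      decD := fun _ _ _ => u0 }
  have hm : ∀ c s t, (σ c).msg s t = σ0.msg s t := by
    intro c s t
    cases t <;> rfl
  have hpm : ∀ s : Fin m → S1 × S2 × W × W3, 0 < pm (fun _ => src.q) s → ∀ i, 0 < src.q (s i) :=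
    fun s hs => pos_of_pm_pos src.nonneg hs
  obtain ⟨c, hc⟩ := Codebook.exists_le (τ := Fin B) (L.block N) hQR hQD
    (p := pm fun _ : Fin m => src.q)
    (pm_nonneg fun _ => src.nonneg)
    (fun t s => σ0.msg s t) (fun t s => σ0.msg s (t + 1)) (fun t s => σ0.msg s (t + 2))
    (qR := fun t s a b => ∏ i, relayMarg src (a i) (b i) (s (pos t i)).2.2.2)
    (qD := fun t s a b => ∏ i, destMarg src (a i) (b i) (s (pos t i)).2.2.1)
    (fun t s a b => Finset.prod_nonneg fun _ _ => pr_nonneg src.nonneg _ _)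
    (fun t s a b => Finset.prod_nonneg fun _ _ => pr_nonneg src.nonneg _ _)
    (fun t s hs => by
      rw [BlockScheme.msg_succ]
      exact Finset.prod_pos fun i _ => pr_pos src.nonneg
        (fun s => (s.1, s.2.1, s.2.2.2)) (hpm s hs (pos t i)))
    (fun t s hs => by
      rw [BlockScheme.msg_succ]
      exact Finset.prod_pos fun i _ => pr_pos src.nonneg
        (fun s => (s.1, s.2.1, s.2.2.1)) (hpm s hs (pos t i)))
    hΓ hR hD
  refine ⟨(σ c).code hN loc n, ((σ c).marcErr_code_le hN src ch loc hloc hn).trans ?_⟩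
  simp only [hm]
  refine hc.trans ?_
  refine (Finset.sum_le_card_nsmul univ _ _ fun t _ => le_of_eq ?_).trans_eq
    (by rw [Finset.card_fin, nsmul_eq_mul])
  have hpmf : IsPmf (pm fun _ : Fin m => src.q) := pm_isPmf fun _ => hsrc
  rw [ex_add, ex_add, ex_add, ex_add, ex_add, ex_const hpmf, ex_const hpmf, ex_const hpmf]
  have e1 := ex_pm_comp (p := fun _ : Fin m => src.q) (fun _ => hsrc) (hpos t) fun t =>
    Codebook.srcBad (fun (a : Fin M → S1) (b : Fin M → S2) =>
      ∏ i, relayMarg src (a i) (b i) (t i).2.2.2) SR (fun i => (t i).1) (fun i => (t i).2.1)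
  have e2 := ex_pm_comp (p := fun _ : Fin m => src.q) (fun _ => hsrc) (hpos t) fun t =>
    Codebook.srcBad (fun (a : Fin M → S1) (b : Fin M → S2) =>
      ∏ i, destMarg src (a i) (b i) (t i).2.2.1) SD (fun i => (t i).1) (fun i => (t i).2.1)
  simp only [BlockScheme.msg_succ]
  rw [← e1, ← e2]

end

section Asymptotics

open Filter Topology

/-- Overlapping blocks of length `M` covering `Fin m`. -/
lemma exists_blocks {B M m : ℕ} (hM : 0 < M) (hMm : M ≤ m) (hm : m ≤ B * M) :
    ∃ pos : Fin B → Fin M → Fin m, (∀ t, Function.Injective (pos t)) ∧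
      ∃ loc : Fin m → Fin B × Fin M, ∀ i, pos (loc i).1 (loc i).2 = i := by
  refine ⟨fun t j => ⟨min (t * M) (m - M) + j, by have := j.isLt; omega⟩, fun t j j' h => ?_,
    fun i => (⟨i / M, (Nat.div_lt_iff_lt_mul hM).2 (i.isLt.trans_le hm)⟩,
      ⟨i - min (i / M * M) (m - M), ?_⟩), fun i => ?_⟩
  · simp only [Fin.mk.injEq] at h
    exact Fin.ext (by omega)
  · have h1 := Nat.div_add_mod' i M
    have h2 := Nat.mod_lt i hM
    have h3 := i.isLt
    omega
  · have h1 := Nat.div_add_mod' i M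
    have h2 := Nat.mod_lt i hM
    exact Fin.ext (by dsimp only; omega)

variable {ι : Type*} [Finite ι] {H I : ι → ℝ} {κ : ℝ}

lemma exists_slack (h : ∀ j, H j < κ * I j) :
    ∃ δ > 0, ∀ j, H j + δ < κ * (I j - δ) := by
  have h1 : ∀ᶠ δ in 𝓝[>] (0 : ℝ), ∀ j, H j + δ < κ * (I j - δ) := by
    refine eventually_all.2 fun j => Filter.Eventually.filter_mono nhdsWithin_le_nhds ?_
    refine ContinuousAt.eventually_lt (by fun_prop) (by fun_prop) ?_
    simpa using h j
  obtain ⟨δ, h2, h3⟩ := (h1.and self_mem_nhdsWithin).exists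
  exact ⟨δ, h3, h2⟩

lemma exists_block_number (h : ∀ j, H j < κ * I j) :
    ∃ B : ℕ, 0 < B ∧ ∀ j, H j / B < κ * I j / (B + 1) := by
  have h1 : ∀ᶠ B : ℕ in atTop, ∀ j, H j + H j / B < κ * I j := by
    refine eventually_all.2 fun j => ?_
    have : Tendsto (fun B : ℕ => H j + H j / B) atTop (𝓝 (H j + 0)) :=
      tendsto_const_nhds.add (tendsto_const_div_atTop_nhds_zero_nat _)
    exact this.eventually_lt_const (by simpa using h j)
  obtain ⟨B, h2, h3⟩ := (h1.and (eventually_gt_atTop 0)).exists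
  refine ⟨B, h3, fun j => ?_⟩
  have hB : (0 : ℝ) < B := by exact_mod_cast h3
  rw [lt_div_iff₀ (by positivity)]
  refine lt_of_eq_of_lt ?_ (h2 j)
  field_simp

lemma eventually_exponent (hκ : 0 < κ) {B : ℕ} (h : ∀ j, H j / B < κ * I j / (B + 1)) :
    ∃ c > 0, ∀ᶠ m : ℕ in atTop, ∀ j, c * m + (⌈(m : ℝ) / B⌉₊ : ℝ) * H j ≤
      (⌊κ * m / (B + 1)⌋₊ : ℝ) * I j := by
  have h1 : ∀ᶠ c in 𝓝[>] (0 : ℝ), ∀ j, H j / B + c < κ * I j / (B + 1) := by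
    refine eventually_all.2 fun j => Filter.Eventually.filter_mono nhdsWithin_le_nhds ?_
    refine ContinuousAt.eventually_lt (by fun_prop) (by fun_prop) ?_
    simpa using h j
  obtain ⟨c, h2, h3⟩ := (h1.and self_mem_nhdsWithin).exists
  have hc : 0 < c := h3
  refine ⟨c / 2, half_pos hc, eventually_all.2 fun j => ?_⟩
  have h4 : ∀ᶠ m : ℕ in atTop, (|H j| + |I j|) * (2 / c) ≤ m :=
    tendsto_natCast_atTop_atTop.eventually_ge_atTop _
  filter_upwards [h4] with m hm
  have hm' : |H j| + |I j| ≤ c / 2 * m := by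
    have := mul_le_mul_of_nonneg_left hm (half_pos hc).le
    refine le_trans (le_of_eq ?_) this
    field_simp
  have a1 : (⌈(m : ℝ) / B⌉₊ : ℝ) * H j ≤ m / B * H j + |H j| := by
    have u1 := Nat.le_ceil ((m : ℝ) / B)
    have u2 := Nat.ceil_lt_add_one (a := (m : ℝ) / B) (by positivity)
    have u3 : (⌈(m : ℝ) / B⌉₊ - (m : ℝ) / B) * H j ≤ 1 * |H j| :=
      (mul_le_mul_of_nonneg_left (le_abs_self _) (by linarith)).trans
        (mul_le_mul_of_nonneg_right (by linarith) (abs_nonneg _))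
    linarith
  have a2 : κ * m / (B + 1) * I j - |I j| ≤ (⌊κ * m / (B + 1)⌋₊ : ℝ) * I j := by
    have u1 := Nat.floor_le (a := κ * m / (B + 1)) (by positivity)
    have u2 := Nat.lt_floor_add_one (κ * m / (B + 1))
    have u3 : (κ * m / (B + 1) - ⌊κ * m / (B + 1)⌋₊) * I j ≤ 1 * |I j| :=
      (mul_le_mul_of_nonneg_left (le_abs_self _) (by linarith)).trans
        (mul_le_mul_of_nonneg_right (by linarith) (abs_nonneg _))
    linarith
  have a3 := mul_le_mul_of_nonneg_left (h2 j).le (Nat.cast_nonneg (α := ℝ) m)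
  have e1 : (m : ℝ) * (H j / B + c) = m / B * H j + c * m := by ring
  have e2 : (m : ℝ) * (κ * I j / (B + 1)) = κ * m / (B + 1) * I j := by ring
  linarith

end Asymptotics

section Achievability

open Filter Topology

variable {S1 S2 W W3 V1 V2 X1 X2 X3 Y Y3 : Type}
  [Fintype S1] [Fintype S2] [Fintype W] [Fintype W3] [Fintype V1] [Fintype V2]
  [Fintype X1] [Fintype X2] [Fintype X3] [Fintype Y] [Fintype Y3]
  (src : SourcePMF (S1 × S2 × W × W3)) (ch : DMMARC X1 X2 X3 Y Y3) (L : InLaw V1 V2 X1 X2 X3)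

lemma marcAchievable_of_rates {κ : ℝ} (hκ : 0 < κ)
    (hR : ∀ j, srcEnt src.q (fun s => s.1) (fun s => s.2.1) (fun s => s.2.2.2) (relayMarg src) j <
      κ * L.relayInfo (BlockScheme.relayCh ch) j)
    (hD : ∀ j, srcEnt src.q (fun s => s.1) (fun s => s.2.1) (fun s => s.2.2.1) (destMarg src) j <
      κ * L.destInfo (BlockScheme.destCh ch) j) : marcAchievable src ch κ := by
  have hsrc : IsPmf src.q := ⟨src.nonneg, src.sum_one⟩
  set HR := srcEnt src.q (fun s => s.1) (fun s => s.2.1) (fun s => s.2.2.2) (relayMarg src)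
  set HD := srcEnt src.q (fun s => s.1) (fun s => s.2.1) (fun s => s.2.2.1) (destMarg src)
  set IR := L.relayInfo (BlockScheme.relayCh ch)
  set ID := L.destInfo (BlockScheme.destCh ch)
  have h0 : ∀ j, Sum.elim HR HD j < κ * Sum.elim IR ID j := by
    rintro (j | j)
    · exact hR j
    · exact hD j
  obtain ⟨δ, hδ, h1⟩ := exists_slack h0
  obtain ⟨B, hB, h2⟩ := exists_block_number (H := fun j => Sum.elim HR HD j + δ)
    (I := fun j => Sum.elim IR ID j - δ) h1
  obtain ⟨c, hc, h3⟩ := eventually_exponent hκ h2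
  have hB' : (0 : ℝ) < B := by exact_mod_cast hB
  obtain ⟨C1, k1⟩ := exists_srcBad_le hsrc (fun s => s.1) (fun s => s.2.1) (fun s => s.2.2.2)
    (r := relayMarg src) (fun _ _ _ => pr_nonneg src.nonneg _ _)
    (fun s hs => pr_pos src.nonneg (fun s => (s.1, s.2.1, s.2.2.2)) hs) hδ
  obtain ⟨C2, k2⟩ := L.exists_relayTail_le (BlockScheme.relayCh_isPmf ch) hδ
  obtain ⟨C3, k3⟩ := exists_srcBad_le hsrc (fun s => s.1) (fun s => s.2.1) (fun s => s.2.2.1)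
    (r := destMarg src) (fun _ _ _ => pr_nonneg src.nonneg _ _)
    (fun s hs => pr_pos src.nonneg (fun s => (s.1, s.2.1, s.2.2.1)) hs) hδ
  obtain ⟨C4, k4⟩ := L.exists_destTail_le (BlockScheme.destCh_isPmf ch) hδ
  let M : ℕ → ℕ := fun m => ⌈(m : ℝ) / B⌉₊
  let N : ℕ → ℕ := fun m => ⌊κ * m / (B + 1)⌋₊
  have hMt : Tendsto M atTop atTop := by
    refine tendsto_nat_ceil_atTop.comp ?_
    exact tendsto_natCast_atTop_atTop.atTop_div_const hB'
  have hNt : Tendsto N atTop atTop := by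
    refine tendsto_nat_floor_atTop.comp ?_
    exact (tendsto_natCast_atTop_atTop.const_mul_atTop hκ).atTop_div_const (by positivity)
  have hΓt : Tendsto (fun m : ℕ => (3 : ℝ) / 2 ^ (c * m)) atTop (𝓝 0) := by
    refine Tendsto.div_atTop tendsto_const_nhds ?_
    refine (tendsto_rpow_atTop_of_base_gt_one 2 (by norm_num)).comp ?_
    exact tendsto_natCast_atTop_atTop.const_mul_atTop hc
  have hE : Tendsto (fun m : ℕ => (B : ℝ) * ((C1 / M m + C2 / N m + 3 / 2 ^ (c * m)) +
      (C3 / M m + C4 / N m + 3 / 2 ^ (c * m)))) atTop (𝓝 0) := by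
    have d : ∀ C : ℝ, ∀ {K : ℕ → ℕ}, Tendsto K atTop atTop →
        Tendsto (fun m => C / (K m : ℝ)) atTop (𝓝 0) := fun C K hK =>
      (tendsto_const_div_atTop_nhds_zero_nat C).comp hK
    have := ((((d C1 hMt).add (d C2 hNt)).add hΓt).add
      (((d C3 hMt).add (d C4 hNt)).add hΓt)).const_mul (B : ℝ)
    simpa using this
  intro ε hε
  have hev := h3.and ((hE.eventually_lt_const hε).and
    ((hMt.eventually_gt_atTop 0).and (hNt.eventually_gt_atTop 0)))
  obtain ⟨m0, hm0⟩ := eventually_atTop.1 hev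
  refine ⟨m0, 0, fun m n hm _ hmn => ?_⟩
  obtain ⟨g1, g2, g3, g4⟩ := hm0 m hm.le
  have hmpos : (0 : ℝ) < m := by
    have : 0 < m := (Nat.zero_le _).trans_lt hm
    exact_mod_cast this
  have hn : (n : ℝ) = κ * m := by rw [← hmn]; field_simp
  have hMm : M m ≤ m := Nat.ceil_le.2 (div_le_self hmpos.le (by exact_mod_cast hB))
  have hBM : m ≤ B * M m := by
    have := Nat.le_ceil ((m : ℝ) / B)
    rw [div_le_iff₀ hB', mul_comm] at this
    exact_mod_cast this
  have hNn : (B + 1) * N m ≤ n := by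
    have h : (N m : ℝ) ≤ κ * m / (B + 1) := Nat.floor_le (by positivity)
    rw [le_div_iff₀ (by positivity), ← hn, mul_comm] at h
    exact_mod_cast h
  obtain ⟨pos, hpos, loc, hloc⟩ := exists_blocks g3 hMm hBM
  have hpow : ∀ j, (2 : ℝ) ^ (c * m) * 2 ^ ((M m : ℝ) * (Sum.elim HR HD j + δ)) ≤
      2 ^ ((N m : ℝ) * (Sum.elim IR ID j - δ)) := fun j => by
    rw [← Real.rpow_add (by norm_num)]
    exact Real.rpow_le_rpow_of_exponent_le (by norm_num) (g1 j)
  obtain ⟨code, hcode⟩ := exists_code_le src ch L g4 hNn hpos hloc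
    (Γ := (2 : ℝ) ^ (c * m)) (by positivity)
    (SR := fun j => (2 : ℝ) ^ ((M m : ℝ) * (HR j + δ)))
    (ΘR := fun j => (2 : ℝ) ^ ((N m : ℝ) * (IR j - δ)))
    (SD := fun j => (2 : ℝ) ^ ((M m : ℝ) * (HD j + δ)))
    (ΘD := fun j => (2 : ℝ) ^ ((N m : ℝ) * (ID j - δ)))
    (fun j => hpow (Sum.inl j)) (fun j => hpow (Sum.inr j))
  refine ⟨code, (hcode.trans (mul_le_mul_of_nonneg_left ?_ hB'.le)).trans_lt g2⟩
  have l1 := k1 (M m) g3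
  have l2 := k2 (N m) g4
  have l3 := k3 (M m) g3
  have l4 := k4 (N m) g4
  gcongr

end Achievability

/-- **Theorem 1** (operational separation based achievability for the DM MARC). -/
theorem marc_operational_separation_achievability
    (src : SourcePMF (S1 × S2 × W × W3)) (ch : DMMARC X1 X2 X3 Y Y3) (κ : ℝ) (hκ : 0 < κ)
    (pV1 : V1 → ℝ) (pX1 : V1 → X1 → ℝ) (pV2 : V2 → ℝ) (pX2 : V2 → X2 → ℝ)
    (pX3 : V1 → V2 → X3 → ℝ)
    (hpV1 : ∀ v, 0 ≤ pV1 v) (hpV1s : ∑ v, pV1 v = 1)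
    (hpV2 : ∀ v, 0 ≤ pV2 v) (hpV2s : ∑ v, pV2 v = 1)
    (hpX1 : ∀ v x, 0 ≤ pX1 v x) (hpX1s : ∀ v, ∑ x, pX1 v x = 1)
    (hpX2 : ∀ v x, 0 ≤ pX2 v x) (hpX2s : ∀ v, ∑ x, pX2 v x = 1)
    (hpX3 : ∀ v1 v2 x, 0 ≤ pX3 v1 v2 x) (hpX3s : ∀ v1 v2, ∑ x, pX3 v1 v2 x = 1)
    -- H(S1|S2,W3) < κ·I(X1;Y3|X2,V1,X3)
    (h1 : condEnt (opSepLaw src ch pV1 pX1 pV2 pX2 pX3)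
        (fun z => z.1.1) (fun z => (z.1.2.1, z.1.2.2.2))
      < κ * condMutInfo (opSepLaw src ch pV1 pX1 pV2 pX2 pX3)
        (fun z => z.2.2.2.1) (fun z => z.2.2.2.2.2.2.2)
        (fun z => (z.2.2.2.2.1, z.2.1, z.2.2.2.2.2.1)))
    -- H(S2|S1,W3) < κ·I(X2;Y3|X1,V2,X3)
    (h2 : condEnt (opSepLaw src ch pV1 pX1 pV2 pX2 pX3)
        (fun z => z.1.2.1) (fun z => (z.1.1, z.1.2.2.2))
      < κ * condMutInfo (opSepLaw src ch pV1 pX1 pV2 pX2 pX3)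
        (fun z => z.2.2.2.2.1) (fun z => z.2.2.2.2.2.2.2)
        (fun z => (z.2.2.2.1, z.2.2.1, z.2.2.2.2.2.1)))
    -- H(S1,S2|W3) < κ·I(X1,X2;Y3|V1,V2,X3)
    (h3 : condEnt (opSepLaw src ch pV1 pX1 pV2 pX2 pX3)
        (fun z => (z.1.1, z.1.2.1)) (fun z => z.1.2.2.2)
      < κ * condMutInfo (opSepLaw src ch pV1 pX1 pV2 pX2 pX3)
        (fun z => (z.2.2.2.1, z.2.2.2.2.1)) (fun z => z.2.2.2.2.2.2.2)
        (fun z => (z.2.1, z.2.2.1, z.2.2.2.2.2.1)))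
    -- H(S1|S2,W) < κ·I(X1,X3;Y|X2,V2)
    (h4 : condEnt (opSepLaw src ch pV1 pX1 pV2 pX2 pX3)
        (fun z => z.1.1) (fun z => (z.1.2.1, z.1.2.2.1))
      < κ * condMutInfo (opSepLaw src ch pV1 pX1 pV2 pX2 pX3)
        (fun z => (z.2.2.2.1, z.2.2.2.2.2.1)) (fun z => z.2.2.2.2.2.2.1)
        (fun z => (z.2.2.2.2.1, z.2.2.1)))
    -- H(S2|S1,W) < κ·I(X2,X3;Y|X1,V1)
    (h5 : condEnt (opSepLaw src ch pV1 pX1 pV2 pX2 pX3)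
        (fun z => z.1.2.1) (fun z => (z.1.1, z.1.2.2.1))
      < κ * condMutInfo (opSepLaw src ch pV1 pX1 pV2 pX2 pX3)
        (fun z => (z.2.2.2.2.1, z.2.2.2.2.2.1)) (fun z => z.2.2.2.2.2.2.1)
        (fun z => (z.2.2.2.1, z.2.1)))
    -- H(S1,S2|W) < κ·I(X1,X2,X3;Y)
    (h6 : condEnt (opSepLaw src ch pV1 pX1 pV2 pX2 pX3)
        (fun z => (z.1.1, z.1.2.1)) (fun z => z.1.2.2.1)
      < κ * mutInfo (opSepLaw src ch pV1 pX1 pV2 pX2 pX3)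
        (fun z => (z.2.2.2.1, z.2.2.2.2.1, z.2.2.2.2.2.1)) (fun z => z.2.2.2.2.2.2.1)) :
    marcAchievable src ch κ := by
  let L : InLaw V1 V2 X1 X2 X3 := ⟨pV1, pV2, pX1, pX2, pX3, ⟨hpV1, hpV1s⟩, ⟨hpV2, hpV2s⟩,
    fun v => ⟨hpX1 v, hpX1s v⟩, fun v => ⟨hpX2 v, hpX2s v⟩, fun v w => ⟨hpX3 v w, hpX3s v w⟩⟩
  have es := ex_opSepLaw_source src ch L
  have er := ex_opSepLaw_relay src ch L
  have ed := ex_opSepLaw_dest src ch L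
  refine marcAchievable_of_rates src ch L hκ ?_ ?_
  · unfold relayMarg
    rw [srcEnt_eq _ _ _ src.nonneg, L.relayInfo_eq (BlockScheme.relayCh_isPmf ch)]
    intro j
    fin_cases j
    · exact (condEnt_comp es (fun s => s.1) fun s => (s.2.1, s.2.2.2)) ▸
        (condMutInfo_comp er (fun t => t.1.1.1.2) (fun t => t.2)
          fun t => (t.1.1.2, t.1.1.1.1.1, t.1.2)) ▸ h1
    · exact (condEnt_comp es (fun s => s.2.1) fun s => (s.1, s.2.2.2)) ▸
        (condMutInfo_comp er (fun t => t.1.1.2) (fun t => t.2)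
          fun t => (t.1.1.1.2, t.1.1.1.1.2, t.1.2)) ▸ h2
    · exact (condEnt_comp es (fun s => (s.1, s.2.1)) fun s => s.2.2.2) ▸
        (condMutInfo_comp er (fun t => (t.1.1.1.2, t.1.1.2)) (fun t => t.2)
          fun t => (t.1.1.1.1.1, t.1.1.1.1.2, t.1.2)) ▸ h3
  · unfold destMarg
    rw [srcEnt_eq _ _ _ src.nonneg, L.destInfo_eq (BlockScheme.destCh_isPmf ch)]
    intro j
    fin_cases j
    · exact (condEnt_comp es (fun s => s.1) fun s => (s.2.1, s.2.2.1)) ▸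
        (condMutInfo_comp ed (fun t => (t.1.1.1.2, t.1.2)) (fun t => t.2)
          fun t => (t.1.1.2, t.1.1.1.1.2)) ▸ h4
    · exact (condEnt_comp es (fun s => s.2.1) fun s => (s.1, s.2.2.1)) ▸
        (condMutInfo_comp ed (fun t => (t.1.1.2, t.1.2)) (fun t => t.2)
          fun t => (t.1.1.1.2, t.1.1.1.1.1)) ▸ h5
    · exact (condEnt_comp es (fun s => (s.1, s.2.1)) fun s => s.2.2.1) ▸
        (mutInfo_comp ed (fun t => (t.1.1.1.2, t.1.1.2, t.1.2)) (fun t => t.2)) ▸ h6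

end OperationalSeparation

end Paper
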